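/- arXiv:1908.03139 — 2 statements merged into one kernel-verified Lean document; each statement's English description precedes it below -/
import Mathlib

section
/- Let k be a field and let F ∈ k[X₀,X₁,X₂,X₃] be a homogeneous polynomial of degree 3 defining a smooth cubic surface in P³ over k. If there exists a finite field extension K/k whose degree [K:k] is not divisible by 3 and a nontrivial zero of F in K, then there exists a finite field extension L/k with [L:k] equal to 1, 4, or 10 in which F has a nontrivial zero. -/
universe u v

section

open MvPolynomial

/-- Every extension of degree less than `n` in which `F` has a nontrivial zero has degree
divisible by three. -/
def ZeroDegreesDivisible {k : Type u} [Field k] (F : MvPolynomial (Fin 4) k) (n : ℕ) : Prop :=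
  ∀ (L : Type u) [Field L] [Algebra k L] [FiniteDimensional k L], Module.finrank k L < n →
    (∃ y : Fin 4 → L, y ≠ 0 ∧ aeval y F = 0) → 3 ∣ Module.finrank k L

theorem ZeroDegreesDivisible.three_dvd_finrank {k : Type u} [Field k]
    {F : MvPolynomial (Fin 4) k} {n : ℕ} (hF : ZeroDegreesDivisible F n)
    {Q : Type u} [CommRing Q] [Algebra k Q] (x : Fin 4 → Q) (hx : aeval x F = 0)
    (hspan : Ideal.span (Set.range x) = ⊤) (d : ℕ) :
    ∀ (V : Type u) [AddCommGroup V] [Module k V] [Module Q V] [IsScalarTower k Q V]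
      [FiniteDimensional k V], Module.finrank k V = d → d < n → 3 ∣ d := by
  induction d using Nat.strong_induction_on with
  | _ d ih =>
  intro V _ _ _ _ _ hV hd
  by_cases h0 : Module.finrank k V = 0
  · simp [← hV, h0]
  have hnt : Nontrivial V := Module.nontrivial_of_finrank_pos (Nat.pos_of_ne_zero h0)
  have : IsArtinian Q V := isArtinian_of_tower k inferInstance
  obtain ⟨U, hU⟩ := IsAtomic.exists_atom (Submodule Q V)
  have hUs : IsSimpleModule Q U := isSimpleModule_iff_isAtom.2 hU
  obtain ⟨m, hm, ⟨e⟩⟩ := isSimpleModule_iff_quot_maximal.1 hUs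
  let _ : Field (Q ⧸ m) := Ideal.Quotient.field m
  let e' : U ≃ₗ[k] (Q ⧸ m) := e.restrictScalars k
  have : FiniteDimensional k U := inferInstanceAs (FiniteDimensional k (U.restrictScalars k))
  have : FiniteDimensional k (Q ⧸ m) := e'.finiteDimensional
  have hsum : Module.finrank k (V ⧸ U) + Module.finrank k U = Module.finrank k V :=
    Submodule.finrank_quotient_add_finrank (U.restrictScalars k)
  have hpos : 0 < Module.finrank k U := by
    rw [e'.finrank_eq]; exact Module.finrank_pos
  have h1 : 3 ∣ Module.finrank k (Q ⧸ m) := by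
    refine hF (Q ⧸ m) (by rw [← e'.finrank_eq]; omega)
      ⟨fun i => Ideal.Quotient.mkₐ k m (x i), ?_, ?_⟩
    · intro h
      refine hm.ne_top (top_le_iff.1 ?_)
      rw [← hspan, Ideal.span_le]
      rintro _ ⟨i, rfl⟩
      exact Ideal.Quotient.eq_zero_iff_mem.1 (congrFun h i)
    · have := comp_aeval_apply (f := x) (Ideal.Quotient.mkₐ k m) F
      rw [hx, map_zero] at this
      exact this.symm
  have : FiniteDimensional k (V ⧸ U) :=
    inferInstanceAs (FiniteDimensional k (V ⧸ U.restrictScalars k))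
  have h2 := ih (Module.finrank k (V ⧸ U)) (by omega) (V ⧸ U) rfl (by omega)
  rw [← hV, ← hsum, e'.finrank_eq]
  exact dvd_add h2 h1

end

theorem castelnuovo_numerics (v l : ℕ → ℕ) (D e : ℕ) (hv0 : v 0 = 1)
    (hv : ∀ i, v (i + 1) + l (i + 1) = v i + min (i + 2) 3) (hl0 : l 0 = 0)
    (hl3 : ∀ i, l i ≤ min (i + 1) 3) (hmono : ∀ i, l i ≤ l (i + 1))
    (hstrict : ∀ i, 0 < l i → l i = 3 ∨ l i < l (i + 1)) (hD : 0 < l D)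
    (he : ∃ N, ∀ i ≥ N, v i = e) :
    e ≤ 3 * D ∧ ∀ j, e = 3 * j → ∀ a,
      6 * j * a + 3 * j ≤ 2 * (∑ i ∈ Finset.range (a + 1), v i) + 3 * j * j := by
  classical
  have hex : ∃ m, 0 < l m := ⟨D, hD⟩
  obtain ⟨m, hm, hmin⟩ : ∃ m, 0 < l m ∧ ∀ i < m, l i = 0 :=
    ⟨Nat.find hex, Nat.find_spec hex, fun i hi => by simpa using Nat.find_min hex hi⟩
  have hmD : m ≤ D := by
    by_contra h
    have := hmin D (by omega)
    omega
  have hm0 : 0 < m := Nat.pos_of_ne_zero (by rintro rfl; omega)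
  have hlow : ∀ i, i < m → 1 ≤ i → v i = 3 * i := by
    intro i hi h1
    induction i, h1 using Nat.le_induction with
    | base => have := hv 0; have := hmin 1 hi; simp_all
    | succ i h1 ih =>
      have h2 := hv i; have h3 := hmin (i + 1) hi; have h4 := ih (by omega)
      omega
  have hvm : v m + l m = 3 * m := by
    obtain ⟨i, rfl⟩ : ∃ i, m = i + 1 := ⟨m - 1, by omega⟩
    have h2 := hv i
    rcases Nat.eq_zero_or_pos i with rfl | hi
    · omega
    · have := hlow i (by omega) hi
      omega
  have hvm1 := hv m
  have hvm2 := hv (m + 1)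
  have h3m := hl3 m
  have h3m1 := hl3 (m + 1)
  have h3m2 := hl3 (m + 2)
  have hs0 := hstrict m hm
  have hm1 := hmono m
  have hm2 := hmono (m + 1)
  have hs1 := hstrict (m + 1) (by omega)
  simp only [Nat.add_assoc, Nat.reduceAdd] at *
  have hl2 : ∀ i ≥ m + 2, l i = 3 := by
    intro i hi
    induction i, hi using Nat.le_induction with
    | base => omega
    | succ i hi ih => have := hmono i; have := hl3 (i + 1); omega
  have hconst : ∀ i ≥ m + 2, v i = v (m + 2) := by
    intro i hi
    induction i, hi using Nat.le_induction with
    | base => rfl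
    | succ i hi ih => have := hv i; have := hl2 (i + 1) (by omega); omega
  have hev : e = v (m + 2) := by
    obtain ⟨N, hN⟩ := he
    rw [← hN (max N (m + 2)) (le_max_left _ _)]
    exact hconst _ (le_max_right _ _)
  refine ⟨by omega, ?_⟩
  intro j hj
  -- the values of `v` are those of a plane curve of degree `3`
  have hj1 : 1 ≤ j := by omega
  have hsmall : ∀ i, i < j → 1 ≤ i → v i = 3 * i := fun i hi h1 => hlow i (by omega) h1
  have hvj : 3 * j ≤ v j + 1 := by
    rcases (show j = m ∨ j + 1 = m by omega) with rfl | h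
    · omega
    · have := hlow j (by omega) hj1
      omega
  have hbig : ∀ i, j < i → v i = 3 * j := by
    intro i hi
    by_cases h2 : m + 2 ≤ i
    · rw [hconst i h2]; omega
    · rcases (show i = m ∨ i = m + 1 by omega) with rfl | rfl <;> omega
  have hsum : ∀ a, a < j → 2 * (∑ i ∈ Finset.range (a + 1), v i) = 2 + 3 * a * (a + 1) := by
    intro a ha
    induction a with
    | zero => simp [hv0]
    | succ a ih =>
      rw [Finset.sum_range_succ, mul_add, ih (by omega), hsmall (a + 1) ha (by omega)]
      ring
  intro a
  rcases Nat.lt_or_ge a j with ha | ha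
  · rw [hsum a ha]
    obtain ⟨t, rfl⟩ : ∃ t, j = a + 1 + t := ⟨j - a - 1, by omega⟩
    nlinarith
  · induction a, ha using Nat.le_induction with
    | base =>
      obtain ⟨t, rfl⟩ : ∃ t, j = t + 1 := ⟨j - 1, by omega⟩
      have := hsum t (by omega)
      rw [Finset.sum_range_succ]
      nlinarith
    | succ a ha ih =>
      rw [Finset.sum_range_succ, hbig (a + 1) (by omega)]
      nlinarith

section

open Polynomial

/-- The value at `(q, p)` of the homogenization in degree `i` of a univariate polynomial. -/
noncomputable def homEval (k : Type*) {B : Type*} [Field k] [CommRing B] [Algebra k B] (p q : B)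
    (i : ℕ) : k[X] →ₗ[k] B :=
  (MvPolynomial.aeval ![q, p]).toLinearMap ∘ₗ homogenizeLM i

section homEval

variable {k : Type*} {B : Type*} [Field k] [CommRing B] [Algebra k B] (p q : B)

theorem homEval_apply (i : ℕ) (f : k[X]) :
    homEval k p q i f = MvPolynomial.aeval ![q, p] (f.homogenize i) := rfl

theorem homEval_mul {i j : ℕ} {f g : k[X]} (hf : f.natDegree ≤ i) (hg : g.natDegree ≤ j) :
    homEval k p q (i + j) (f * g) = homEval k p q i f * homEval k p q j g := by
  simp [homEval_apply, homogenize_mul _ _ hf hg]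

@[simp] theorem homEval_one (i : ℕ) : homEval k p q i 1 = p ^ i := by
  simp [homEval_apply]

@[simp] theorem homEval_one_X : homEval k p q 1 X = q := by
  simp [homEval_apply]

@[simp] theorem homEval_zero_C (c : k) : homEval k p q 0 (C c) = algebraMap k B c := by
  simp [homEval_apply]

theorem homEval_succ {i : ℕ} {f : k[X]} (hf : f.natDegree ≤ i) :
    homEval k p q (i + 1) f = p * homEval k p q i f := by
  have := homEval_mul p q hf (natDegree_one (R := k).le.trans zero_le_one)
  simpa [mul_comm] using this

theorem homEval_succ_X_mul {i : ℕ} {f : k[X]} (hf : f.natDegree ≤ i) :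
    homEval k p q (i + 1) (X * f) = q * homEval k p q i f := by
  have := homEval_mul p q hf (natDegree_X (R := k)).le
  simpa [mul_comm] using this

theorem mem_degreeLT_succ_iff {f : k[X]} {i : ℕ} :
    f ∈ degreeLT k (i + 1) ↔ f.natDegree ≤ i := by
  rw [mem_degreeLT]
  by_cases hf : f = 0
  · simp [hf]
  · rw [degree_eq_natDegree hf]; norm_cast; omega

theorem map_homEval_succ (i : ℕ) :
    (degreeLT k (i + 2)).map (homEval k p q (i + 1)) =
      Submodule.span k {p, q} * (degreeLT k (i + 1)).map (homEval k p q i) := by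
  apply le_antisymm
  · rintro _ ⟨f, hf, rfl⟩
    have hf' := mem_degreeLT_succ_iff.1 hf
    have h1 : f.divX.natDegree ≤ i := by rw [natDegree_divX_eq_natDegree_tsub_one]; omega
    rw [← divX_mul_X_add f, map_add, mul_comm f.divX, homEval_succ_X_mul p q h1,
      homEval_succ p q (f := C (f.coeff 0)) (by simp)]
    refine add_mem (Submodule.mul_mem_mul (Submodule.subset_span (by simp))
      ⟨_, mem_degreeLT_succ_iff.2 h1, rfl⟩) (Submodule.mul_mem_mul
      (Submodule.subset_span (by simp)) ⟨_, mem_degreeLT_succ_iff.2 (by simp), rfl⟩)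
  · rw [Submodule.mul_le]
    rintro m hm _ ⟨f, hf, rfl⟩
    have hf' := mem_degreeLT_succ_iff.1 hf
    obtain ⟨a, b, rfl⟩ := Submodule.mem_span_pair.1 hm
    refine ⟨C a * f + C b * (X * f), mem_degreeLT_succ_iff.2 ?_, ?_⟩
    · refine natDegree_add_le_of_degree_le ?_ ?_
      · exact (natDegree_C_mul_le _ _).trans (by omega)
      · refine (natDegree_C_mul_le _ _).trans ?_
        exact natDegree_mul_le.trans (by simp; omega)
    · rw [map_add, ← smul_eq_C_mul, ← smul_eq_C_mul, map_smul, map_smul, homEval_succ p q hf',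
        homEval_succ_X_mul p q hf']
      simp [add_mul]

/-- Modulo `E * M ^ i`, every element of degree `i + 1` of the algebra generated by
`M = E ⊔ span {p, q}` is a form in `p` and `q`. -/
theorem pow_succ_eq_sup_map_homEval {E M : Submodule k B} (hM : M = E ⊔ Submodule.span k {p, q})
    (i : ℕ) : M ^ (i + 1) = E * M ^ i ⊔ (degreeLT k (i + 2)).map (homEval k p q (i + 1)) := by
  induction i with
  | zero =>
    have h0 : (degreeLT k (0 + 1)).map (homEval k p q 0) = 1 := by
      ext x
      rw [Submodule.mem_one]
      constructor
      · rintro ⟨f, hf, rfl⟩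
        have hf' := mem_degreeLT_succ_iff.1 hf
        rw [eq_C_of_natDegree_le_zero hf']
        exact ⟨_, (homEval_zero_C p q _).symm⟩
      · rintro ⟨c, rfl⟩
        exact ⟨C c, mem_degreeLT_succ_iff.2 (by simp), by simp⟩
    rw [map_homEval_succ, h0, zero_add, pow_one, pow_zero, mul_one, mul_one, hM]
  | succ i ih =>
    rw [map_homEval_succ, pow_succ' M (i + 1)]
    nth_rewrite 1 [hM]
    rw [Submodule.sup_mul]
    apply le_antisymm
    · refine sup_le le_sup_left ?_
      rw [ih, Submodule.mul_sup]
      refine sup_le (le_sup_of_le_left ?_) le_sup_right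
      rw [← mul_assoc, mul_comm _ E, mul_assoc, ← ih, pow_succ']
      gcongr
      rw [hM]; exact le_sup_right
    · refine sup_le le_sup_left (le_sup_of_le_right ?_)
      gcongr
      rw [ih]; exact le_sup_right

end homEval

end

section

open Polynomial

section

variable {k : Type*} {V : Type*} [Field k] [CommRing V] [Algebra k V] [FiniteDimensional k V]

/-- For a linear map `f` and a subspace `N` of `W` containing `W ⊓ ker f`, the codimension of `N`
in `W` is that of its image. -/
theorem finrank_add_finrank_map {E E' : Type*} [AddCommGroup E] [Module k E] [AddCommGroup E']
    [Module k E'] (f : E →ₗ[k] E') (W : Submodule k E) [FiniteDimensional k W] :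
    Module.finrank k (W.map f) + Module.finrank k (W ⊓ LinearMap.ker f : Submodule k E) =
      Module.finrank k W := by
  have h1 := LinearMap.finrank_range_add_finrank_ker (f.domRestrict W)
  rw [LinearMap.range_domRestrict] at h1
  rw [← h1, LinearMap.ker_domRestrict]
  congr 1
  rw [← Submodule.finrank_map_subtype_eq W, Submodule.map_comap_subtype]

instance (i : ℕ) : FiniteDimensional k (degreeLT k i) :=
  (degreeLTEquiv k i).symm.finiteDimensional

theorem finrank_degreeLT (i : ℕ) : Module.finrank k (degreeLT k i) = i := by
  rw [(degreeLTEquiv k i).finrank_eq]; simp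

/-- A finite algebra generated by `1, p, q`, with relations like those of a hyperplane section of
a curve on a cubic surface without points of low degree. -/
theorem plane_scheme_numerics [Nontrivial V] (p q : V) (T : Submodule k V)
    (hT : T = 1 ⊔ Submodule.span k {p, q}) (hgen : ∃ N, T ^ N = ⊤)
    (χ : k[X]) (hχ : Irreducible χ) (hχ3 : χ.natDegree = 3) (h1 : homEval k p q 3 χ ∈ T ^ 2)
    (D : ℕ) (g : k[X]) (hg : g ≠ 0) (hg2 : g.natDegree ≤ 2) (hgD : g.natDegree ≤ D + 1)
    (h2 : homEval k p q (D + 1) g ∈ T ^ D) :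
    Module.finrank k V ≤ 3 * (D + 1) ∧ ∀ j, Module.finrank k V = 3 * j → ∀ a,
      6 * j * a + 3 * j ≤
        2 * (∑ i ∈ Finset.range (a + 1), Module.finrank k ↥(T ^ i)) + 3 * j * j := by
  classical
  have hone : (1 : Submodule k V) ≤ T := hT ▸ le_sup_left
  have hTmono : Monotone (fun i => T ^ i) := fun i j hij => pow_le_pow_right' hone hij
  have : Fact (Irreducible χ) := ⟨hχ⟩
  have hχm : χ ≠ 0 := hχ.ne_zero
  have : FiniteDimensional k (AdjoinRoot χ) := (AdjoinRoot.powerBasis hχm).finite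
  have hκ : Module.finrank k (AdjoinRoot χ) = 3 := by
    rw [(AdjoinRoot.powerBasis hχm).finrank, AdjoinRoot.powerBasis_dim, hχ3]
  let S : ℕ → Submodule k V := fun i => match i with | 0 => ⊥ | i + 1 => T ^ i
  have hS0 : S 0 = ⊥ := rfl
  have hSs : ∀ i, S (i + 1) = T ^ i := fun i => rfl
  have hTS : ∀ i, T * S i ≤ S (i + 1) := by
    intro i
    cases i with
    | zero => simp [hS0]
    | succ i => rw [hSs, hSs, pow_succ']
  have hSsucc : ∀ i, S (i + 1) = S i ⊔ (degreeLT k (i + 1)).map (homEval k p q i) := by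
    intro i
    cases i with
    | zero =>
      rw [hS0, bot_sup_eq, hSs, pow_zero]
      ext x
      rw [Submodule.mem_one]
      constructor
      · rintro ⟨c, rfl⟩
        exact ⟨C c, mem_degreeLT_succ_iff.2 (by simp), by simp⟩
      · rintro ⟨f, hf, rfl⟩
        rw [eq_C_of_natDegree_le_zero (mem_degreeLT_succ_iff.1 hf)]
        exact ⟨_, (homEval_zero_C p q _).symm⟩
    | succ i => rw [hSs, hSs, pow_succ_eq_sup_map_homEval p q hT i, one_mul]
  let N : ℕ → Submodule k k[X] := fun i => degreeLT k (i + 1) ⊓ (S i).comap (homEval k p q i)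
  let ψ : k[X] →ₗ[k] AdjoinRoot χ := (AdjoinRoot.mkₐ χ).toLinearMap
  have hψ : ∀ f, ψ f = AdjoinRoot.mk χ f := fun f => rfl
  have hker : ∀ i, degreeLT k (i + 1) ⊓ LinearMap.ker ψ ≤ N i := by
    rintro i f ⟨hf, hf0⟩
    refine ⟨hf, ?_⟩
    have hf' := mem_degreeLT_succ_iff.1 hf
    obtain ⟨g, rfl⟩ := AdjoinRoot.mk_eq_zero.1 (LinearMap.mem_ker.1 hf0)
    rcases eq_or_ne g 0 with rfl | hg
    · simp
    rw [natDegree_mul hχm hg, hχ3] at hf'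
    obtain ⟨t, rfl⟩ : ∃ t, i = 3 + t := ⟨i - 3, by omega⟩
    rw [SetLike.mem_coe, Submodule.mem_comap, homEval_mul p q hχ3.le (by omega)]
    rw [show 3 + t = (2 + t) + 1 by omega, hSs, pow_add]
    refine Submodule.mul_mem_mul h1 ?_
    have : homEval k p q t g ∈ S (t + 1) := by
      rw [hSsucc]
      exact Submodule.mem_sup_right ⟨g, mem_degreeLT_succ_iff.2 (by omega), rfl⟩
    exact this
  have hNle : ∀ i, N i ≤ degreeLT k (i + 1) := fun i => inf_le_left
  have hNfin : ∀ i, FiniteDimensional k (N i) := fun i =>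
    Submodule.finiteDimensional_of_le (hNle i)
  let l : ℕ → ℕ := fun i => Module.finrank k ((N i).map ψ)
  have hcount : ∀ i, Module.finrank k (S (i + 1)) + l i =
      Module.finrank k (S i) + Module.finrank k ((degreeLT k (i + 1)).map ψ) := by
    intro i
    have a1 := finrank_add_finrank_map ψ (degreeLT k (i + 1))
    have a2 := finrank_add_finrank_map ψ (N i)
    have a3 : N i ⊓ LinearMap.ker ψ = degreeLT k (i + 1) ⊓ LinearMap.ker ψ :=
      le_antisymm (inf_le_inf_right _ (hNle i)) (le_inf (hker i) inf_le_right)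
    rw [a3] at a2
    have a4 := finrank_add_finrank_map ((S i).mkQ ∘ₗ homEval k p q i) (degreeLT k (i + 1))
    have a5 : degreeLT k (i + 1) ⊓ LinearMap.ker ((S i).mkQ ∘ₗ homEval k p q i) = N i := by
      rw [LinearMap.ker_comp, Submodule.ker_mkQ]
    have a6 : (degreeLT k (i + 1)).map ((S i).mkQ ∘ₗ homEval k p q i) =
        (S (i + 1)).map (S i).mkQ := by
      rw [hSsucc, Submodule.map_sup, Submodule.map_comp]
      simp
    have a7 := finrank_add_finrank_map (S i).mkQ (S (i + 1))
    have a8 : S (i + 1) ⊓ LinearMap.ker (S i).mkQ = S i := by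
      rw [Submodule.ker_mkQ, inf_eq_right, hSsucc]
      exact le_sup_left
    rw [a8] at a7
    rw [a5, a6] at a4
    simp only [l]
    omega
  have hκi : ∀ i, Module.finrank k ((degreeLT k (i + 1)).map ψ) = min (i + 1) 3 := by
    have low : ∀ i ≤ 2, Module.finrank k ((degreeLT k (i + 1)).map ψ) = i + 1 := by
      intro i hi
      have a1 := finrank_add_finrank_map ψ (degreeLT k (i + 1))
      have : degreeLT k (i + 1) ⊓ LinearMap.ker ψ = ⊥ := by
        rw [eq_bot_iff]
        rintro f ⟨hf, hf0⟩
        have hf' := mem_degreeLT_succ_iff.1 hf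
        have hd := AdjoinRoot.mk_eq_zero.1 (LinearMap.mem_ker.1 hf0)
        exact eq_zero_of_dvd_of_natDegree_lt hd (by omega)
      rw [this, finrank_bot, finrank_degreeLT] at a1
      omega
    intro i
    rcases Nat.lt_or_ge i 2 with hi | hi
    · rw [low i (by omega)]; omega
    · have b1 : Module.finrank k ((degreeLT k (2 + 1)).map ψ) ≤
          Module.finrank k ((degreeLT k (i + 1)).map ψ) :=
        Submodule.finrank_mono (Submodule.map_mono (degreeLT_mono (by omega)))
      have b2 := Submodule.finrank_le ((degreeLT k (i + 1)).map ψ)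
      rw [low 2 le_rfl] at b1
      omega
  have hp : p ∈ T := hT ▸ Submodule.mem_sup_right (Submodule.subset_span (by simp))
  have hq : q ∈ T := hT ▸ Submodule.mem_sup_right (Submodule.subset_span (by simp))
  have hN1 : ∀ i, N i ≤ N (i + 1) := by
    rintro i f ⟨hf, hf1⟩
    have hf' := mem_degreeLT_succ_iff.1 hf
    refine ⟨mem_degreeLT_succ_iff.2 (by omega), ?_⟩
    rw [SetLike.mem_coe, Submodule.mem_comap, homEval_succ p q hf']
    exact hTS i (Submodule.mul_mem_mul hp hf1)
  have hNX : ∀ i, ∀ f ∈ N i, X * f ∈ N (i + 1) := by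
    rintro i f ⟨hf, hf1⟩
    have hf' := mem_degreeLT_succ_iff.1 hf
    refine ⟨mem_degreeLT_succ_iff.2 (natDegree_mul_le.trans (by simp; omega)), ?_⟩
    rw [SetLike.mem_coe, Submodule.mem_comap, homEval_succ_X_mul p q hf']
    exact hTS i (Submodule.mul_mem_mul hq hf1)
  have hlmono : ∀ i, (N i).map ψ ≤ (N (i + 1)).map ψ := fun i => Submodule.map_mono (hN1 i)
  have key := castelnuovo_numerics (fun i => Module.finrank k ↥(T ^ i)) l (D + 1)
    (Module.finrank k V) ?_ ?_ ?_ ?_ ?_ ?_ ?_ ?_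
  · exact key
  · rw [pow_zero, Submodule.one_eq_span]
    exact finrank_span_singleton one_ne_zero
  · intro i
    have := hcount (i + 1)
    rw [hκi] at this
    exact this
  · have : N 0 = ⊥ := by
      rw [eq_bot_iff]
      rintro f ⟨hf, hf1⟩
      have hf' := mem_degreeLT_succ_iff.1 hf
      rw [SetLike.mem_coe, Submodule.mem_comap, hS0, Submodule.mem_bot,
        eq_C_of_natDegree_le_zero hf', homEval_zero_C] at hf1
      rw [eq_C_of_natDegree_le_zero hf', (FaithfulSMul.algebraMap_injective k V)
        (hf1.trans (map_zero _).symm)]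
      simp
    simp [l, this]
  · intro i
    rw [← hκi]
    exact Submodule.finrank_mono (Submodule.map_mono (hNle i))
  · exact fun i => Submodule.finrank_mono (hlmono i)
  · intro i hi
    by_contra! hcon
    have heq : (N i).map ψ = (N (i + 1)).map ψ :=
      Submodule.eq_of_le_of_finrank_le (hlmono i) hcon.2
    -- the image is stable under multiplication by the root, hence an ideal of a field
    have hst : ∀ f : k[X], ∀ x ∈ (N i).map ψ, AdjoinRoot.mk χ f * x ∈ (N i).map ψ := by
      intro f x hx
      induction f using Polynomial.induction_on' with
      | add f g hf hg => rw [map_add, add_mul]; exact add_mem hf hg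
      | monomial n c =>
        induction n with
        | zero =>
          rw [monomial_zero_left, AdjoinRoot.mk_C, ← AdjoinRoot.algebraMap_eq, ← Algebra.smul_def]
          exact Submodule.smul_mem _ _ hx
        | succ n ih =>
          rw [← monomial_mul_X, mul_comm _ X, map_mul, mul_assoc]
          obtain ⟨f, hf, hfx⟩ := ih
          rw [← hfx, hψ, ← map_mul, heq]
          exact ⟨_, hNX i f hf, rfl⟩
    obtain ⟨x, hx, hx0⟩ := (Submodule.ne_bot_iff _).1
      (Submodule.one_le_finrank_iff.1 (Nat.succ_le_of_lt hi))
    have htop : (N i).map ψ = ⊤ := by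
      rw [eq_top_iff]
      rintro y -
      obtain ⟨f, hf⟩ := AdjoinRoot.mk_surjective (y * x⁻¹)
      have := hst f x hx
      rwa [hf, inv_mul_cancel_right₀ hx0] at this
    apply hcon.1
    change Module.finrank k ((N i).map ψ) = 3
    rw [htop, finrank_top, hκ]
  · have hgN : g ∈ N (D + 1) := ⟨mem_degreeLT_succ_iff.2 hgD, h2⟩
    have hg0 : ψ g ≠ 0 := fun h =>
      hg (eq_zero_of_dvd_of_natDegree_lt (AdjoinRoot.mk_eq_zero.1 h) (by omega))
    refine Submodule.one_le_finrank_iff.2 fun h => hg0 ?_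
    exact (Submodule.mem_bot k).1 (h ▸ Submodule.mem_map_of_mem hgN)
  · obtain ⟨n, hn⟩ := hgen
    refine ⟨n, fun i hi => ?_⟩
    have : T ^ i = ⊤ := eq_top_iff.2 (hn ▸ hTmono hi)
    change Module.finrank k ↥(T ^ i) = _
    rw [this, finrank_top]

end

end

section

variable {k : Type u} {A : Type u} [Field k] [CommRing A] [Algebra k A]

/-- A family of linear maps `τ i` which is multiplicative on the powers `M ^ i`. -/
structure IsMultiplicative {V : Type*} [CommRing V] [Algebra k V] (M : Submodule k A)
    (τ : ℕ → A →ₗ[k] V) : Prop where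
  map_one : τ 0 1 = 1
  map_mul : ∀ i j, ∀ r ∈ M ^ i, ∀ s ∈ M ^ j, τ (i + j) (r * s) = τ i r * τ j s

theorem IsMultiplicative.map_pow {V : Type*} [CommRing V] [Algebra k V] {M : Submodule k A}
    {τ : ℕ → A →ₗ[k] V} (h : IsMultiplicative M τ) (i : ℕ) :
    (M ^ i).map (τ i) = (M.map (τ 1)) ^ i := by
  induction i with
  | zero =>
    rw [pow_zero, pow_zero, Submodule.one_eq_span, Submodule.map_span, Set.image_singleton,
      h.map_one, Submodule.one_eq_span]
  | succ i ih =>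
    rw [pow_succ (M.map (τ 1)), ← ih]
    apply le_antisymm
    · rw [Submodule.map_le_iff_le_comap, pow_succ, Submodule.mul_le]
      intro r hr s hs
      rw [Submodule.mem_comap, h.map_mul i 1 r hr s (by simpa using hs)]
      exact Submodule.mul_mem_mul ⟨r, hr, rfl⟩ ⟨s, hs, rfl⟩
    · rw [Submodule.mul_le]
      rintro _ ⟨r, hr, rfl⟩ _ ⟨s, hs, rfl⟩
      rw [← h.map_mul i 1 r hr s (by simpa using hs)]
      refine ⟨r * s, ?_, rfl⟩
      rw [pow_succ]
      exact Submodule.mul_mem_mul hr hs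

theorem submodule_prod_mem_prod {ι : Type*} {s : Finset ι} {N : ι → Submodule k A} {x : ι → A}
    (h : ∀ i ∈ s, x i ∈ N i) : ∏ i ∈ s, x i ∈ ∏ i ∈ s, N i := by
  classical
  induction s using Finset.induction_on with
  | empty => simpa using Submodule.one_le.1 (le_refl (1 : Submodule k A))
  | insert i s hi ih =>
    rw [Finset.prod_insert hi, Finset.prod_insert hi]
    exact Submodule.mul_mem_mul (h i (by simp)) (ih fun j hj => h j (by simp [hj]))

open MvPolynomial in
theorem aeval_mem_pow {M : Submodule k A} {σ : Type*} {x : σ → A} (hx : ∀ i, x i ∈ M)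
    {F : MvPolynomial σ k} {D : ℕ} (hF : F.IsHomogeneous D) : aeval x F ∈ M ^ D := by
  rw [aeval_def, eval₂_eq]
  refine sum_mem fun d hd => ?_
  rw [← Algebra.smul_def]
  refine Submodule.smul_mem _ _ ?_
  have hD := hF (mem_support_iff.1 hd)
  rw [Finsupp.weight_apply, Finsupp.sum] at hD
  simp only [Pi.one_apply, smul_eq_mul, mul_one] at hD
  rw [← hD, ← Finset.prod_pow_eq_pow_sum]
  exact submodule_prod_mem_prod fun i hi => Submodule.pow_mem_pow _ (hx i) (d i)

open MvPolynomial in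
theorem IsMultiplicative.map_aeval {V : Type*} [CommRing V] [Algebra k V] {M : Submodule k A}
    {τ : ℕ → A →ₗ[k] V} (h : IsMultiplicative M τ) {σ : Type*} {x : σ → A} (hx : ∀ i, x i ∈ M)
    {F : MvPolynomial σ k} {D : ℕ} (hF : F.IsHomogeneous D) :
    τ D (aeval x F) = aeval (fun i => τ 1 (x i)) F := by
  have hp : ∀ i n, x i ^ n ∈ M ^ n ∧ τ n (x i ^ n) = τ 1 (x i) ^ n := by
    intro i n
    refine ⟨Submodule.pow_mem_pow _ (hx i) n, ?_⟩
    induction n with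
    | zero => simp [h.map_one]
    | succ n ih =>
      rw [pow_succ, h.map_mul n 1 _ (Submodule.pow_mem_pow _ (hx i) n) _ (by simpa using hx i), ih,
        pow_succ]
  have key : ∀ (s : Finset σ) (d : σ →₀ ℕ), ∏ i ∈ s, x i ^ d i ∈ M ^ (∑ i ∈ s, d i) ∧
      τ (∑ i ∈ s, d i) (∏ i ∈ s, x i ^ d i) = ∏ i ∈ s, τ 1 (x i) ^ d i := by
    classical
    intro s d
    induction s using Finset.induction_on with
    | empty => simpa [h.map_one] using Submodule.one_le.1 (le_refl (1 : Submodule k A))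
    | insert i s hi ih =>
      rw [Finset.prod_insert hi, Finset.sum_insert hi, Finset.prod_insert hi]
      refine ⟨?_, ?_⟩
      · rw [pow_add]; exact Submodule.mul_mem_mul (hp i _).1 ih.1
      · rw [h.map_mul _ _ _ (hp i _).1 _ ih.1, (hp i _).2, ih.2]
  rw [aeval_def, aeval_def, eval₂_eq, eval₂_eq, map_sum]
  refine Finset.sum_congr rfl fun d hd => ?_
  rw [← Algebra.smul_def, map_smul, ← Algebra.smul_def]
  have hD := hF (mem_support_iff.1 hd)
  rw [Finsupp.weight_apply, Finsupp.sum] at hD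
  simp only [Pi.one_apply, smul_eq_mul, mul_one] at hD
  conv_lhs => rw [← hD, (key _ _).2]

end

section

variable {k : Type u} {A : Type u} [Field k] [CommRing A] [Algebra k A] [IsDomain A]

/-- The subalgebra of the field of fractions generated by `M / l`, where `l ∈ M`. -/
def chartAlgebra (M : Submodule k A) (l : A) (hl : l ∈ M) : Subalgebra k (FractionRing A) where
  carrier := {x | ∃ N, ∃ r ∈ M ^ N, x * algebraMap A (FractionRing A) l ^ N = algebraMap A _ r}
  mul_mem' := by
    rintro x y ⟨N, r, hr, hx⟩ ⟨N', r', hr', hy⟩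
    refine ⟨N + N', r * r', by rw [pow_add]; exact Submodule.mul_mem_mul hr hr', ?_⟩
    rw [map_mul, ← hx, ← hy]; ring
  add_mem' := by
    rintro x y ⟨N, r, hr, hx⟩ ⟨N', r', hr', hy⟩
    refine ⟨N + N', r * l ^ N' + l ^ N * r', add_mem ?_ ?_, ?_⟩
    · rw [pow_add]; exact Submodule.mul_mem_mul hr (Submodule.pow_mem_pow _ hl _)
    · rw [pow_add]; exact Submodule.mul_mem_mul (Submodule.pow_mem_pow _ hl _) hr'
    · rw [map_add, map_mul, map_mul, ← hx, ← hy, map_pow, map_pow]; ring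
  algebraMap_mem' := by
    intro c
    refine ⟨0, algebraMap k A c, ?_, ?_⟩
    · rw [pow_zero]; exact Submodule.algebraMap_mem c
    · rw [pow_zero, mul_one, ← IsScalarTower.algebraMap_apply]

/-- If `l` is a nonzerodivisor modulo `G` in large degrees, then the homogeneous coordinate ring
modulo `(G, l - 1)` is described in large degrees by the powers of `M`. -/
theorem exists_chart (M : Submodule k A) [FiniteDimensional k M] (l : A) (hl : l ∈ M)
    (hl0 : l ≠ 0) (a : ℕ) (G : A) (hG : G ∈ M ^ a) (hG0 : G ≠ 0) (m N₀ : ℕ) (haN : a ≤ N₀)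
    (hrec : ∀ N ≥ N₀, ∀ r ∈ M ^ (N + 1), ∃ x ∈ M ^ N, ∃ y ∈ M ^ (N + 1 - a), r = l * x + G * y)
    (hdim : ∀ N ≥ N₀, Module.finrank k ↥(M ^ N) = Module.finrank k ↥(M ^ (N - a)) + m) :
    ∃ (V : Type u) (_ : CommRing V) (_ : Algebra k V) (τ : ℕ → A →ₗ[k] V),
      FiniteDimensional k V ∧ Module.finrank k V = m ∧ IsMultiplicative M τ ∧ τ 1 l = 1 ∧
      (∀ N ≥ N₀, (M ^ N).map (τ N) = ⊤) ∧
      (∀ N ≥ N₀, ∀ r ∈ M ^ N, τ N r = 0 ↔ ∃ s ∈ M ^ (N - a), r = G * s) ∧ τ a G = 0 := by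
  classical
  have hfin : ∀ N, FiniteDimensional k ↥(M ^ N) := fun N =>
    Module.Finite.iff_fg.2 ((Module.Finite.iff_fg.1 ‹FiniteDimensional k M›).pow N)
  let K := FractionRing A
  let ι := algebraMap A K
  have hι : Function.Injective ι := IsFractionRing.injective A K
  have hlι : ι l ≠ 0 := fun h => hl0 (hι (h.trans (map_zero ι).symm))
  have hlp : ∀ N, ι l ^ N ≠ 0 := fun N => pow_ne_zero N hlι
  let C := chartAlgebra M l hl
  have hmul : ∀ {N N' : ℕ} {r r' : A}, r ∈ M ^ N → r' ∈ M ^ N' → r * r' ∈ M ^ (N + N') :=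
    fun h h' => by rw [pow_add]; exact Submodule.mul_mem_mul h h'
  have hlpow : ∀ N, l ^ N ∈ M ^ N := fun N => Submodule.pow_mem_pow _ hl N
  -- the fraction `r / l ^ N`
  let σ : ∀ N, ↥(M ^ N) →ₗ[k] C := fun N =>
    { toFun := fun r => ⟨ι r / ι l ^ N, N, r, r.2, by rw [div_mul_cancel₀ _ (hlp N)]⟩
      map_add' := fun r s => by
        apply Subtype.ext
        change ι (r + s) / _ = ι r / _ + ι s / _
        rw [map_add, add_div]
      map_smul' := fun c r => by
        apply Subtype.ext
        change ι (c • (r : A)) / _ = c • (ι r / _)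
        rw [Algebra.smul_def c (r : A), Algebra.smul_def, map_mul, mul_div_assoc]
        rfl }
  have hσ : ∀ N (r : A) (hr : r ∈ M ^ N), (σ N ⟨r, hr⟩ : K) = ι r / ι l ^ N := fun _ _ _ => rfl
  let g : C := σ a ⟨G, hG⟩
  let J : Ideal C := Ideal.span {g}
  let π : C →ₐ[k] (C ⧸ J) := Ideal.Quotient.mkₐ k J
  have hτ : ∀ N, ∃ t : A →ₗ[k] (C ⧸ J), t ∘ₗ (M ^ N).subtype = π.toLinearMap ∘ₗ σ N :=
    fun N => LinearMap.exists_extend _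
  choose τ hτ using hτ
  have hτ' : ∀ N (r : A) (hr : r ∈ M ^ N), τ N r = π (σ N ⟨r, hr⟩) := fun N r hr =>
    LinearMap.congr_fun (hτ N) ⟨r, hr⟩
  have hπ : ∀ c, π c = 0 ↔ ∃ d, c = g * d := fun c => by
    rw [Ideal.Quotient.mkₐ_eq_mk, Ideal.Quotient.eq_zero_iff_mem, Ideal.mem_span_singleton']
    exact ⟨fun ⟨d, hd⟩ => ⟨d, by rw [← hd, mul_comm]⟩, fun ⟨d, hd⟩ => ⟨d, by rw [hd, mul_comm]⟩⟩
  -- `l` is a nonzerodivisor modulo `G`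
  have hinj : ∀ N ≥ N₀, ∀ r ∈ M ^ N, ∀ y ∈ M ^ (N + 1 - a), l * r = G * y →
      ∃ w ∈ M ^ (N - a), r = G * w := by
    intro N hN r hr y hy hry
    let Φ : (↥(M ^ N) × ↥(M ^ (N + 1 - a))) →ₗ[k] A :=
      LinearMap.coprod (LinearMap.mulLeft k l ∘ₗ (M ^ N).subtype)
        (LinearMap.mulLeft k G ∘ₗ (M ^ (N + 1 - a)).subtype)
    have hΦ : ∀ x y, Φ (x, y) = l * x + G * y := fun x y => rfl
    have hr1 : LinearMap.range Φ = M ^ (N + 1) := by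
      apply le_antisymm
      · rintro _ ⟨⟨x, y⟩, rfl⟩
        rw [hΦ]
        refine add_mem ?_ ?_
        · rw [mul_comm]
          exact hmul x.2 (by rw [pow_one]; exact hl)
        · have := hmul hG y.2
          rwa [show a + (N + 1 - a) = N + 1 by omega] at this
      · intro r hr
        obtain ⟨x, hx, y, hy, rfl⟩ := hrec N hN r hr
        exact ⟨(⟨x, hx⟩, ⟨y, hy⟩), rfl⟩
    have hrk := LinearMap.finrank_range_add_finrank_ker Φ
    rw [hr1, Module.finrank_prod] at hrk
    have hΨmem : ∀ w : ↥(M ^ (N - a)), G * w ∈ M ^ N := fun w => by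
      have := hmul hG w.2
      rwa [show a + (N - a) = N by omega] at this
    have hΨmem' : ∀ w : ↥(M ^ (N - a)), -(l * (w : A)) ∈ M ^ (N + 1 - a) := fun w => by
      have := hmul w.2 (show l ∈ M ^ 1 by rwa [pow_one])
      rw [show N + 1 - a = N - a + 1 by omega, mul_comm]
      exact neg_mem this
    let Ψ : ↥(M ^ (N - a)) →ₗ[k] (↥(M ^ N) × ↥(M ^ (N + 1 - a))) :=
      LinearMap.prod
        ((LinearMap.mulLeft k G ∘ₗ (M ^ (N - a)).subtype).codRestrict _ hΨmem)
        ((-(LinearMap.mulLeft k l ∘ₗ (M ^ (N - a)).subtype)).codRestrict _ hΨmem')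
    have hΨinj : Function.Injective Ψ := by
      intro w w' hww
      have h1 := congrArg (fun p => (p.1 : A)) hww
      have h2 : G * (w : A) = G * w' := h1
      exact Subtype.ext (mul_left_cancel₀ hG0 h2)
    have hΨrange : LinearMap.range Ψ = LinearMap.ker Φ := by
      apply Submodule.eq_of_le_of_finrank_le
      · rintro _ ⟨w, rfl⟩
        rw [LinearMap.mem_ker]
        change l * (G * (w : A)) + G * (-(l * (w : A))) = 0
        ring
      · rw [LinearMap.finrank_range_of_inj hΨinj]
        have e1 := hdim N hN
        have e2 := hdim (N + 1) (by omega)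
        omega
    have hk : ((⟨r, hr⟩, -⟨y, hy⟩) : ↥(M ^ N) × ↥(M ^ (N + 1 - a))) ∈ LinearMap.ker Φ := by
      rw [LinearMap.mem_ker]
      change l * r + G * (-y) = 0
      rw [hry]; ring
    rw [← hΨrange] at hk
    obtain ⟨w, hw⟩ := hk
    exact ⟨w, w.2, (congrArg (fun p => (p.1 : A)) hw).symm⟩
  have hinj' : ∀ t, ∀ N ≥ N₀, ∀ r ∈ M ^ N, (∃ y ∈ M ^ (N + t - a), l ^ t * r = G * y) →
      ∃ w ∈ M ^ (N - a), r = G * w := by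
    intro t
    induction t with
    | zero =>
      rintro N hN r hr ⟨y, hy, h⟩
      exact ⟨y, hy, by simpa using h⟩
    | succ t ih =>
      rintro N hN r hr ⟨y, hy, h⟩
      obtain ⟨w, hw, hw'⟩ := ih (N + 1) (by omega) (r * l) (hmul hr (by rwa [pow_one]))
        ⟨y, by rwa [show N + 1 + t - a = N + (t + 1) - a by omega], by rw [← h]; ring⟩
      exact hinj N hN r hr w hw (by rw [← hw', mul_comm])
  have hker : ∀ N ≥ N₀, ∀ r ∈ M ^ N, τ N r = 0 ↔ ∃ s ∈ M ^ (N - a), r = G * s := by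
    intro N hN r hr
    rw [hτ' N r hr, hπ]
    constructor
    · rintro ⟨⟨d, N', s, hs, hd⟩, h⟩
      have h1 : ι r / ι l ^ N = ι G / ι l ^ a * d := congrArg Subtype.val h
      have h2 : l ^ (a + N') * r = G * (s * l ^ N) := by
        apply hι
        simp only [map_mul, map_pow]
        rw [← show d * ι l ^ N' = ι s from hd]
        rw [div_eq_iff (hlp N), div_mul_eq_mul_div, div_mul_eq_mul_div, eq_div_iff (hlp a)] at h1
        rw [pow_add]
        linear_combination ι l ^ N' * h1
      refine hinj' (a + N') N hN r hr ⟨s * l ^ N, ?_, h2⟩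
      rw [show N + (a + N') - a = N' + N by omega]
      exact hmul hs (hlpow N)
    · rintro ⟨s, hs, rfl⟩
      refine ⟨σ (N - a) ⟨s, hs⟩, Subtype.ext ?_⟩
      change ι (G * s) / ι l ^ N = ι G / ι l ^ a * (ι s / ι l ^ (N - a))
      rw [div_mul_div_comm, ← pow_add, ← map_mul, show a + (N - a) = N by omega]
  have hsurj : ∀ N ≥ N₀, (M ^ N).map (τ N) = ⊤ := by
    intro N hN
    rw [eq_top_iff]
    have key : ∀ N', ∀ s (hs : s ∈ M ^ N'), π (σ N' ⟨s, hs⟩) ∈ (M ^ N).map (τ N) := by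
      intro N'
      induction N' with
      | zero =>
        intro s hs
        refine ⟨s * l ^ N, by simpa using hmul hs (hlpow N), ?_⟩
        rw [hτ' N _ (by simpa using hmul hs (hlpow N))]
        congr 1
        apply Subtype.ext
        change ι (s * l ^ N) / ι l ^ N = ι s / ι l ^ 0
        rw [map_mul, map_pow, mul_div_cancel_right₀ _ (hlp N), pow_zero, div_one]
      | succ N' ih =>
        intro s hs
        by_cases hNN : N' < N
        · have hm : s * l ^ (N - (N' + 1)) ∈ M ^ N := by
            have := hmul hs (hlpow (N - (N' + 1)))
            rwa [show N' + 1 + (N - (N' + 1)) = N by omega] at this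
          refine ⟨s * l ^ (N - (N' + 1)), hm, ?_⟩
          rw [hτ' N _ hm]
          congr 1
          apply Subtype.ext
          change ι (s * l ^ (N - (N' + 1))) / ι l ^ N = ι s / ι l ^ (N' + 1)
          rw [map_mul, map_pow, div_eq_div_iff (hlp _) (hlp _), mul_assoc, ← pow_add,
            show N - (N' + 1) + (N' + 1) = N by omega]
        · obtain ⟨x, hx, y, hy, rfl⟩ := hrec N' (by omega) s hs
          have h1 : σ (N' + 1) ⟨l * x + G * y, hs⟩ =
              σ N' ⟨x, hx⟩ + g * σ (N' + 1 - a) ⟨y, hy⟩ := by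
            apply Subtype.ext
            change ι (l * x + G * y) / ι l ^ (N' + 1) =
              ι x / ι l ^ N' + ι G / ι l ^ a * (ι y / ι l ^ (N' + 1 - a))
            rw [div_mul_div_comm, ← pow_add, show a + (N' + 1 - a) = N' + 1 by omega, map_add,
              map_mul, map_mul, add_div, pow_succ' (ι l) N', mul_div_mul_left _ _ hlι]
          have h2 : π (g * σ (N' + 1 - a) ⟨y, hy⟩) = 0 := (hπ _).2 ⟨_, rfl⟩
          rw [h1, map_add, h2, add_zero]
          exact ih x hx
    rintro v -
    obtain ⟨⟨c, N', s, hs, hc⟩, rfl⟩ := Ideal.Quotient.mkₐ_surjective k J v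
    have : (⟨c, N', s, hs, hc⟩ : C) = σ N' ⟨s, hs⟩ := by
      apply Subtype.ext
      change c = ι s / ι l ^ N'
      rw [eq_div_iff (hlp N')]
      exact hc
    rw [this]
    exact key N' s hs
  have hVfin : FiniteDimensional k (C ⧸ J) := by
    refine Module.finite_def.2 ?_
    rw [← hsurj N₀ le_rfl]
    exact (Module.Finite.iff_fg.1 (hfin N₀)).map _
  refine ⟨C ⧸ J, inferInstance, inferInstance, τ, hVfin, ?_, ⟨?_, ?_⟩, ?_, hsurj, hker, ?_⟩
  · have h1 := finrank_add_finrank_map (τ N₀) (M ^ N₀)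
    rw [hsurj N₀ le_rfl, finrank_top] at h1
    have h2 : M ^ N₀ ⊓ LinearMap.ker (τ N₀) = (M ^ (N₀ - a)).map (LinearMap.mulLeft k G) := by
      ext r
      constructor
      · rintro ⟨hr, hr0⟩
        obtain ⟨s, hs, rfl⟩ := (hker N₀ le_rfl r hr).1 hr0
        exact ⟨s, hs, rfl⟩
      · rintro ⟨s, hs, rfl⟩
        have : G * s ∈ M ^ N₀ := by
          have := hmul hG hs
          rwa [show a + (N₀ - a) = N₀ by omega] at this
        exact ⟨this, (hker N₀ le_rfl _ this).2 ⟨s, hs, rfl⟩⟩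
    have h3 := (Submodule.equivMapOfInjective (LinearMap.mulLeft k G)
      (mul_right_injective₀ hG0) (M ^ (N₀ - a))).finrank_eq
    rw [h2] at h1
    have := hdim N₀ le_rfl
    omega
  · rw [hτ' 0 1 (by rw [pow_zero]; exact Submodule.one_le.1 le_rfl), ← map_one π]
    congr 1
    apply Subtype.ext
    change ι 1 / ι l ^ 0 = 1
    simp
  · intro i j r hr s hs
    rw [hτ' _ _ (hmul hr hs), hτ' _ _ hr, hτ' _ _ hs, ← map_mul]
    congr 1
    apply Subtype.ext
    change ι (r * s) / ι l ^ (i + j) = ι r / ι l ^ i * (ι s / ι l ^ j)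
    rw [div_mul_div_comm, map_mul, pow_add]
  · rw [hτ' 1 l (by rwa [pow_one]), ← map_one π]
    congr 1
    apply Subtype.ext
    change ι l / ι l ^ 1 = 1
    rw [pow_one, div_self hlι]
  · rw [hτ' a G hG, hπ]
    exact ⟨1, by rw [mul_one]⟩

end

section

variable {k : Type u} {A : Type u} [Field k] [CommRing A] [Algebra k A]

theorem finiteDimensional_submodule_pow (M : Submodule k A) [FiniteDimensional k M] (N : ℕ) :
    FiniteDimensional k ↥(M ^ N) :=
  Module.Finite.iff_fg.2 ((Module.Finite.iff_fg.1 ‹FiniteDimensional k M›).pow N)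

theorem mem_span_one_mul_iff {u : A} {W : Submodule k A} {r : A} :
    r ∈ Submodule.span k {1, u} * W ↔ ∃ x ∈ W, ∃ y ∈ W, r = u * x + y := by
  constructor
  · intro hr
    induction hr using Submodule.mul_induction_on' with
    | mem_mul_mem m hm n hn =>
      obtain ⟨a, b, rfl⟩ := Submodule.mem_span_pair.1 hm
      exact ⟨b • n, W.smul_mem _ hn, a • n, W.smul_mem _ hn, by simp [add_mul, add_comm]⟩
    | add r _ s _ hr hs =>
      obtain ⟨x, hx, y, hy, rfl⟩ := hr
      obtain ⟨x', hx', y', hy', rfl⟩ := hs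
      exact ⟨x + x', add_mem hx hx', y + y', add_mem hy hy', by ring⟩
  · rintro ⟨x, hx, y, hy, rfl⟩
    refine add_mem (Submodule.mul_mem_mul (Submodule.subset_span (by simp)) hx) ?_
    rw [← one_mul y]
    exact Submodule.mul_mem_mul (Submodule.subset_span (by simp)) hy

theorem finrank_pow_succ_add_le {M : Submodule k A} [FiniteDimensional k M] (h1 : (1 : A) ∈ M)
    {u : A} (hu : u ∈ M) {N : ℕ}
    (hrec : M ^ (N + 2) ≤ Submodule.span k {1, u} * M ^ (N + 1)) :
    Module.finrank k ↥(M ^ (N + 2)) + Module.finrank k ↥(M ^ N) ≤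
      2 * Module.finrank k ↥(M ^ (N + 1)) := by
  have hfin := finiteDimensional_submodule_pow M
  have hle : ∀ N, M ^ N ≤ M ^ (N + 1) := fun N =>
    pow_le_pow_right' (Submodule.one_le.2 h1) (Nat.le_succ N)
  have hum : ∀ N, ∀ r ∈ M ^ N, u * r ∈ M ^ (N + 1) := fun N r hr => by
    rw [pow_succ']; exact Submodule.mul_mem_mul hu hr
  let f := (M ^ (N + 1)).mkQ ∘ₗ LinearMap.mulLeft k u
  have e1 := finrank_add_finrank_map f (M ^ (N + 1))
  have e2 := finrank_add_finrank_map (M ^ (N + 1)).mkQ (M ^ (N + 2))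
  rw [Submodule.ker_mkQ, inf_eq_right.2 (hle (N + 1))] at e2
  have e3 : (M ^ (N + 1)).map f = (M ^ (N + 2)).map (M ^ (N + 1)).mkQ := by
    apply le_antisymm
    · rintro _ ⟨r, hr, rfl⟩
      exact ⟨u * r, hum _ r hr, rfl⟩
    · rintro _ ⟨r, hr, rfl⟩
      obtain ⟨x, hx, y, hy, rfl⟩ := mem_span_one_mul_iff.1 (hrec hr)
      refine ⟨x, hx, ?_⟩
      have hy0 : (M ^ (N + 1)).mkQ y = 0 := (Submodule.Quotient.mk_eq_zero _).2 hy
      rw [map_add, hy0, add_zero]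
      rfl
  have e4 : M ^ N ≤ M ^ (N + 1) ⊓ LinearMap.ker f := by
    refine fun r hr => ⟨hle N hr, ?_⟩
    exact (Submodule.Quotient.mk_eq_zero _).2 (hum N r hr)
  have : FiniteDimensional k ↥(M ^ (N + 1) ⊓ LinearMap.ker f) :=
    Submodule.finiteDimensional_of_le inf_le_left
  have e5 := Submodule.finrank_mono e4
  rw [e3] at e1
  omega

theorem exists_eventually_const_of_antitone (d : ℕ → ℕ) (N₁ : ℕ)
    (hd : ∀ N ≥ N₁, d (N + 1) ≤ d N) : ∃ N₂ ≥ N₁, ∀ N ≥ N₂, d N = d N₂ := by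
  have hne : {m | ∃ N ≥ N₁, d N = m}.Nonempty := ⟨_, N₁, le_rfl, rfl⟩
  obtain ⟨N₂, hN₂, hm⟩ := Nat.sInf_mem hne
  refine ⟨N₂, hN₂, fun N hN => le_antisymm ?_ ?_⟩
  · induction N, hN using Nat.le_induction with
    | base => rfl
    | succ N hN ih => exact (hd N (by omega)).trans ih
  · rw [hm]
    exact Nat.sInf_le ⟨N, by omega, rfl⟩

theorem exists_mem_pow_of_pow_stable {M : Submodule k A} (h1 : (1 : A) ∈ M)
    (hgen : ∀ r : A, ∃ N, r ∈ M ^ N) {N : ℕ} (h : M ^ (N + 1) = M ^ N) : M ^ N = ⊤ := by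
  have h2 : ∀ i, M ^ (N + i) = M ^ N := by
    intro i
    induction i with
    | zero => rfl
    | succ i ih => rw [← add_assoc, pow_succ, ih, ← pow_succ, h]
  rw [eq_top_iff]
  rintro r -
  obtain ⟨N', hN'⟩ := hgen r
  rw [← h2 N']
  exact pow_le_pow_right' (Submodule.one_le.2 h1) (Nat.le_add_left _ _) hN'

open Polynomial in
theorem pow_succ_le_of_relations {M : Submodule k A} {u v z : A}
    (hM : M = Submodule.span k {1, u} ⊔ Submodule.span k {v, z})
    (χ : k[X]) (hχ : Irreducible χ) (hχ3 : χ.natDegree = 3)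
    (hχM : homEval k v z 3 χ ∈ Submodule.span k {1, u} * M ^ 2)
    (D : ℕ) (g : k[X]) (hg : g ≠ 0) (hg2 : g.natDegree ≤ 2) (hgD : g.natDegree ≤ D + 1)
    (hgM : homEval k v z (D + 1) g ∈ Submodule.span k {1, u} * M ^ D) :
    ∀ N ≥ D + 3, M ^ (N + 1) ≤ Submodule.span k {1, u} * M ^ N := by
  intro N hN
  set E := Submodule.span k {1, u}
  have hv : v ∈ M := hM ▸ Submodule.mem_sup_right (Submodule.subset_span (by simp))
  have hz : z ∈ M := hM ▸ Submodule.mem_sup_right (Submodule.subset_span (by simp))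
  have hhom : ∀ i f, homEval k v z i f ∈ M ^ i := fun i f =>
    aeval_mem_pow (by intro i; fin_cases i <;> simpa) (isHomogeneous_homogenize f)
  rw [pow_succ_eq_sup_map_homEval v z hM N]
  refine sup_le le_rfl ?_
  rintro _ ⟨f, hf, rfl⟩
  have hf' := mem_degreeLT_succ_iff.1 hf
  have hcop : IsCoprime χ g := (hχ.coprime_iff_not_dvd).2 fun h =>
    hg (eq_zero_of_dvd_of_natDegree_lt h (by omega))
  obtain ⟨s, t, hst⟩ := hcop
  have hβ : (f * t % χ).natDegree ≤ 2 := by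
    have := natDegree_mod_lt (f * t) (q := χ) (by omega)
    omega
  set β := f * t % χ with hβdef
  have hdiv : χ ∣ f - β * g := by
    have h1 := EuclideanDomain.div_add_mod (f * t) χ
    refine ⟨f * s + f * t / χ * g, ?_⟩
    linear_combination (-f) * hst - g * h1
  obtain ⟨α, hα⟩ := hdiv
  have hαd : α.natDegree + 3 ≤ N + 1 ∨ α = 0 := by
    rcases eq_or_ne α 0 with h0 | h0
    · exact Or.inr h0
    left
    have h1 : (f - β * g).natDegree ≤ N + 1 :=
      (natDegree_sub_le_of_le hf' (natDegree_mul_le_of_le hβ hg2)).trans (by omega)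
    rw [hα, natDegree_mul hχ.ne_zero h0] at h1
    omega
  have hf2 : f = α * χ + β * g := by rw [mul_comm α, ← hα]; ring
  rw [hf2, map_add]
  refine add_mem ?_ ?_
  · rcases hαd with hαd | rfl
    · obtain ⟨i, rfl⟩ : ∃ i, N = i + 2 := ⟨N - 2, by omega⟩
      rw [show i + 2 + 1 = i + 3 by omega, homEval_mul v z (by omega) hχ3.le, pow_add,
        ← mul_assoc, mul_comm E, mul_assoc]
      exact Submodule.mul_mem_mul (hhom _ _) hχM
    · simp
  · obtain ⟨i, rfl⟩ : ∃ i, N = i + D := ⟨N - D, by omega⟩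
    rw [show i + D + 1 = i + (D + 1) by omega, homEval_mul v z (by omega) hgD, pow_add,
      ← mul_assoc, mul_comm E, mul_assoc]
    exact Submodule.mul_mem_mul (hhom _ _) hgM

open Polynomial in
/-- The numerical behaviour of the hyperplane section of a curve. -/
theorem curve_numerics [IsDomain A] (hinf : ¬ FiniteDimensional k A) {M : Submodule k A}
    (hgen : ∀ r : A, ∃ N, r ∈ M ^ N) {u v z : A}
    (hM : M = Submodule.span k {1, u} ⊔ Submodule.span k {v, z})
    (χ : k[X]) (hχ : Irreducible χ) (hχ3 : χ.natDegree = 3)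
    (hχM : homEval k v z 3 χ ∈ Submodule.span k {1, u} * M ^ 2)
    (D : ℕ) (g : k[X]) (hg : g ≠ 0) (hg2 : g.natDegree ≤ 2) (hgD : g.natDegree ≤ D + 1)
    (hgM : homEval k v z (D + 1) g ∈ Submodule.span k {1, u} * M ^ D)
    {F : MvPolynomial (Fin 4) k} (hF : F.IsHomogeneous 3) (x : Fin 4 → A)
    (hx : Submodule.span k (Set.range x) = M) (hxF : MvPolynomial.aeval x F = 0)
    {n : ℕ} (hn : ZeroDegreesDivisible F n) :
    ∃ e N₁, 1 ≤ e ∧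
      (∀ N ≥ N₁, Module.finrank k ↥(M ^ (N + 1)) = Module.finrank k ↥(M ^ N) + e) ∧
      (∀ N ≥ N₁, M ^ (N + 1) ≤ Submodule.span k {1, u} * M ^ N) ∧
      e ≤ 3 * (D + 1) ∧ (e < n → 3 ∣ e) ∧
      ∀ j, e = 3 * j → ∀ a, 6 * j * a + 3 * j ≤ 2 * Module.finrank k ↥(M ^ a) + 3 * j * j := by
  have : FiniteDimensional k M := by
    rw [← hx]; exact FiniteDimensional.span_of_finite k (Set.finite_range x)
  have hfin := finiteDimensional_submodule_pow M
  have h1 : (1 : A) ∈ M := hM ▸ Submodule.mem_sup_left (Submodule.subset_span (by simp))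
  have hu : u ∈ M := hM ▸ Submodule.mem_sup_left (Submodule.subset_span (by simp))
  have hv : v ∈ M := hM ▸ Submodule.mem_sup_right (Submodule.subset_span (by simp))
  have hz : z ∈ M := hM ▸ Submodule.mem_sup_right (Submodule.subset_span (by simp))
  have hle : ∀ N, M ^ N ≤ M ^ (N + 1) := fun N =>
    pow_le_pow_right' (Submodule.one_le.2 h1) (Nat.le_succ N)
  have hrec := pow_succ_le_of_relations hM χ hχ hχ3 hχM D g hg hg2 hgD hgM
  have hlt : ∀ N, Module.finrank k ↥(M ^ N) < Module.finrank k ↥(M ^ (N + 1)) := by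
    intro N
    by_contra! hcon
    have htop := exists_mem_pow_of_pow_stable h1 hgen
      (Submodule.eq_of_le_of_finrank_le (hle N) hcon).symm
    refine hinf (Module.finite_def.2 ?_)
    rw [← htop]
    exact Module.Finite.iff_fg.1 (hfin N)
  obtain ⟨N₁, hN₁, hconst⟩ := exists_eventually_const_of_antitone
    (fun N => Module.finrank k ↥(M ^ (N + 1)) - Module.finrank k ↥(M ^ N)) (D + 3) (by
      intro N hN
      have := finrank_pow_succ_add_le h1 hu (hrec (N + 1) (by omega))
      have := hlt N
      change Module.finrank k ↥(M ^ (N + 2)) - _ ≤ _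
      omega)
  set e := Module.finrank k ↥(M ^ (N₁ + 1)) - Module.finrank k ↥(M ^ N₁) with he
  have he1 : 1 ≤ e := by have := hlt N₁; omega
  have hstep : ∀ N ≥ N₁, Module.finrank k ↥(M ^ (N + 1)) = Module.finrank k ↥(M ^ N) + e := by
    intro N hN
    have := hlt N
    have := hconst N hN
    omega
  refine ⟨e, N₁, he1, hstep, fun N hN => hrec N (by omega), ?_⟩
  have hu0 : u ≠ 0 := by
    rintro rfl
    have h2 := hrec N₁ hN₁
    have h3 : M ^ (N₁ + 1) ≤ M ^ N₁ := by
      intro r hr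
      obtain ⟨x, hx, y, hy, rfl⟩ := mem_span_one_mul_iff.1 (h2 hr)
      simpa using hy
    have := Submodule.finrank_mono h3
    have := hlt N₁
    omega
  obtain ⟨V, _, _, τ, hV, hVe, hτ, hτu, hτtop, hτker, hτ1⟩ := exists_chart M u hu hu0 1 1
    (by rwa [pow_one]) one_ne_zero e (N₁ + 1) (by omega)
    (by
      intro N hN r hr
      obtain ⟨x, hx, y, hy, rfl⟩ := mem_span_one_mul_iff.1 (hrec N (by omega) hr)
      exact ⟨x, hx, y, hy, by rw [one_mul]⟩)
    (by
      intro N hN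
      obtain ⟨i, rfl⟩ : ∃ i, N = i + 1 := ⟨N - 1, by omega⟩
      exact hstep i (by omega))
  have hnt : Nontrivial V := Module.nontrivial_of_finrank_pos (R := k) (by omega)
  set T := M.map (τ 1) with hTdef
  have hTpow : ∀ i, (M ^ i).map (τ i) = T ^ i := hτ.map_pow
  have hT : T = 1 ⊔ Submodule.span k {τ 1 v, τ 1 z} := by
    rw [hTdef, hM, Submodule.map_sup, Submodule.map_span, Submodule.map_span, Set.image_pair,
      Set.image_pair, hτ1, hτu, Submodule.span_insert_zero, Submodule.one_eq_span]
  have hτE : ∀ i, ∀ r ∈ Submodule.span k {1, u} * M ^ i, τ (i + 1) r ∈ T ^ i := by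
    intro i r hr
    obtain ⟨x, hx, y, hy, rfl⟩ := mem_span_one_mul_iff.1 hr
    rw [← one_mul y, add_comm i, map_add, hτ.map_mul 1 i u (by rwa [pow_one]) x hx,
      hτ.map_mul 1 i 1 (by rwa [pow_one]) y hy, hτu, hτ1, one_mul, zero_mul, add_zero,
      ← hTpow]
    exact ⟨x, hx, rfl⟩
  have hhom : ∀ i f, homEval k (τ 1 v) (τ 1 z) i f = τ i (homEval k v z i f) := by
    intro i f
    rw [homEval_apply, homEval_apply, hτ.map_aeval (M := M)
      (by intro i; fin_cases i <;> simpa) (isHomogeneous_homogenize f)]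
    congr 2
    funext i
    fin_cases i <;> rfl
  obtain ⟨r1, r2⟩ := plane_scheme_numerics (τ 1 v) (τ 1 z) T hT
    ⟨N₁ + 1, by rw [← hTpow]; exact hτtop _ le_rfl⟩ χ hχ hχ3
    (by rw [hhom]; exact hτE 2 _ hχM) D g hg hg2 hgD (by rw [hhom]; exact hτE D _ hgM)
  rw [hVe] at r1 r2
  refine ⟨r1, ?_, ?_⟩
  · intro hen
    refine hn.three_dvd_finrank (fun i => τ 1 (x i)) ?_ ?_ e V hVe hen
    · rw [← hτ.map_aeval (M := M) (fun i => hx ▸ Submodule.subset_span ⟨i, rfl⟩) hF, hxF, map_zero]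
    · rw [Ideal.eq_top_iff_one, ← hτu]
      have h3 : τ 1 u ∈ Submodule.span k (Set.range fun i => τ 1 (x i)) := by
        have : Set.range (fun i => τ 1 (x i)) = τ 1 '' Set.range x := by
          rw [← Set.range_comp]; rfl
        rw [this, ← Submodule.map_span, hx]
        exact ⟨u, hu, rfl⟩
      exact Submodule.span_le_restrictScalars k V _ h3
  · intro j hj a
    refine (r2 j hj a).trans ?_
    have : ∑ i ∈ Finset.range (a + 1), Module.finrank k ↥(T ^ i) ≤
        Module.finrank k ↥(M ^ a) := by
      induction a with
      | zero =>
        rw [Finset.sum_range_one, ← hTpow]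
        exact Submodule.finrank_map_le _ _
      | succ a ih =>
        rw [Finset.sum_range_succ, ← hTpow]
        have e1 := finrank_add_finrank_map (τ (a + 1)) (M ^ (a + 1))
        have e2 : M ^ a ≤ M ^ (a + 1) ⊓ LinearMap.ker (τ (a + 1)) := by
          refine fun r hr => ⟨hle a hr, LinearMap.mem_ker.2 ?_⟩
          rw [← one_mul r, add_comm, hτ.map_mul 1 a 1 (by rwa [pow_one]) r hr, hτ1, zero_mul]
        have : FiniteDimensional k ↥(M ^ (a + 1) ⊓ LinearMap.ker (τ (a + 1))) :=
          Submodule.finiteDimensional_of_le inf_le_left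
        have e3 := Submodule.finrank_mono e2
        omega
    omega

end

section

variable {k : Type u} {A : Type u} [Field k] [CommRing A] [Algebra k A]

theorem exists_map_pow_eq_top {M : Submodule k A} (h1 : (1 : A) ∈ M)
    (hgen : ∀ r : A, ∃ N, r ∈ M ^ N) (I : Submodule k A) [FiniteDimensional k (A ⧸ I)] :
    ∃ N₀, ∀ N ≥ N₀, (M ^ N).map I.mkQ = ⊤ := by
  classical
  obtain ⟨s, hs⟩ := Module.finite_def.1 ‹FiniteDimensional k (A ⧸ I)›
  choose f hf using Submodule.mkQ_surjective I
  choose d hd using hgen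
  refine ⟨s.sup (fun y => d (f y)), fun N hN => ?_⟩
  rw [eq_top_iff, ← hs, Submodule.span_le]
  intro y hy
  refine ⟨f y, ?_, hf y⟩
  exact pow_le_pow_right' (Submodule.one_le.2 h1)
    ((Finset.le_sup (f := fun y => d (f y)) hy).trans hN) (hd (f y))

open Polynomial in
/-- Sections through a scheme of length `r` on a curve of degree `e` leave a residual scheme. -/
theorem residual_numerics [IsDomain A] [Infinite k] {M : Submodule k A}
    (hgen : ∀ r : A, ∃ N, r ∈ M ^ N) {u : A} (h1 : (1 : A) ∈ M) (hu : u ∈ M) {e N₁ : ℕ}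
    (he : 1 ≤ e)
    (hstep : ∀ N ≥ N₁, Module.finrank k ↥(M ^ (N + 1)) = Module.finrank k ↥(M ^ N) + e)
    (hrec : ∀ N ≥ N₁, M ^ (N + 1) ≤ Submodule.span k {1, u} * M ^ N)
    {F : MvPolynomial (Fin 4) k} (hF : F.IsHomogeneous 3) (x : Fin 4 → A)
    (hx : Submodule.span k (Set.range x) = M) (hxF : MvPolynomial.aeval x F = 0)
    {n : ℕ} (hn : ZeroDegreesDivisible F n) {a : ℕ} {G : A} (hG : G ∈ M ^ a) (hG0 : G ≠ 0)
    (I : Ideal A) (hGI : G ∈ I) [FiniteDimensional k (A ⧸ I)] :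
    ∃ t, t + Module.finrank k (A ⧸ I) = e * a ∧ (t < n → 3 ∣ t) := by
  have : FiniteDimensional k M := by
    rw [← hx]; exact FiniteDimensional.span_of_finite k (Set.finite_range x)
  have hfin := finiteDimensional_submodule_pow M
  have hmono : ∀ {i j : ℕ}, i ≤ j → M ^ i ≤ M ^ j := fun hij =>
    pow_le_pow_right' (Submodule.one_le.2 h1) hij
  have hmul : ∀ {N N' : ℕ} {r r' : A}, r ∈ M ^ N → r' ∈ M ^ N' → r * r' ∈ M ^ (N + N') :=
    fun h h' => by rw [pow_add]; exact Submodule.mul_mem_mul h h'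
  have hdim' : ∀ i, ∀ N ≥ N₁,
      Module.finrank k ↥(M ^ (N + i)) = Module.finrank k ↥(M ^ N) + e * i := by
    intro i N hN
    induction i with
    | zero => simp
    | succ i ih => rw [← add_assoc, hstep _ (by omega), ih]; ring
  have hdim : ∀ N ≥ N₁ + a,
      Module.finrank k ↥(M ^ N) = Module.finrank k ↥(M ^ (N - a)) + e * a := by
    intro N hN
    have := hdim' a (N - a) (by omega)
    rwa [show N - a + a = N by omega] at this
  have hGmap : ∀ N, Module.finrank k ((M ^ N).map (LinearMap.mulLeft k G)) =
      Module.finrank k ↥(M ^ N) := fun N =>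
    (Submodule.equivMapOfInjective (LinearMap.mulLeft k G)
      (mul_right_injective₀ hG0) (M ^ N)).finrank_eq.symm
  have hGle : ∀ N ≥ a, (M ^ (N - a)).map (LinearMap.mulLeft k G) ≤ M ^ N := by
    rintro N hN _ ⟨s, hs, rfl⟩
    have := hmul hG hs
    rwa [show a + (N - a) = N by omega] at this
  have hupoly : ∀ (f : k[X]) (d : ℕ), f.natDegree ≤ d → aeval u f ∈ M ^ d := by
    intro f d hd
    rw [aeval_eq_sum_range]
    refine sum_mem fun i hi => Submodule.smul_mem _ _ ?_
    exact hmono (by simp at hi; omega) (Submodule.pow_mem_pow _ hu i)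
  -- a polynomial in `u` divisible by `G`
  obtain ⟨π, hπ0, hπd, w, hw, hπw⟩ : ∃ π : k[X], π ≠ 0 ∧ π.natDegree ≤ e * a ∧
      ∃ w ∈ M ^ (N₁ + e * a), aeval u π = G * w := by
    let B := (M ^ (N₁ + e * a)).map (LinearMap.mulLeft k G)
    let f : k[X] →ₗ[k] A ⧸ B := B.mkQ ∘ₗ (aeval u).toLinearMap
    have e1 := finrank_add_finrank_map f (degreeLT k (e * a + 1))
    rw [finrank_degreeLT] at e1
    have hB : B ≤ M ^ (N₁ + e * a + a) := by
      have := hGle (N₁ + e * a + a) (by omega)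
      rwa [show N₁ + e * a + a - a = N₁ + e * a by omega] at this
    have e2 := finrank_add_finrank_map B.mkQ (M ^ (N₁ + e * a + a))
    rw [Submodule.ker_mkQ, inf_eq_right.2 hB, hGmap] at e2
    have e3 := hdim' a (N₁ + e * a) (by omega)
    have e4 : (degreeLT k (e * a + 1)).map f ≤ (M ^ (N₁ + e * a + a)).map B.mkQ := by
      rintro _ ⟨g, hg, rfl⟩
      exact ⟨aeval u g, hupoly g _ ((mem_degreeLT_succ_iff.1 hg).trans (by omega)), rfl⟩
    have e5 := Submodule.finrank_mono e4
    obtain ⟨π, ⟨hπ1, hπ2⟩, hπ0⟩ := (Submodule.ne_bot_iff _).1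
      (Submodule.one_le_finrank_iff.1 (show 1 ≤ Module.finrank k
        (degreeLT k (e * a + 1) ⊓ LinearMap.ker f : Submodule k k[X]) by omega))
    obtain ⟨w, hw, hw'⟩ : aeval u π ∈ B :=
      (Submodule.Quotient.mk_eq_zero B).1 (LinearMap.mem_ker.1 hπ2)
    exact ⟨π, hπ0, mem_degreeLT_succ_iff.1 hπ1, w, hw, hw'.symm⟩
  obtain ⟨ρ, hρ⟩ : ∃ ρ, π.eval ρ ≠ 0 := by
    by_contra! h
    exact hπ0 (Polynomial.funext fun r => by simpa using h r)
  set l := u - algebraMap k A ρ with hl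
  have hlM : l ∈ M := by
    refine sub_mem hu ?_
    rw [Algebra.algebraMap_eq_smul_one]
    exact M.smul_mem _ h1
  have hl0 : l ≠ 0 := by
    intro h
    have hu' : u = algebraMap k A ρ := sub_eq_zero.1 h
    have h3 : M ^ (N₁ + 1) ≤ M ^ N₁ := by
      intro r hr
      obtain ⟨x, hx, y, hy, rfl⟩ := mem_span_one_mul_iff.1 (hrec N₁ le_rfl hr)
      rw [hu', ← Algebra.smul_def]
      exact add_mem (Submodule.smul_mem _ _ hx) hy
    have := Submodule.finrank_mono h3
    have := hstep N₁ le_rfl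
    omega
  have hπ1 : ∃ π₁ : k[X], π₁.natDegree ≤ e * a ∧
      aeval u π = algebraMap k A (π.eval ρ) + l * aeval u π₁ := by
    refine ⟨π /ₘ (X - C ρ), ?_, ?_⟩
    · rw [natDegree_divByMonic _ (monic_X_sub_C ρ)]; omega
    · conv_lhs => rw [← modByMonic_add_div π (X - C ρ)]
      rw [modByMonic_X_sub_C_eq_C_eval]
      simp [hl]
  obtain ⟨π₁, hπ₁d, hπ₁⟩ := hπ1
  have hred : ∀ i, ∀ r ∈ M ^ (N₁ + i + 1), ∃ x ∈ M ^ (N₁ + i), ∃ y ∈ M ^ N₁, r = l * x + y := by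
    intro i
    induction i with
    | zero =>
      intro r hr
      obtain ⟨x, hx, y, hy, rfl⟩ := mem_span_one_mul_iff.1 (hrec N₁ le_rfl hr)
      refine ⟨x, hx, algebraMap k A ρ * x + y, add_mem ?_ hy, by rw [hl]; ring⟩
      rw [← Algebra.smul_def]
      exact Submodule.smul_mem _ _ hx
    | succ i ih =>
      intro r hr
      obtain ⟨x, hx, y, hy, rfl⟩ := mem_span_one_mul_iff.1 (hrec (N₁ + i + 1) (by omega) hr)
      obtain ⟨x', hx', y', hy', h⟩ := ih (algebraMap k A ρ * x + y) (by
        refine add_mem ?_ hy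
        rw [← Algebra.smul_def]
        exact Submodule.smul_mem _ _ hx)
      refine ⟨x + x', add_mem hx (hmono (by omega) hx'), y', hy', ?_⟩
      rw [mul_add, add_assoc, ← h, hl]; ring
  obtain ⟨V, _, _, τ, hV, hVe, hτ, hτl, hτtop, hτker, -⟩ := exists_chart M l hlM hl0 a G hG hG0
    (e * a) (2 * N₁ + e * a + a) (by omega)
    (by
      intro N hN r hr
      obtain ⟨i, rfl⟩ : ∃ i, N = N₁ + i := ⟨N - N₁, by omega⟩
      obtain ⟨x, hx, y, hy, rfl⟩ := hred i r hr
      set c := (π.eval ρ)⁻¹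
      have hc : algebraMap k A c * algebraMap k A (π.eval ρ) = 1 := by
        rw [← map_mul, inv_mul_cancel₀ hρ, map_one]
      refine ⟨x - c • (aeval u π₁ * y), sub_mem hx (Submodule.smul_mem _ _ ?_),
        c • (w * y), Submodule.smul_mem _ _ ?_, ?_⟩
      · exact hmono (by omega) (hmul (hupoly π₁ _ hπ₁d) hy)
      · exact hmono (by omega) (hmul hw hy)
      · rw [Algebra.smul_def, Algebra.smul_def]
        linear_combination (-y) * hc + (algebraMap k A c * y) * (hπ₁.symm.trans hπw))
    (fun N hN => hdim N (by omega))
  let I' : Submodule k A := I.restrictScalars k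
  have : FiniteDimensional k (A ⧸ I') := inferInstanceAs (FiniteDimensional k (A ⧸ I))
  have hr : Module.finrank k (A ⧸ I') = Module.finrank k (A ⧸ I) := rfl
  obtain ⟨N₂, hN₂⟩ := exists_map_pow_eq_top h1 hgen I'
  set N₀ := 2 * N₁ + e * a + a + N₂ with hN₀
  let W : ℕ → Submodule k V := fun N => (M ^ N ⊓ I').map (τ N)
  have hinf : ∀ N, FiniteDimensional k ↥(M ^ N ⊓ I') := fun N =>
    Submodule.finiteDimensional_of_le inf_le_left
  have hW : ∀ N ≥ N₀, Module.finrank k (W N) + Module.finrank k (A ⧸ I) = e * a := by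
    intro N hN
    have e1 := finrank_add_finrank_map I'.mkQ (M ^ N)
    rw [hN₂ N (by omega), Submodule.ker_mkQ, finrank_top] at e1
    have e2 := finrank_add_finrank_map (τ N) (M ^ N ⊓ I')
    have e3 : M ^ N ⊓ I' ⊓ LinearMap.ker (τ N) = (M ^ (N - a)).map (LinearMap.mulLeft k G) := by
      ext r
      constructor
      · rintro ⟨⟨hr, -⟩, hr0⟩
        obtain ⟨s, hs, rfl⟩ := (hτker N (by omega) r hr).1 hr0
        exact ⟨s, hs, rfl⟩
      · rintro ⟨s, hs, rfl⟩
        have := hGle N (by omega) ⟨s, hs, rfl⟩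
        exact ⟨⟨this, I.mul_mem_right _ hGI⟩, (hτker N (by omega) _ this).2 ⟨s, hs, rfl⟩⟩
    rw [e3, hGmap] at e2
    have e4 := hdim N (by omega)
    simp only [W]
    omega
  have hWmono : ∀ N, W N ≤ W (N + 1) := by
    rintro N _ ⟨r, ⟨hr, hrI⟩, rfl⟩
    refine ⟨l * r, ⟨?_, I.mul_mem_left _ hrI⟩, ?_⟩
    · rw [mul_comm]; exact hmul hr (by rwa [pow_one])
    · rw [add_comm, hτ.map_mul 1 N l (by rwa [pow_one]) r hr, hτl, one_mul]
  have hWconst : ∀ i, W (N₀ + i) = W N₀ := by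
    intro i
    have hle : W N₀ ≤ W (N₀ + i) := monotone_nat_of_le_succ hWmono (Nat.le_add_right _ _)
    refine (Submodule.eq_of_le_of_finrank_le hle ?_).symm
    have := hW N₀ le_rfl
    have := hW (N₀ + i) (by omega)
    omega
  let J : Ideal V :=
    { carrier := W N₀
      add_mem' := fun h h' => add_mem h h'
      zero_mem' := zero_mem _
      smul_mem' := by
        rintro c _ ⟨r, ⟨hr, hrI⟩, rfl⟩
        have hc : c ∈ (M ^ N₀).map (τ N₀) := by rw [hτtop N₀ (by omega)]; trivial
        obtain ⟨s, hs, rfl⟩ := hc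
        rw [smul_eq_mul, ← hτ.map_mul _ _ s hs r hr]
        have : τ (N₀ + N₀) (s * r) ∈ W (N₀ + N₀) :=
          ⟨s * r, ⟨hmul hs hr, I.mul_mem_left _ hrI⟩, rfl⟩
        rwa [hWconst] at this }
  let eJ : W N₀ ≃ₗ[k] J :=
    { toFun := fun y => ⟨y.1, y.2⟩
      invFun := fun y => ⟨y.1, y.2⟩
      map_add' := fun _ _ => rfl
      map_smul' := fun _ _ => rfl
      left_inv := fun _ => rfl
      right_inv := fun _ => rfl }
  have : FiniteDimensional k J := eJ.finiteDimensional
  refine ⟨Module.finrank k (W N₀), hW N₀ le_rfl, fun htn => ?_⟩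
  refine hn.three_dvd_finrank (fun i => τ 1 (x i)) ?_ ?_ _ J eJ.finrank_eq.symm htn
  · rw [← hτ.map_aeval (M := M) (fun i => hx ▸ Submodule.subset_span ⟨i, rfl⟩) hF, hxF, map_zero]
  · rw [Ideal.eq_top_iff_one, ← hτl]
    have h3 : τ 1 l ∈ Submodule.span k (Set.range fun i => τ 1 (x i)) := by
      have : Set.range (fun i => τ 1 (x i)) = τ 1 '' Set.range x := by
        rw [← Set.range_comp]; rfl
      rw [this, ← Submodule.map_span, hx]
      exact ⟨l, hlM, rfl⟩
    exact Submodule.span_le_restrictScalars k V _ h3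

end

section

variable {k : Type u} {A : Type u} [Field k] [CommRing A] [Algebra k A]

theorem finrank_span_basis_image {ι E : Type*} [AddCommGroup E] [Module k E]
    (B : Module.Basis ι k E) (s : Finset ι) :
    Module.finrank k (Submodule.span k (B '' (s : Set ι))) = s.card := by
  classical
  have h := finrank_span_eq_card (R := k) (b := fun t : s => B t)
    (B.linearIndependent.comp _ Subtype.val_injective)
  have hr : Set.range (fun t : s => B t) = B '' (s : Set ι) := by
    ext; simp
  rwa [hr, Fintype.card_coe] at h

theorem finite_quotient_span_basis_image {ι E : Type*} [AddCommGroup E] [Module k E]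
    (B : Module.Basis ι k E) (s : Finset ι) (W : Submodule k E)
    (hW : W = Submodule.span k (B '' (s : Set ι)ᶜ)) :
    FiniteDimensional k (E ⧸ W) ∧ Module.finrank k (E ⧸ W) = s.card := by
  classical
  have hc : IsCompl W (Submodule.span k (B '' (s : Set ι))) := by
    subst hW
    constructor
    · exact (B.linearIndependent.disjoint_span_image disjoint_compl_left)
    · rw [codisjoint_iff, ← Submodule.span_union, ← Set.image_union, Set.compl_union_self,
        Set.image_univ, B.span_eq]
  have e := Submodule.quotientEquivOfIsCompl _ _ hc
  have : FiniteDimensional k (Submodule.span k (B '' (s : Set ι))) :=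
    FiniteDimensional.span_of_finite k (s.finite_toSet.image B)
  exact ⟨e.symm.finiteDimensional, by rw [e.finrank_eq, finrank_span_basis_image]⟩

variable {y w z : A} (B : Module.Basis (ℕ × ℕ × Fin 3) k A)

theorem monomial_mul_mem_span {hB : ∀ t, B t = y ^ t.1 * w ^ t.2.1 * z ^ (t.2.2 : ℕ)} (a b : ℕ)
    {T T' : Set (ℕ × ℕ × Fin 3)} (hT : ∀ t ∈ T, (a + t.1, b + t.2.1, t.2.2) ∈ T') {r : A}
    (hr : r ∈ Submodule.span k (B '' T)) :
    y ^ a * w ^ b * r ∈ Submodule.span k (B '' T') := by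
  induction hr using Submodule.span_induction with
  | mem x hx =>
    obtain ⟨t, ht, rfl⟩ := hx
    refine Submodule.subset_span ⟨_, hT t ht, ?_⟩
    rw [hB, hB]; ring
  | zero => simp
  | add x y _ _ hx hy => rw [mul_add]; exact add_mem hx hy
  | smul c x _ hx => rw [mul_smul_comm]; exact Submodule.smul_mem _ _ hx

/-- The indices of the basis of the functions of degree at most `N` on a cubic surface. -/
def degreeLESet (N : ℕ) : Set (ℕ × ℕ × Fin 3) := {t | t.1 + t.2.1 + t.2.2 ≤ N}

theorem surface_pow_eq (hB : ∀ t, B t = y ^ t.1 * w ^ t.2.1 * z ^ (t.2.2 : ℕ))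
    (hz : z ^ 3 ∈ Submodule.span k (B '' degreeLESet 3)) (N : ℕ) :
    (Submodule.span k {1, y, w, z}) ^ N = Submodule.span k (B '' degreeLESet N) := by
  have h1 : (1 : A) ∈ Submodule.span k ({1, y, w, z} : Set A) := Submodule.subset_span (by simp)
  apply le_antisymm
  · induction N with
    | zero =>
      rw [pow_zero, Submodule.one_le]
      exact Submodule.subset_span ⟨(0, 0, 0), by simp [degreeLESet], by simp [hB]⟩
    | succ N ih =>
      rw [pow_succ]
      refine (mul_le_mul_left ih _).trans ?_
      rw [Submodule.span_mul_span, Submodule.span_le]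
      rintro _ ⟨_, ⟨⟨a, b, i⟩, ht, rfl⟩, s, hs, rfl⟩
      simp only [degreeLESet, Set.mem_ofPred_eq] at ht
      simp only [Set.mem_insert_iff, Set.mem_singleton_iff] at hs
      change B (a, b, i) * s ∈ _
      rcases hs with rfl | rfl | rfl | rfl
      · rw [mul_one]
        exact Submodule.subset_span ⟨_, by simp [degreeLESet]; omega, rfl⟩
      · exact Submodule.subset_span ⟨(a + 1, b, i), by simp [degreeLESet]; omega, by
          simp only [hB]; ring⟩
      · exact Submodule.subset_span ⟨(a, b + 1, i), by simp [degreeLESet]; omega, by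
          simp only [hB]; ring⟩
      · by_cases hi : (i : ℕ) + 1 < 3
        · exact Submodule.subset_span ⟨(a, b, ⟨i + 1, hi⟩), by simp [degreeLESet]; omega, by
            simp only [hB]; ring⟩
        · have hi2 : (i : ℕ) = 2 := by omega
          rw [hB]
          simp only [hi2]
          rw [mul_assoc, ← pow_succ]
          refine monomial_mul_mem_span B (hB := hB) a b ?_ hz
          intro t ht
          simp only [degreeLESet, Set.mem_ofPred_eq] at ht ⊢
          omega
  · rw [Submodule.span_le]
    rintro _ ⟨⟨a, b, i⟩, ht, rfl⟩
    simp only [degreeLESet, Set.mem_ofPred_eq] at ht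
    refine pow_le_pow_right' (Submodule.one_le.2 h1) ht ?_
    rw [hB, pow_add, pow_add]
    refine Submodule.mul_mem_mul (Submodule.mul_mem_mul ?_ ?_) ?_ <;>
    exact Submodule.pow_mem_pow _ (Submodule.subset_span (by simp)) _

theorem exists_mem_surface_pow (hB : ∀ t, B t = y ^ t.1 * w ^ t.2.1 * z ^ (t.2.2 : ℕ))
    (hz : z ^ 3 ∈ Submodule.span k (B '' degreeLESet 3)) (r : A) :
    ∃ N, r ∈ (Submodule.span k {1, y, w, z}) ^ N := by
  refine ⟨(B.repr r).support.sup fun t => t.1 + t.2.1 + t.2.2, ?_⟩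
  rw [surface_pow_eq B hB hz, Module.Basis.mem_span_image]
  intro t ht
  exact Finset.le_sup (f := fun t : ℕ × ℕ × Fin 3 => t.1 + t.2.1 + (t.2.2 : ℕ)) ht

/-- The pairs of natural numbers with sum less than `m`. -/
def pairsLT (m : ℕ) : Finset (ℕ × ℕ) := (Finset.range m).biUnion Finset.HasAntidiagonal.antidiagonal

theorem mem_pairsLT {m : ℕ} {t : ℕ × ℕ} : t ∈ pairsLT m ↔ t.1 + t.2 < m := by
  simp [pairsLT]

theorem two_mul_card_pairsLT (m : ℕ) : 2 * (pairsLT m).card = m * (m + 1) := by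
  rw [pairsLT, Finset.card_biUnion]
  · simp only [Finset.Nat.card_antidiagonal]
    induction m with
    | zero => simp
    | succ m ih => rw [Finset.sum_range_succ, mul_add, ih]; ring
  · intro i _ j _ hij
    rw [Function.onFun, Finset.disjoint_left]
    intro t h1 h2
    rw [Finset.HasAntidiagonal.mem_antidiagonal] at h1 h2
    exact hij (h1.symm.trans h2)

theorem two_mul_finrank_surface_pow
    (hB : ∀ t, B t = y ^ t.1 * w ^ t.2.1 * z ^ (t.2.2 : ℕ))
    (hz : z ^ 3 ∈ Submodule.span k (B '' degreeLESet 3)) (N : ℕ) :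
    2 * Module.finrank k ↥((Submodule.span k {1, y, w, z}) ^ N) = 3 * N * (N + 1) + 2 := by
  classical
  let f : Fin 3 → (ℕ × ℕ) ↪ (ℕ × ℕ × Fin 3) := fun i =>
    ⟨fun t => (t.1, t.2, i), fun s t h => by simp only [Prod.mk.injEq] at h; ext <;> tauto⟩
  let S : Finset (ℕ × ℕ × Fin 3) := Finset.univ.biUnion fun i : Fin 3 =>
    (pairsLT (N + 1 - i)).map (f i)
  have hS : (S : Set (ℕ × ℕ × Fin 3)) = degreeLESet N := by
    ext ⟨a, b, i⟩
    rw [Finset.mem_coe, Finset.mem_biUnion]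
    constructor
    · rintro ⟨i', -, h⟩
      obtain ⟨t, ht, h⟩ := Finset.mem_map.1 h
      rw [mem_pairsLT] at ht
      change (t.1, t.2, i') = (a, b, i) at h
      simp only [Prod.mk.injEq] at h
      obtain ⟨rfl, rfl, rfl⟩ := h
      change t.1 + t.2 + (i' : ℕ) ≤ N
      omega
    · intro h
      change a + b + (i : ℕ) ≤ N at h
      refine ⟨i, Finset.mem_univ _, Finset.mem_map.2 ⟨(a, b), ?_, rfl⟩⟩
      rw [mem_pairsLT]
      simp only
      omega
  rw [surface_pow_eq B hB hz, ← hS, finrank_span_basis_image, Finset.card_biUnion]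
  · simp only [Finset.card_map, Fin.sum_univ_three, mul_add, two_mul_card_pairsLT]
    rcases N with _ | N
    · simp
    · simp; ring
  · intro i _ j _ hij
    rw [Function.onFun, Finset.disjoint_left]
    intro t h1 h2
    obtain ⟨_, -, h1⟩ := Finset.mem_map.1 h1
    obtain ⟨_, -, h2⟩ := Finset.mem_map.1 h2
    exact hij (congrArg (fun t => t.2.2) (h1.trans h2.symm))

/-- The ideal generated by the monomials in `y`, `w` with exponents outside of `Δ`. -/
def staircaseIdeal (y w : A) (Δ : Finset (ℕ × ℕ)) : Ideal A :=
  Ideal.span {r | ∃ a b, (a, b) ∉ Δ ∧ r = y ^ a * w ^ b}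

theorem monomial_mem_staircaseIdeal {Δ : Finset (ℕ × ℕ)} {a b : ℕ} (h : (a, b) ∉ Δ) :
    y ^ a * w ^ b ∈ staircaseIdeal y w Δ :=
  Ideal.subset_span ⟨a, b, h, rfl⟩

theorem mul_mem_staircaseIdeal {Δ Δ' : Finset (ℕ × ℕ)} (p q : ℕ)
    (h : ∀ a b, (a, b) ∉ Δ → (p + a, q + b) ∉ Δ') {r : A} (hr : r ∈ staircaseIdeal y w Δ) :
    y ^ p * w ^ q * r ∈ staircaseIdeal y w Δ' := by
  induction hr using Submodule.span_induction with
  | mem x hx =>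
    obtain ⟨a, b, hab, rfl⟩ := hx
    have := monomial_mem_staircaseIdeal (y := y) (w := w) (h a b hab)
    rwa [pow_add, pow_add, mul_mul_mul_comm] at this
  | zero => simp
  | add x y _ _ hx hy => rw [mul_add]; exact add_mem hx hy
  | smul c x _ hx => rw [smul_eq_mul, mul_left_comm]; exact Ideal.mul_mem_left _ _ hx

theorem finrank_quotient_staircaseIdeal
    (hB : ∀ t, B t = y ^ t.1 * w ^ t.2.1 * z ^ (t.2.2 : ℕ)) (Δ : Finset (ℕ × ℕ))
    (hΔ : ∀ a b, (a, b) ∉ Δ → ∀ p q, (a + p, b + q) ∉ Δ) :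
    FiniteDimensional k (A ⧸ staircaseIdeal y w Δ) ∧
      Module.finrank k (A ⧸ staircaseIdeal y w Δ) = 3 * Δ.card := by
  classical
  let f : (ℕ × ℕ) × Fin 3 ↪ (ℕ × ℕ × Fin 3) := (Equiv.prodAssoc ℕ ℕ (Fin 3)).toEmbedding
  let S : Finset (ℕ × ℕ × Fin 3) := (Δ ×ˢ Finset.univ).map f
  have hS : ∀ a b i, (a, b, i) ∈ S ↔ (a, b) ∈ Δ := by
    intro a b i
    simp only [S, f, Finset.mem_map_equiv]
    simp
  have h : (staircaseIdeal y w Δ).restrictScalars k = Submodule.span k (B '' (S : Set _)ᶜ) := by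
    apply le_antisymm
    · intro r hr
      change r ∈ staircaseIdeal y w Δ at hr
      induction hr using Submodule.span_induction with
      | mem x hx =>
        obtain ⟨a, b, hab, rfl⟩ := hx
        refine Submodule.subset_span ⟨(a, b, 0), ?_, by simp [hB]⟩
        simpa [hS] using hab
      | zero => simp
      | add x y _ _ hx hy => exact add_mem hx hy
      | smul c x hx₀ hx =>
        clear hx₀
        induction hx using Submodule.span_induction with
        | mem x hx =>
          obtain ⟨⟨a, b, i⟩, hab, rfl⟩ := hx
          have hc : z ^ (i : ℕ) * c ∈ Submodule.span k (B '' Set.univ) := by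
            rw [Set.image_univ, B.span_eq]; trivial
          have := monomial_mul_mem_span B (hB := hB) a b (T' := (S : Set _)ᶜ) ?_ hc
          · rw [hB, smul_eq_mul]
            convert this using 1
            ring
          · rintro ⟨p, q, l⟩ -
            simp only [Set.mem_compl_iff, Finset.mem_coe, hS] at hab ⊢
            exact hΔ a b hab p q
        | zero => simp
        | add x y _ _ hx hy => rw [smul_add]; exact add_mem hx hy
        | smul a x _ hx => rw [smul_comm]; exact Submodule.smul_mem _ _ hx
    · rw [Submodule.span_le]
      rintro _ ⟨⟨a, b, i⟩, hab, rfl⟩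
      rw [hB]
      refine Ideal.mul_mem_right _ _ (monomial_mem_staircaseIdeal ?_)
      simpa [hS] using hab
  have := finite_quotient_span_basis_image B S _ h
  have hc : S.card = 3 * Δ.card := by simp [S, mul_comm]
  rw [hc] at this
  exact this

/-- A maximal ideal of degree larger than three does not contain a staircase ideal. -/
theorem isCoprime_of_staircaseIdeal_le
    (hB : ∀ t, B t = y ^ t.1 * w ^ t.2.1 * z ^ (t.2.2 : ℕ)) {m : Ideal A} (hm : m.IsMaximal)
    (hn : 3 < Module.finrank k (A ⧸ m)) {Δ : Finset (ℕ × ℕ)} {I : Ideal A}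
    (hI : staircaseIdeal y w Δ ≤ I) : IsCoprime m I := by
  rw [Ideal.isCoprime_iff_sup_eq]
  by_contra hne
  have hIm : I ≤ m := by
    exact le_sup_right.trans (hm.eq_of_le hne le_sup_left).ge
  have hy : y ∈ m := by
    obtain ⟨N, hN⟩ := (Δ.image Prod.fst).exists_notMem
    refine hm.isPrime.mem_of_pow_mem N (hIm (hI ?_))
    have := monomial_mem_staircaseIdeal (y := y) (w := w) (Δ := Δ) (a := N) (b := 0) (fun h => hN
      (Finset.mem_image_of_mem _ h))
    simpa using this
  have hw : w ∈ m := by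
    obtain ⟨N, hN⟩ := (Δ.image Prod.snd).exists_notMem
    refine hm.isPrime.mem_of_pow_mem N (hIm (hI ?_))
    have := monomial_mem_staircaseIdeal (y := y) (w := w) (Δ := Δ) (a := 0) (b := N) (fun h => hN
      (Finset.mem_image_of_mem _ h))
    simpa using this
  have hle : staircaseIdeal y w {(0, 0)} ≤ m := by
    rw [staircaseIdeal, Ideal.span_le]
    rintro _ ⟨a, b, hab, rfl⟩
    simp only [Finset.mem_singleton, Prod.mk.injEq, not_and_or] at hab
    rcases hab with h | h
    · exact Ideal.mul_mem_right _ _ (Ideal.pow_mem_of_mem _ hy _ (by omega))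
    · exact Ideal.mul_mem_left _ _ (Ideal.pow_mem_of_mem _ hw _ (by omega))
  obtain ⟨h1, h2⟩ := finrank_quotient_staircaseIdeal B hB {(0, 0)} (by
    simp only [Finset.mem_singleton, Prod.mk.injEq]; omega)
  have h3 := LinearMap.finrank_le_finrank_of_surjective
    (f := (Ideal.Quotient.factorₐ k hle).toLinearMap) (Ideal.Quotient.factor_surjective hle)
  rw [h2] at h3
  simp at h3
  omega

end

section

open Polynomial

variable {k : Type u} {A : Type u} [Field k] [CommRing A] [Algebra k A]

theorem homEval_C_mul_X_pow (p q : A) {i D : ℕ} (hi : i ≤ D) (c : k) :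
    homEval k p q D (C c * X ^ i) = algebraMap k A c * (p ^ (D - i) * q ^ i) := by
  obtain ⟨j, rfl⟩ := Nat.exists_eq_add_of_le' hi
  have h1 : homEval k p q i (X ^ i : k[X]) = q ^ i := by
    clear hi
    induction i with
    | zero => simp
    | succ i ih =>
      rw [pow_succ, homEval_mul p q (by simp) (by simp), ih, homEval_one_X, pow_succ]
  have h2 : homEval k p q (j + i) ((1 : k[X]) * X ^ i) = p ^ j * q ^ i := by
    rw [homEval_mul p q (by simp) (by simp), h1, homEval_one]
  rw [one_mul] at h2
  rw [← smul_eq_C_mul, map_smul, Algebra.smul_def, h2, Nat.add_sub_cancel]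

variable {y w z : A}

theorem monomial_mem_hyperplane_mul (c : k) {a b i D : ℕ} (h : a + b + i ≤ D) :
    y ^ a * w ^ b * z ^ i ∈ Submodule.span k {1, w - c • y} *
      (Submodule.span k {1, y, w, z}) ^ D := by
  have h1 : (1 : A) ∈ Submodule.span k ({1, y, w, z} : Set A) := Submodule.subset_span (by simp)
  rw [← one_mul (y ^ a * w ^ b * z ^ i)]
  refine Submodule.mul_mem_mul (Submodule.subset_span (Set.mem_insert _ _)) ?_
  refine pow_le_pow_right' (Submodule.one_le.2 h1) h ?_
  rw [pow_add, pow_add]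
  refine Submodule.mul_mem_mul (Submodule.mul_mem_mul ?_ ?_) ?_ <;>
  exact Submodule.pow_mem_pow _ (Submodule.subset_span (by simp)) _

theorem monomial_sub_homEval_mem (c : k) {a b i D : ℕ} (h : a + b + i = D + 1) :
    y ^ a * w ^ b * z ^ i - homEval k y z (D + 1) (C (c ^ b) * X ^ i) ∈
      Submodule.span k {1, w - c • y} * (Submodule.span k {1, y, w, z}) ^ D := by
  have hle : ∀ b, y ^ a * (w ^ b - (c • y) ^ b) * z ^ i ∈ Submodule.span k {1, w - c • y} *
      (Submodule.span k {1, y, w, z}) ^ (a + b + i - 1) := by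
    intro b
    rcases b with _ | b
    · simp
    rw [← geom_sum₂_mul, mul_comm _ (w - c • y), mul_left_comm, mul_assoc]
    refine Submodule.mul_mem_mul (Submodule.subset_span (by simp)) ?_
    rw [show a + (b + 1) + i - 1 = a + b + i by omega, pow_add, pow_add]
    refine Submodule.mul_mem_mul (Submodule.mul_mem_mul ?_ ?_) ?_
    · exact Submodule.pow_mem_pow _ (Submodule.subset_span (by simp)) _
    · refine sum_mem fun j hj => ?_
      have hj : j < b + 1 := Finset.mem_range.1 hj
      have hb : b = j + (b + 1 - 1 - j) := by omega
      conv_lhs => rw [hb]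
      rw [pow_add]
      refine Submodule.mul_mem_mul ?_ ?_ <;> apply Submodule.pow_mem_pow
      · exact Submodule.subset_span (by simp)
      · exact Submodule.smul_mem _ _ (Submodule.subset_span (by simp))
    · exact Submodule.pow_mem_pow _ (Submodule.subset_span (by simp)) _
  have := hle b
  rw [h, Nat.add_sub_cancel] at this
  convert this using 1
  rw [homEval_C_mul_X_pow _ _ (by omega), show D + 1 - i = a + b by omega, Algebra.smul_def,
    map_pow]
  ring

/-- The restriction of a quaternary form to the line `X₀ = 0`, `X₂ = c X₁`. -/
noncomputable def restrictLine (F : MvPolynomial (Fin 4) k) (c : k) : k[X] :=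
  MvPolynomial.aeval ![0, 1, C c, X] F

theorem restrictLine_eq_sum (F : MvPolynomial (Fin 4) k) (c : k) : restrictLine F c =
    ∑ d ∈ F.support, C (F.coeff d) * ((0 : k[X]) ^ d 0 * (C (c ^ d 2) * X ^ d 3)) := by
  rw [restrictLine, MvPolynomial.aeval_def, MvPolynomial.eval₂_eq']
  refine Finset.sum_congr rfl fun d _ => ?_
  simp [Fin.prod_univ_four, Polynomial.algebraMap_eq, mul_assoc]

theorem sum_eq_of_isHomogeneous {F : MvPolynomial (Fin 4) k} {D : ℕ} (hF : F.IsHomogeneous D)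
    {d : Fin 4 →₀ ℕ} (hd : d ∈ F.support) : d 0 + d 1 + d 2 + d 3 = D := by
  have hD := hF (MvPolynomial.mem_support_iff.1 hd)
  rw [Finsupp.weight_apply, Finsupp.sum_fintype _ _ (by simp)] at hD
  simpa [Fin.sum_univ_four] using hD

theorem aeval_sub_homEval_restrictLine_mem {F : MvPolynomial (Fin 4) k} {D : ℕ}
    (hF : F.IsHomogeneous (D + 1)) (c : k) :
    MvPolynomial.aeval ![1, y, w, z] F - homEval k y z (D + 1) (restrictLine F c) ∈
      Submodule.span k {1, w - c • y} * (Submodule.span k {1, y, w, z}) ^ D := by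
  rw [restrictLine_eq_sum, map_sum, MvPolynomial.aeval_def, MvPolynomial.eval₂_eq',
    ← Finset.sum_sub_distrib]
  refine sum_mem fun d hd => ?_
  have hD := sum_eq_of_isHomogeneous hF hd
  rw [← smul_eq_C_mul, map_smul, ← Algebra.smul_def, ← smul_sub]
  refine Submodule.smul_mem _ _ ?_
  simp only [Fin.prod_univ_four, Matrix.cons_val, one_pow, one_mul]
  rcases Nat.eq_zero_or_pos (d 0) with h0 | h0
  · rw [h0, pow_zero, one_mul]
    exact monomial_sub_homEval_mem c (by omega)
  · rw [zero_pow h0.ne', zero_mul, map_zero, sub_zero]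
    exact monomial_mem_hyperplane_mul c (by omega)

theorem irreducible_restrictLine {F : MvPolynomial (Fin 4) k} (hF : F.IsHomogeneous 3)
    (h : ∀ a : Fin 4 → k, MvPolynomial.aeval a F = 0 → a = 0) (c : k) :
    Irreducible (restrictLine F c) ∧ (restrictLine F c).natDegree = 3 := by
  have hle : (restrictLine F c).natDegree ≤ 3 := by
    rw [restrictLine_eq_sum]
    refine natDegree_sum_le_of_forall_le _ _ fun d hd => ?_
    have hD := sum_eq_of_isHomogeneous hF hd
    rcases Nat.eq_zero_or_pos (d 0) with h0 | h0
    · rw [h0, pow_zero, one_mul, ← mul_assoc, ← C_mul]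
      exact (natDegree_C_mul_X_pow_le _ _).trans (by omega)
    · simp [zero_pow h0.ne']
  have hcoeff : (restrictLine F c).coeff 3 = MvPolynomial.aeval ![0, 0, 0, (1 : k)] F := by
    rw [restrictLine_eq_sum, finsetSum_coeff, MvPolynomial.aeval_def, MvPolynomial.eval₂_eq']
    refine Finset.sum_congr rfl fun d hd => ?_
    have hD := sum_eq_of_isHomogeneous hF hd
    simp only [Fin.prod_univ_four, Matrix.cons_val, one_pow, mul_one, coeff_C_mul,
      Algebra.algebraMap_self, RingHom.id_apply]
    congr 1
    rcases Nat.eq_zero_or_pos (d 0) with h0 | h0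
    · rw [h0, pow_zero, one_mul, coeff_C_mul, coeff_X_pow, pow_zero, one_mul]
      split_ifs with h3
      · have h1 : d 1 = 0 := by omega
        have h2 : d 2 = 0 := by omega
        simp [h1, h2]
      · have : d 1 ≠ 0 ∨ d 2 ≠ 0 := by omega
        rcases this with h | h <;> simp [zero_pow h]
    · simp [zero_pow h0.ne']
  have h3 : (restrictLine F c).natDegree = 3 := by
    refine natDegree_eq_of_le_of_coeff_ne_zero hle ?_
    rw [hcoeff]
    intro h0
    simpa using congrFun (h _ h0) 3
  refine ⟨?_, h3⟩
  rw [irreducible_iff_roots_eq_zero_of_degree_le_three (by omega) (by omega),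
    Multiset.eq_zero_iff_forall_notMem]
  intro ρ hρ
  have hρ := (mem_roots'.1 hρ).2
  have h1 : MvPolynomial.aeval ![0, 1, c, ρ] F = 0 := by
    rw [IsRoot.def, ← coe_aeval_eq_eval, restrictLine, MvPolynomial.comp_aeval_apply] at hρ
    have he : (fun i => aeval ρ ((![0, 1, C c, X] : Fin 4 → k[X]) i)) = ![0, 1, c, ρ] := by
      ext i
      fin_cases i <;> simp
    rwa [he] at hρ
  simpa using congrFun (h _ h1) 1

/-- After a linear change of coordinates, a function of degree exactly `D + 1` on a cubic surface
does not vanish on the line at infinity of a general hyperplane section. -/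
theorem exists_hyperplane [Infinite k] (B : Module.Basis (ℕ × ℕ × Fin 3) k A)
    (hB : ∀ t, B t = y ^ t.1 * w ^ t.2.1 * z ^ (t.2.2 : ℕ))
    (hz : z ^ 3 ∈ Submodule.span k (B '' degreeLESet 3)) {G : A} {D : ℕ}
    (hG : G ∈ (Submodule.span k {1, y, w, z}) ^ (D + 1))
    (hG' : G ∉ (Submodule.span k {1, y, w, z}) ^ D) :
    ∃ (c : k) (g : k[X]), g ≠ 0 ∧ g.natDegree ≤ 2 ∧ g.natDegree ≤ D + 1 ∧
      G - homEval k y z (D + 1) g ∈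
        Submodule.span k {1, w - c • y} * (Submodule.span k {1, y, w, z}) ^ D := by
  classical
  rw [surface_pow_eq B hB hz, Module.Basis.mem_span_image] at hG hG'
  obtain ⟨t₀, ht₀, ht₀D⟩ := Set.not_subset.1 hG'
  have hdeg : ∀ t ∈ (B.repr G).support, t.1 + t.2.1 + t.2.2 ≤ D + 1 := fun t ht => hG ht
  have ht₀' : t₀.1 + t₀.2.1 + t₀.2.2 = D + 1 := by
    have := hdeg t₀ ht₀
    have : ¬ (t₀.1 + t₀.2.1 + t₀.2.2 ≤ D) := ht₀D
    omega
  let S := (B.repr G).support.filter fun t => t.1 + t.2.1 + (t.2.2 : ℕ) = D + 1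
  have hS : t₀ ∈ S := Finset.mem_filter.2 ⟨ht₀, ht₀'⟩
  let P : k[X] := ∑ t ∈ S, if t.2.2 = t₀.2.2 then C (B.repr G t) * X ^ t.2.1 else 0
  have hP : P ≠ 0 := by
    intro h
    have h1 : P.coeff t₀.2.1 = B.repr G t₀ := by
      simp only [P, finsetSum_coeff]
      rw [Finset.sum_eq_single t₀]
      · simp
      · rintro t ht htt
        split_ifs with hi
        · rw [coeff_C_mul, coeff_X_pow, if_neg, mul_zero]
          intro hb
          refine htt ?_
          have := (Finset.mem_filter.1 ht).2
          rw [hi] at this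
          exact Prod.ext (by omega) (Prod.ext hb.symm hi)
        · simp
      · exact fun h => absurd hS h
    rw [h, coeff_zero] at h1
    exact (Finsupp.mem_support_iff.1 ht₀) h1.symm
  obtain ⟨c, hc⟩ : ∃ c, P.eval c ≠ 0 := by
    by_contra! h
    exact hP (Polynomial.funext fun c => by simp [h c])
  let g : k[X] := ∑ t ∈ S, C (B.repr G t) * (C (c ^ t.2.1) * X ^ (t.2.2 : ℕ))
  have hgdeg : ∀ e : ℕ, (∀ t ∈ S, (t.2.2 : ℕ) ≤ e) → g.natDegree ≤ e := by
    intro e he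
    refine natDegree_sum_le_of_forall_le _ _ fun t ht => ?_
    rw [← mul_assoc, ← C_mul]
    exact (natDegree_C_mul_X_pow_le _ _).trans (he t ht)
  refine ⟨c, g, ?_, hgdeg 2 fun t _ => by omega, hgdeg (D + 1) fun t ht => ?_, ?_⟩
  · intro h
    apply hc
    have : g.coeff t₀.2.2 = P.eval c := by
      simp only [g, P, finsetSum_coeff, eval_finsetSum, coeff_C_mul, coeff_X_pow]
      refine Finset.sum_congr rfl fun t _ => ?_
      by_cases hi : t.2.2 = t₀.2.2
      · simp [hi]
      · have : ¬ ((t₀.2.2 : ℕ) = t.2.2) := fun h => hi (Fin.ext h.symm)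
        simp [hi, this]
    rw [← this, h, coeff_zero]
  · have := (Finset.mem_filter.1 ht).2
    omega
  · have hGs : G = ∑ t ∈ (B.repr G).support, B.repr G t • B t := by
      conv_lhs => rw [← B.linearCombination_repr G]
      rfl
    have hgs : homEval k y z (D + 1) g = ∑ t ∈ (B.repr G).support, B.repr G t •
        (if t.1 + t.2.1 + (t.2.2 : ℕ) = D + 1 then
          homEval k y z (D + 1) (C (c ^ t.2.1) * X ^ (t.2.2 : ℕ)) else 0) := by
      simp only [g, S, map_sum, Finset.sum_filter]
      refine Finset.sum_congr rfl fun t _ => ?_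
      split_ifs
      · rw [← smul_eq_C_mul, map_smul]
      · rw [smul_zero, map_zero]
    have hsub : G - homEval k y z (D + 1) g = ∑ t ∈ (B.repr G).support, B.repr G t • (B t -
        if t.1 + t.2.1 + (t.2.2 : ℕ) = D + 1 then
          homEval k y z (D + 1) (C (c ^ t.2.1) * X ^ (t.2.2 : ℕ)) else 0) := by
      simp only [smul_sub, Finset.sum_sub_distrib]
      rw [← hgs, ← hGs]
    rw [hsub]
    refine sum_mem fun t ht => ?_
    rw [hB]
    refine Submodule.smul_mem _ _ ?_
    split_ifs with h
    · exact monomial_sub_homEval_mem c h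
    · rw [sub_zero]
      have := hdeg t ht
      exact monomial_mem_hyperplane_mul c (by omega)

end

section

open Polynomial

variable {k : Type u} {A : Type u} [Field k] [CommRing A] [Algebra k A]

theorem map_homEval {A' : Type*} [CommRing A'] [Algebra k A'] (φ : A →ₐ[k] A') (p q : A) (i : ℕ)
    (f : k[X]) : φ (homEval k p q i f) = homEval k (φ p) (φ q) i f := by
  rw [homEval_apply, homEval_apply, MvPolynomial.comp_aeval_apply]
  have : (fun i => φ ((![q, p] : Fin 2 → A) i)) = ![φ q, φ p] := by
    ext i
    fin_cases i <;> rfl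
  rw [this]

theorem span_one_y_w_z_eq (y w z : A) (c : k) : Submodule.span k {1, y, w, z} =
    Submodule.span k {1, w - c • y} ⊔ Submodule.span k {y, z} := by
  rw [← Submodule.span_union]
  apply le_antisymm <;> rw [Submodule.span_le]
  · rintro r (rfl | rfl | rfl | rfl)
    · exact Submodule.subset_span (by simp)
    · exact Submodule.subset_span (by simp)
    · have h1 := Submodule.subset_span (R := k)
        (show r - c • y ∈ ({1, r - c • y} ∪ {y, z} : Set A) by simp)
      have h2 := Submodule.subset_span (R := k) (show y ∈ ({1, r - c • y} ∪ {y, z} : Set A) by simp)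
      have := add_mem h1 (Submodule.smul_mem _ c h2)
      rwa [sub_add_cancel] at this
    · exact Submodule.subset_span (by simp)
  · rintro r ((rfl | rfl) | (rfl | rfl))
    · exact Submodule.subset_span (by simp)
    · exact sub_mem (Submodule.subset_span (by simp))
        (Submodule.smul_mem _ _ (Submodule.subset_span (by simp)))
    · exact Submodule.subset_span (by simp)
    · exact Submodule.subset_span (by simp)

theorem exists_curve_degree [Infinite k] {y w z : A} (B : Module.Basis (ℕ × ℕ × Fin 3) k A)
    (hB : ∀ t, B t = y ^ t.1 * w ^ t.2.1 * z ^ (t.2.2 : ℕ))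
    (hz : z ^ 3 ∈ Submodule.span k (B '' degreeLESet 3))
    {F : MvPolynomial (Fin 4) k} (hF : F.IsHomogeneous 3)
    (hF₀ : ∀ a : Fin 4 → k, MvPolynomial.aeval a F = 0 → a = 0)
    (hxF : MvPolynomial.aeval ![1, y, w, z] F = 0)
    {n : ℕ} (hn : ZeroDegreesDivisible F n) {G : A} {D : ℕ}
    (hG : G ∈ (Submodule.span k {1, y, w, z}) ^ (D + 1))
    (hG' : G ∉ (Submodule.span k {1, y, w, z}) ^ D) (p : Ideal A) [p.IsPrime] (hGp : G ∈ p)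
    (hinf : ¬ FiniteDimensional k (A ⧸ p)) :
    ∃ e, 1 ≤ e ∧ e ≤ 3 * (D + 1) ∧ (e < n → 3 ∣ e) ∧
      (∀ j, e = 3 * j → ∀ a, 6 * j * a + 3 * j ≤ 2 * Module.finrank k
        ↥(((Submodule.span k {1, y, w, z}) ^ a).map (Ideal.Quotient.mkₐ k p).toLinearMap) +
          3 * j * j) ∧
      ∀ a, ∀ H ∈ (Submodule.span k {1, y, w, z}) ^ a, H ∉ p → ∀ I : Ideal A, p ≤ I → H ∈ I →
        FiniteDimensional k (A ⧸ I) →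
          ∃ t, t + Module.finrank k (A ⧸ I) = e * a ∧ (t < n → 3 ∣ t) := by
  set M := Submodule.span k ({1, y, w, z} : Set A) with hM
  let π := Ideal.Quotient.mkₐ k p
  obtain ⟨c, g, hg, hg2, hgD, hgM⟩ := exists_hyperplane B hB hz hG hG'
  obtain ⟨hχ, hχ3⟩ := irreducible_restrictLine hF hF₀ c
  have hχM := aeval_sub_homEval_restrictLine_mem (y := y) (w := w) (z := z) (D := 2) hF c
  rw [hxF, zero_sub, neg_mem_iff] at hχM
  have hmap : ∀ N, (M ^ N).map π.toLinearMap = (M.map π.toLinearMap) ^ N := fun N =>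
    Submodule.map_pow M π N
  have hE : (Submodule.span k {1, w - c • y}).map π.toLinearMap =
      Submodule.span k {1, π (w - c • y)} := by
    rw [Submodule.map_span, Set.image_pair]
    simp
  have hmapE : ∀ N r, r ∈ Submodule.span k {1, w - c • y} * M ^ N →
      π r ∈ Submodule.span k {1, π (w - c • y)} * (M.map π.toLinearMap) ^ N := by
    intro N r hr
    have := Submodule.mem_map_of_mem (f := π.toLinearMap) hr
    rwa [Submodule.map_mul, hE, hmap] at this
  have hM' : M.map π.toLinearMap = Submodule.span k {1, π (w - c • y)} ⊔
      Submodule.span k {π y, π z} := by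
    rw [hM, span_one_y_w_z_eq y w z c, Submodule.map_sup, hE, Submodule.map_span, Set.image_pair]
    rfl
  have hgen : ∀ r, ∃ N, r ∈ (M.map π.toLinearMap) ^ N := by
    intro r
    obtain ⟨r, rfl⟩ := Ideal.Quotient.mkₐ_surjective k p r
    obtain ⟨N, hN⟩ := exists_mem_surface_pow B hB hz r
    exact ⟨N, by rw [← hmap]; exact ⟨r, hN, rfl⟩⟩
  have hx : Submodule.span k (Set.range fun i => π ((![1, y, w, z] : Fin 4 → A) i)) =
      M.map π.toLinearMap := by
    rw [Set.range_comp' π, hM, Submodule.map_span]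
    congr 2
    ext r
    simp [eq_comm]
    tauto
  have hxF' : MvPolynomial.aeval (fun i => π ((![1, y, w, z] : Fin 4 → A) i)) F = 0 := by
    rw [← MvPolynomial.comp_aeval_apply, hxF, map_zero]
  have hgM' := hmapE D _ hgM
  have hπG : π G = 0 := Ideal.Quotient.eq_zero_iff_mem.2 hGp
  rw [map_sub π G, hπG, zero_sub, neg_mem_iff, map_homEval] at hgM'
  have hχM' := hmapE 2 _ hχM
  rw [map_homEval] at hχM'
  obtain ⟨e, N₁, he, hstep, hrec, heD, hen, hdim⟩ := curve_numerics hinf hgen hM' _ hχ hχ3 hχM' D g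
    hg hg2 hgD hgM' hF _ hx hxF' hn
  refine ⟨e, he, heD, hen, fun j hj a => ?_, fun a H hH hHp I hpI hHI hfin => ?_⟩
  · have := hdim j hj a
    rwa [← hmap] at this
  · have eq := (DoubleQuot.quotQuotEquivQuotOfLEₐ k hpI).toLinearEquiv
    have : FiniteDimensional k ((A ⧸ p) ⧸ I.map (Ideal.Quotient.mkₐ k p)) :=
      eq.symm.finiteDimensional
    have hres := residual_numerics hgen
      (hM' ▸ Submodule.mem_sup_left (Submodule.subset_span (by simp)))
      (hM' ▸ Submodule.mem_sup_left (Submodule.subset_span (by simp))) he hstep hrec hF _ hx hxF'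
      hn (a := a) (G := π H) (by rw [← hmap]; exact ⟨H, hH, rfl⟩)
      (fun h => hHp (Ideal.Quotient.eq_zero_iff_mem.1 h)) (I.map (Ideal.Quotient.mkₐ k p))
      (Ideal.mem_map_of_mem _ hHI)
    rwa [eq.finrank_eq] at hres

end

section

variable {k : Type u} {A : Type u} [Field k] [CommRing A] [Algebra k A]

theorem finrank_quotient_inf {I J : Ideal A} (h : IsCoprime I J) [FiniteDimensional k (A ⧸ I)]
    [FiniteDimensional k (A ⧸ J)] : FiniteDimensional k (A ⧸ I ⊓ J) ∧
      Module.finrank k (A ⧸ I ⊓ J) = Module.finrank k (A ⧸ I) + Module.finrank k (A ⧸ J) := by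
  let e : (A ⧸ I ⊓ J) ≃ₐ[k] (A ⧸ I) × (A ⧸ J) :=
    AlgEquiv.ofRingEquiv (f := Ideal.quotientInfEquivQuotientProd I J h) fun r => rfl
  exact ⟨e.symm.toLinearEquiv.finiteDimensional, by
    rw [e.toLinearEquiv.finrank_eq, Module.finrank_prod]⟩

theorem exists_two_independent_mem_inf (W : Submodule k A) [FiniteDimensional k W] (I : Ideal A)
    [FiniteDimensional k (A ⧸ I)]
    (h : Module.finrank k (A ⧸ I) + 2 ≤ Module.finrank k W) :
    ∃ G ∈ W, ∃ H ∈ W, G ∈ I ∧ H ∈ I ∧ G ≠ 0 ∧ H ∉ Submodule.span k {G} := by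
  have : FiniteDimensional k (A ⧸ I.restrictScalars k) :=
    inferInstanceAs (FiniteDimensional k (A ⧸ I))
  have hr : Module.finrank k (A ⧸ I.restrictScalars k) = Module.finrank k (A ⧸ I) := rfl
  have h1 := finrank_add_finrank_map (I.restrictScalars k).mkQ W
  rw [Submodule.ker_mkQ] at h1
  have h2 := Submodule.finrank_le (W.map (I.restrictScalars k).mkQ)
  have h3 : W ⊓ I.restrictScalars k ≠ ⊥ := by
    intro h0
    rw [h0, finrank_bot] at h1
    omega
  obtain ⟨G, hG, hG0⟩ := Submodule.exists_mem_ne_zero_of_ne_bot h3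
  have h4 : ¬ W ⊓ I.restrictScalars k ≤ Submodule.span k {G} := by
    intro hle
    have h5 := Submodule.finrank_mono hle
    have h6 := finrank_span_singleton (K := k) hG0
    omega
  obtain ⟨H, hH, hHG⟩ := SetLike.not_le_iff_exists.1 h4
  exact ⟨G, hG.1, H, hH.1, hG.2, hH.2, hG0, hHG⟩

theorem residual_degree_lt {j d n b t : ℕ} (hb : 6 * j * b + 3 * j < 2 * (n + 1) + 3 * j * j)
    (ht : t + n = 3 * j * (b + 1)) (hj : j < d) (hdn : 3 * d * d < 2 * n + 3 * d) : t < n := by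
  obtain ⟨q, hq⟩ := Nat.even_mul_succ_self j
  obtain ⟨i, rfl⟩ := Nat.exists_eq_add_of_lt hj
  simp only [Nat.mul_add, Nat.add_mul, Nat.mul_assoc, Nat.mul_one,
    Nat.mul_comm i j] at *
  omega

theorem kernel_finrank_le {i j f g h h' : ℕ} (h₁ : f + g = h)
    (h₂ : 2 * h = 3 * (i + j) * (i + j + 1) + 2)
    (h₃ : 2 * h' = 3 * i * (i + 1) + 2) (h₄ : 6 * j * (i + j) + 3 * j ≤ 2 * g + 3 * j * j) :
    f ≤ h' := by
  simp only [Nat.mul_add, Nat.add_mul, Nat.mul_assoc, Nat.mul_one,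
    Nat.mul_comm j i] at *
  omega

/-- A system of functions on a surface of low degree through a point of degree `n` has complete
intersections to which the residual argument applies. -/
theorem complete_intersection_residual [IsDomain A] [Infinite k] {y w z : A}
    (B : Module.Basis (ℕ × ℕ × Fin 3) k A)
    (hB : ∀ t, B t = y ^ t.1 * w ^ t.2.1 * z ^ (t.2.2 : ℕ))
    (hz : z ^ 3 ∈ Submodule.span k (B '' degreeLESet 3))
    {F : MvPolynomial (Fin 4) k} (hF : F.IsHomogeneous 3)
    (hF₀ : ∀ a : Fin 4 → k, MvPolynomial.aeval a F = 0 → a = 0)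
    (hxF : MvPolynomial.aeval ![1, y, w, z] F = 0)
    (hcurve : ∀ G : A, G ≠ 0 → ∀ p ∈ (Ideal.span {G}).minimalPrimes,
      ¬ FiniteDimensional k (A ⧸ p))
    {n : ℕ} (hn : ZeroDegreesDivisible F n) (m : Ideal A) [m.IsMaximal]
    [FiniteDimensional k (A ⧸ m)] (hmn : Module.finrank k (A ⧸ m) = n) (h3 : ¬ 3 ∣ n)
    {d : ℕ} (hd : 3 * d < n) (hdn : 3 * d * d < 2 * n + 3 * d) {G : A}
    (hG : G ∈ (Submodule.span k {1, y, w, z}) ^ d) (hG0 : G ≠ 0) (hGm : G ∈ m)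
    {H : A} (hH : H ∈ (Submodule.span k {1, y, w, z}) ^ d) (hGH : H ∉ Submodule.span k {G})
    (I : Ideal A) (hGI : G ∈ I) (hHI : H ∈ I) (hI : FiniteDimensional k (A ⧸ I)) :
    ∃ t, t + Module.finrank k (A ⧸ I) = 3 * d * d ∧ (t < n → 3 ∣ t) := by
  classical
  have hex : ∃ N, G ∈ (Submodule.span k {1, y, w, z}) ^ N := ⟨d, hG⟩
  have hfind0 : Nat.find hex ≠ 0 := by
    intro h0
    have h1 := Nat.find_spec hex
    rw [h0, pow_zero] at h1
    obtain ⟨c, hc⟩ := Submodule.mem_one.1 h1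
    have hc0 : c ≠ 0 := by rintro rfl; exact hG0 (by rw [← hc, map_zero])
    refine (Ideal.IsPrime.ne_top (I := m) inferInstance) (Ideal.eq_top_of_isUnit_mem _ hGm ?_)
    rw [← hc]
    exact (IsUnit.mk0 c hc0).map _
  obtain ⟨D, hD⟩ := Nat.exists_eq_succ_of_ne_zero hfind0
  have hDd : D + 1 ≤ d := by
    have := Nat.find_min' hex hG
    omega
  have hGD : G ∈ (Submodule.span k {1, y, w, z}) ^ (D + 1) := by
    have := Nat.find_spec hex
    rwa [hD] at this
  have hGD' : G ∉ (Submodule.span k {1, y, w, z}) ^ D := Nat.find_min hex (by omega)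
  obtain ⟨p, hp, hpm⟩ := Ideal.exists_minimalPrimes_le (J := m)
    (show Ideal.span {G} ≤ m by rwa [Ideal.span_singleton_le_iff_mem])
  have hpp : p.IsPrime := hp.1.1
  have hGp : G ∈ p := hp.1.2 (Ideal.mem_span_singleton_self G)
  obtain ⟨e, he, heD, hen, hdim, hres⟩ := exists_curve_degree B hB hz hF hF₀ hxF hn hGD hGD' p hGp
    (hcurve G hG0 p hp)
  set M := Submodule.span k ({1, y, w, z} : Set A) with hM
  have : FiniteDimensional k M := FiniteDimensional.span_of_finite k (Set.toFinite _)
  have hfin := finiteDimensional_submodule_pow M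
  have h1M : (1 : A) ∈ M := Submodule.subset_span (by simp)
  obtain ⟨j, rfl⟩ := hen (by omega)
  have hdim' := hdim j rfl
  have hh := two_mul_finrank_surface_pow B hB hz
  rw [← hM] at hh
  rcases lt_or_eq_of_le (show j ≤ d by omega) with hj | rfl
  · exfalso
    have hexa : ∃ a, 2 * (n + 1) + 3 * j * j ≤ 6 * j * a + 3 * j :=
      ⟨2 * (n + 1) + 3 * j * j, (Nat.le_mul_of_pos_left _ (by omega)).trans (Nat.le_add_right _ _)⟩
    have ha := Nat.find_spec hexa
    have ha' := fun b => Nat.find_min hexa (m := b)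
    set a := Nat.find hexa
    have ha0 : a ≠ 0 := by
      intro h0
      rw [h0] at ha
      nlinarith
    obtain ⟨b, hb⟩ := Nat.exists_eq_succ_of_ne_zero ha0
    have hb' := ha' b (by omega)
    let φ : (A ⧸ p) →ₗ[k] (A ⧸ m) := (Ideal.Quotient.factorₐ k hpm).toLinearMap
    let W := (M ^ a).map (Ideal.Quotient.mkₐ k p).toLinearMap
    have hker : LinearMap.ker (φ ∘ₗ W.subtype) ≠ ⊥ := by
      apply LinearMap.ker_ne_bot_of_finrank_lt
      rw [hmn]
      have := hdim' a
      change n < Module.finrank k W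
      change 6 * j * a + 3 * j ≤ 2 * Module.finrank k W + 3 * j * j at this
      omega
    obtain ⟨⟨_, r, hr, rfl⟩, hr', hr0⟩ := Submodule.exists_mem_ne_zero_of_ne_bot hker
    have hrm : r ∈ m := by
      rw [LinearMap.mem_ker] at hr'
      exact Ideal.Quotient.eq_zero_iff_mem.1 hr'
    have hrp : r ∉ p := fun h => hr0 (Subtype.ext (Ideal.Quotient.eq_zero_iff_mem.2 h))
    obtain ⟨t, ht, htn⟩ := hres a r hr hrp m hpm hrm inferInstance
    rw [hmn] at ht
    have h6 : t < n := residual_degree_lt (not_le.1 hb') (by rw [ht, hb]) hj hdn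
    have h7 := htn h6
    apply h3
    have h8 : 3 ∣ t + n := ht ▸ ⟨j * a, by ring⟩
    exact (Nat.dvd_add_right h7).1 h8
  · have hpM : ∀ N, j ≤ N → M ^ N ⊓ p.restrictScalars k =
        (M ^ (N - j)).map (LinearMap.mulLeft k G) := by
      intro N hN
      symm
      have : FiniteDimensional k ↥(M ^ N ⊓ p.restrictScalars k) :=
        Submodule.finiteDimensional_of_le inf_le_left
      apply Submodule.eq_of_le_of_finrank_le
      · rintro _ ⟨s, hs, rfl⟩
        refine ⟨?_, Ideal.mul_mem_right _ _ hGp⟩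
        have := Submodule.mul_mem_mul hG hs
        rwa [← pow_add, show j + (N - j) = N by omega] at this
      · have e1 := finrank_add_finrank_map (Ideal.Quotient.mkₐ k p).toLinearMap (M ^ N)
        have e2 : LinearMap.ker (Ideal.Quotient.mkₐ k p).toLinearMap = p.restrictScalars k := by
          ext r
          exact Ideal.Quotient.eq_zero_iff_mem
        rw [e2] at e1
        have e3 := (Submodule.equivMapOfInjective (LinearMap.mulLeft k G)
          (mul_right_injective₀ hG0) (M ^ (N - j))).finrank_eq
        have e4 := hdim' N
        have e5 := hh N
        have e6 := hh (N - j)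
        obtain ⟨i, rfl⟩ := Nat.exists_eq_add_of_le' hN
        rw [Nat.add_sub_cancel] at e6 e3 ⊢
        exact kernel_finrank_le (by omega) e5 (e3 ▸ e6) e4
    have hpG : p = Ideal.span {G} := by
      apply le_antisymm
      · intro r hr
        obtain ⟨N, hN⟩ := exists_mem_surface_pow B hB hz r
        have h1 : r ∈ M ^ (N + j) ⊓ p.restrictScalars k :=
          ⟨pow_le_pow_right' (Submodule.one_le.2 h1M) (Nat.le_add_right _ _) hN, hr⟩
        rw [hpM _ (by omega)] at h1
        obtain ⟨s, -, rfl⟩ := h1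
        exact Ideal.mul_mem_right _ _ (Ideal.mem_span_singleton_self G)
      · rwa [Ideal.span_singleton_le_iff_mem]
    refine hres j H hH (fun hHp => hGH ?_) I (by rwa [hpG, Ideal.span_singleton_le_iff_mem]) hHI hI
    have h1 : H ∈ M ^ j ⊓ p.restrictScalars k := ⟨hH, hHp⟩
    rw [hpM j le_rfl, Nat.sub_self, pow_zero] at h1
    obtain ⟨s, hs, rfl⟩ := h1
    obtain ⟨c, rfl⟩ := Submodule.mem_one.1 hs
    rw [Submodule.mem_span_singleton]
    exact ⟨c, by rw [LinearMap.mulLeft_apply, Algebra.smul_def, mul_comm]⟩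

end

section

variable {k : Type u} {A : Type u} [Field k] [CommRing A] [Algebra k A] {y w z : A}

theorem finrank_quotient_staircaseIdeal_sup (B : Module.Basis (ℕ × ℕ × Fin 3) k A)
    (hB : ∀ t, B t = y ^ t.1 * w ^ t.2.1 * z ^ (t.2.2 : ℕ)) {Δ Δ' : Finset (ℕ × ℕ)}
    (hΔ' : ∀ a b, (a, b) ∉ Δ' → ∀ p q, (a + p, b + q) ∉ Δ')
    (h : ∀ p q, p ≠ 0 ∨ q ≠ 0 → ∀ a b, (a, b) ∉ Δ → (p + a, q + b) ∉ Δ') {G H : A}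
    (hG : G ∈ staircaseIdeal y w Δ) (hH : H ∈ staircaseIdeal y w Δ) :
    FiniteDimensional k (A ⧸ staircaseIdeal y w Δ' ⊔ Ideal.span {G, H}) ∧
      Module.finrank k (A ⧸ staircaseIdeal y w Δ' ⊔ Ideal.span {G, H}) ≤ 3 * Δ'.card ∧
      3 * Δ'.card ≤ Module.finrank k (A ⧸ staircaseIdeal y w Δ' ⊔ Ideal.span {G, H}) + 6 := by
  obtain ⟨h1, h2⟩ := finrank_quotient_staircaseIdeal B hB Δ' hΔ'
  set I := staircaseIdeal y w Δ'
  let φ : (A ⧸ I) →ₗ[k] (A ⧸ I ⊔ Ideal.span {G, H}) :=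
    (Ideal.Quotient.factorₐ k (le_sup_left (a := I) (b := Ideal.span {G, H}))).toLinearMap
  have hφ : Function.Surjective φ := Ideal.Quotient.factor_surjective le_sup_left
  have hfin : FiniteDimensional k (A ⧸ I ⊔ Ideal.span {G, H}) :=
    FiniteDimensional.of_surjective φ hφ
  refine ⟨hfin, h2 ▸ LinearMap.finrank_le_finrank_of_surjective hφ, ?_⟩
  let s : Fin 3 ⊕ Fin 3 → A := Sum.elim (fun l => z ^ (l : ℕ) * G) fun l => z ^ (l : ℕ) * H
  have key : ∀ E ∈ staircaseIdeal y w Δ, (∀ l : Fin 3, z ^ (l : ℕ) * E ∈ Set.range s) → ∀ c,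
      c * E ∈ I.restrictScalars k ⊔ Submodule.span k (Set.range s) := by
    intro E hE hs c
    have hc : c ∈ Submodule.span k (Set.range B) := by rw [B.span_eq]; trivial
    induction hc using Submodule.span_induction with
    | mem x hx =>
      obtain ⟨⟨p, q, l⟩, rfl⟩ := hx
      rw [hB]
      by_cases hpq : p ≠ 0 ∨ q ≠ 0
      · refine Submodule.mem_sup_left ?_
        have := Ideal.mul_mem_left I (z ^ (l : ℕ)) (mul_mem_staircaseIdeal p q (h p q hpq) hE)
        change _ ∈ I
        convert this using 1
        ring
      · obtain ⟨rfl, rfl⟩ : p = 0 ∧ q = 0 := by tauto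
        refine Submodule.mem_sup_right (Submodule.subset_span ?_)
        simpa using hs l
    | zero => simp
    | add x y _ _ hx hy => rw [add_mul]; exact add_mem hx hy
    | smul a x _ hx => rw [smul_mul_assoc]; exact Submodule.smul_mem _ _ hx
  have hker : LinearMap.ker φ ≤
      Submodule.span k (Set.range ((Ideal.Quotient.mkₐ k I).toLinearMap ∘ s)) := by
    intro v hv
    obtain ⟨r, rfl⟩ := Ideal.Quotient.mk_surjective v
    have hr : r ∈ I ⊔ Ideal.span {G, H} := Ideal.Quotient.eq_zero_iff_mem.1 hv
    obtain ⟨a, ha, b, hb, rfl⟩ := Submodule.mem_sup.1 hr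
    obtain ⟨g, h, rfl⟩ := Ideal.mem_span_pair.1 hb
    have h3 : a + (g * G + h * H) ∈ I.restrictScalars k ⊔ Submodule.span k (Set.range s) :=
      add_mem (Submodule.mem_sup_left ha) (add_mem (key G hG (fun l => ⟨Sum.inl l, rfl⟩) g)
        (key H hH (fun l => ⟨Sum.inr l, rfl⟩) h))
    have h4 := Submodule.mem_map_of_mem (f := (Ideal.Quotient.mkₐ k I).toLinearMap) h3
    have h0 : (I.restrictScalars k).map (Ideal.Quotient.mkₐ k I).toLinearMap = ⊥ :=
      (I.restrictScalars k).mkQ_map_self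
    rw [Submodule.map_sup, h0, bot_sup_eq, Submodule.map_span, ← Set.range_comp] at h4
    exact h4
  have : FiniteDimensional k
      ↥(Submodule.span k (Set.range ((Ideal.Quotient.mkₐ k I).toLinearMap ∘ s))) :=
    FiniteDimensional.span_of_finite k (Set.finite_range _)
  have h5 := (Submodule.finrank_mono hker).trans (finrank_range_le_card _)
  have h6 := LinearMap.finrank_range_add_finrank_ker φ
  rw [LinearMap.range_eq_top.2 hφ, finrank_top, h2] at h6
  simp only [Fintype.card_sum, Fintype.card_fin] at h5
  omega

/-- No point of degree at least seven and different from ten on a cubic surface is minimal among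
the points of degree prime to three. -/
theorem not_zeroDegreesDivisible_of_maximal (B : Module.Basis (ℕ × ℕ × Fin 3) k A)
    [IsDomain A] [Infinite k]
    (hB : ∀ t, B t = y ^ t.1 * w ^ t.2.1 * z ^ (t.2.2 : ℕ))
    (hz : z ^ 3 ∈ Submodule.span k (B '' degreeLESet 3))
    {F : MvPolynomial (Fin 4) k} (hF : F.IsHomogeneous 3)
    (hF₀ : ∀ a : Fin 4 → k, MvPolynomial.aeval a F = 0 → a = 0)
    (hxF : MvPolynomial.aeval ![1, y, w, z] F = 0)
    (hcurve : ∀ G : A, G ≠ 0 → ∀ p ∈ (Ideal.span {G}).minimalPrimes,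
      ¬ FiniteDimensional k (A ⧸ p))
    {n : ℕ} (m : Ideal A) [hm : m.IsMaximal]
    [FiniteDimensional k (A ⧸ m)] (hmn : Module.finrank k (A ⧸ m) = n) (h3 : ¬ 3 ∣ n)
    (h7 : 7 ≤ n) (h10 : n ≠ 10) : ¬ ZeroDegreesDivisible F n := by
  classical
  intro hn
  have hex : ∃ d, 2 * n ≤ 3 * d * (d + 1) := ⟨2 * n, by nlinarith⟩
  have hd1 := Nat.find_spec hex
  have hd2 := fun d => Nat.find_min hex (m := d)
  generalize Nat.find hex = d at hd1 hd2
  obtain ⟨q, hq⟩ := Nat.even_mul_succ_self d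
  have hd0 : 2 ≤ d := by
    by_contra hlt
    interval_cases d <;> omega
  have hd3 : 3 * d * d < 2 * n + 3 * d := by
    have := hd2 (d - 1) (by omega)
    obtain ⟨c, rfl⟩ : ∃ c, d = c + 1 := ⟨d - 1, by omega⟩
    rw [Nat.add_sub_cancel] at this
    nlinarith
  have hdn : 3 * d < n := by
    rcases Nat.lt_or_ge d 4 with h | h
    · interval_cases d <;> omega
    · nlinarith
  have hq1 : d * d + d = 2 * q := by rw [← two_mul] at hq; rw [← hq]; ring
  have hq2 : n ≤ 3 * q := by rw [mul_assoc, hq] at hd1; omega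
  have hq3 : 3 * q < n + 3 * d := by rw [mul_assoc] at hd3; omega
  have hMd : Module.finrank k ↥((Submodule.span k {1, y, w, z}) ^ d) = 3 * q + 1 := by
    have := two_mul_finrank_surface_pow B hB hz d
    rw [mul_assoc, hq] at this
    omega
  have : FiniteDimensional k ↥(Submodule.span k ({1, y, w, z} : Set A)) :=
    FiniteDimensional.span_of_finite k (Set.toFinite _)
  have hfin := finiteDimensional_submodule_pow (Submodule.span k ({1, y, w, z} : Set A)) d
  have hpair : ∀ Δ : Finset (ℕ × ℕ), (∀ a b, (a, b) ∉ Δ → ∀ p q, (a + p, b + q) ∉ Δ) →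
      n + 3 * Δ.card + 1 ≤ 3 * q → ∃ G H, G ∈ (Submodule.span k {1, y, w, z}) ^ d ∧
        H ∈ (Submodule.span k {1, y, w, z}) ^ d ∧ G ∈ m ∧ H ∈ m ∧ G ∈ staircaseIdeal y w Δ ∧
        H ∈ staircaseIdeal y w Δ ∧ G ≠ 0 ∧ H ∉ Submodule.span k {G} := by
    intro Δ hΔ hc
    obtain ⟨h1, h2⟩ := finrank_quotient_staircaseIdeal B hB Δ hΔ
    obtain ⟨h4, h5⟩ := finrank_quotient_inf (k := k)
      (isCoprime_of_staircaseIdeal_le B hB hm (by omega) (le_refl (staircaseIdeal y w Δ)))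
    obtain ⟨G, hG, H, hH, hGI, hHI, hG0, hGH⟩ := exists_two_independent_mem_inf
      ((Submodule.span k {1, y, w, z}) ^ d) (m ⊓ staircaseIdeal y w Δ)
      (by rw [h5, h2, hMd]; omega)
    exact ⟨G, H, hG, hH, hGI.1, hHI.1, hGI.2, hHI.2, hG0, hGH⟩
  have hstair : ∀ j, n + 3 * j + 1 ≤ 3 * q →
      3 * q ≤ n + 3 * j + 2 → 3 * q + 1 < n + 3 * d → False := by
    intro j hj1 hj2 hnd
    let Δ : Finset (ℕ × ℕ) := {0} ×ˢ Finset.range j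
    have hΔ : ∀ a b, (a, b) ∉ Δ → ∀ p q, (a + p, b + q) ∉ Δ := by
      intro a b
      simp only [Δ, Finset.mem_product, Finset.mem_singleton, Finset.mem_range]
      omega
    have hcard : Δ.card = j := by simp [Δ]
    obtain ⟨G, H, hG, hH, hGm, hHm, hGI, hHI, hG0, hGH⟩ := hpair Δ hΔ (by omega)
    obtain ⟨h1, h2⟩ := finrank_quotient_staircaseIdeal B hB Δ hΔ
    obtain ⟨h4, h5⟩ := finrank_quotient_inf (k := k)
      (isCoprime_of_staircaseIdeal_le B hB hm (by omega) (le_refl (staircaseIdeal y w Δ)))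
    obtain ⟨t, ht, htn⟩ := complete_intersection_residual B hB hz hF hF₀ hxF hcurve hn m hmn h3 hdn
      hd3 hG hG0 hGm hH hGH (m ⊓ staircaseIdeal y w Δ) ⟨hGm, hGI⟩ ⟨hHm, hHI⟩ h4
    rw [h5, h2, hmn, hcard, mul_assoc] at ht
    have := htn (by rcases hj2.eq_or_lt with h | h <;> omega)
    omega
  by_cases hspecial : 3 * q + 1 = n + 3 * d
  · have hd4 : 4 ≤ d := by
      by_contra hlt
      interval_cases d <;> omega
    obtain ⟨j, rfl⟩ := Nat.exists_eq_add_of_le' hd4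
    let Δ : Finset (ℕ × ℕ) := ({0} ×ˢ Finset.range (j + 2)) ∪ {(1, 0)}
    let Δ' : Finset (ℕ × ℕ) := ({0} ×ˢ Finset.range (j + 3)) ∪ {(1, 0), (1, 1), (2, 0)}
    have hΔ : ∀ a b, (a, b) ∉ Δ → ∀ p q, (a + p, b + q) ∉ Δ := by
      intro a b
      simp only [Δ, Finset.mem_product, Finset.mem_singleton, Finset.mem_range, Finset.mem_union,
        Prod.mk.injEq]
      omega
    have hΔ' : ∀ a b, (a, b) ∉ Δ' → ∀ p q, (a + p, b + q) ∉ Δ' := by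
      intro a b
      simp only [Δ', Finset.mem_product, Finset.mem_singleton, Finset.mem_range, Finset.mem_union,
        Prod.mk.injEq, Finset.mem_insert]
      omega
    have hΔΔ' : ∀ p q, p ≠ 0 ∨ q ≠ 0 → ∀ a b, (a, b) ∉ Δ → (p + a, q + b) ∉ Δ' := by
      intro p q hpq a b
      simp only [Δ, Δ', Finset.mem_product, Finset.mem_singleton, Finset.mem_range,
        Finset.mem_union, Prod.mk.injEq, Finset.mem_insert]
      omega
    have hcard : Δ.card = j + 3 := by
      rw [Finset.card_union_of_disjoint]
      · simp
      · simp
    have hcard' : Δ'.card = j + 6 := by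
      rw [Finset.card_union_of_disjoint]
      · simp
      · simp
    obtain ⟨G, H, hG, hH, hGm, hHm, hGI, hHI, hG0, hGH⟩ := hpair Δ hΔ (by omega)
    obtain ⟨h1, h2, h2'⟩ := finrank_quotient_staircaseIdeal_sup B hB hΔ' hΔΔ' hGI hHI
    set I := staircaseIdeal y w Δ' ⊔ Ideal.span {G, H} with hI
    have hGI' : G ∈ I := Ideal.mem_sup_right (Ideal.subset_span (by simp))
    have hHI' : H ∈ I := Ideal.mem_sup_right (Ideal.subset_span (by simp))
    obtain ⟨h4, h5⟩ := finrank_quotient_inf (k := k)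
      (isCoprime_of_staircaseIdeal_le B hB hm (by omega) (le_sup_left : staircaseIdeal y w Δ' ≤ I))
    obtain ⟨t, ht, htn⟩ := complete_intersection_residual B hB hz hF hF₀ hxF hcurve hn m hmn h3 hdn
      hd3 hG hG0 hGm hH hGH (m ⊓ I) ⟨hGm, hGI'⟩ ⟨hHm, hHI'⟩ h4
    rw [h5, hmn, mul_assoc] at ht
    change _ ≤ Module.finrank k (A ⧸ I) + 6 at h2'
    change Module.finrank k (A ⧸ I) ≤ _ at h2
    change t + (n + Module.finrank k (A ⧸ I)) = _ at ht
    have hjj : (j + 4) * (j + 4) = j * j + 8 * j + 16 := by ring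
    have h6 : 3 ∣ Module.finrank k (A ⧸ I) := by
      refine hn.three_dvd_finrank ![1, y, w, z] hxF ?_ _ (A ⧸ I) rfl ?_
      · exact Ideal.eq_top_of_isUnit_mem _ (Ideal.subset_span ⟨0, rfl⟩) isUnit_one
      · have := Nat.zero_le (j * j)
        omega
    have := htn (by omega)
    omega
  · obtain ⟨j, hj⟩ : ∃ j, n + 3 * j + 1 ≤ 3 * q ∧ 3 * q ≤ n + 3 * j + 2 :=
      ⟨(3 * q - n) / 3, by omega, by omega⟩
    exact hstair j hj.1 hj.2 (by omega)

end

section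

open Polynomial

theorem exists_ne_zero_aeval_mem {k A : Type*} [Field k] [CommRing A] [Algebra k A] (p : Ideal A)
    [FiniteDimensional k (A ⧸ p)] (a : A) : ∃ g : k[X], g ≠ 0 ∧ aeval a g ∈ p := by
  have hθint : IsIntegral k (Ideal.Quotient.mkₐ k p a) := IsIntegral.of_finite k _
  obtain ⟨g, hg, hga⟩ := hθint
  refine ⟨g, hg.ne_zero, Ideal.Quotient.eq_zero_iff_mem.1 ?_⟩
  rw [← Polynomial.aeval_def, Polynomial.aeval_algHom_apply] at hga
  exact hga

/-- Minimal primes over a principal ideal of a free algebra over the polynomial ring in two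
variables have infinite codimension. -/
theorem not_finiteDimensional_quotient_of_mem_minimalPrimes {k A : Type*} [Field k] [CommRing A]
    [IsDomain A] [IsNoetherianRing A] [Algebra k A] [Algebra k[X][X] A]
    [IsScalarTower k k[X][X] A] [Module.Free k[X][X] A] {G : A}
    {p : Ideal A} (hp : p ∈ (Ideal.span {G}).minimalPrimes) : ¬ FiniteDimensional k (A ⧸ p) := by
  intro hfin
  have hpp : p.IsPrime := hp.1.1
  obtain ⟨g, hg, hgp⟩ := exists_ne_zero_aeval_mem (k := k) p (algebraMap k[X][X] A (C X))
  obtain ⟨h, hh, hhp⟩ := exists_ne_zero_aeval_mem (k := k) p (algebraMap k[X][X] A X)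
  rw [Polynomial.aeval_algebraMap_apply] at hgp hhp
  have hC : ∀ g : k[X], aeval (C X : k[X][X]) g = C g := by
    intro g
    have h1 : aeval (C X : k[X][X]) = (Polynomial.CAlgHom (R := k) (A := k[X])) := by
      ext1
      simp
    rw [h1]
    rfl
  rw [hC] at hgp
  obtain ⟨π, hπ, hπp⟩ : ∃ π : k[X], Irreducible π ∧ algebraMap k[X][X] A (C π) ∈ p := by
    have hprod := UniqueFactorizationMonoid.factors_prod hg
    obtain ⟨v, hv⟩ := hprod
    have h2 : algebraMap k[X][X] A (C (UniqueFactorizationMonoid.factors g).prod) ∈ p := by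
      rw [← hv, map_mul, map_mul] at hgp
      exact (hpp.mem_or_mem hgp).resolve_right fun h =>
        hpp.ne_top (Ideal.eq_top_of_isUnit_mem _ h ((v.isUnit.map C).map _))
    rw [← RingHom.comp_apply, map_multiset_prod,
      Ideal.IsPrime.multiset_prod_mem_iff_exists_mem hpp] at h2
    obtain ⟨_, h2, h3⟩ := h2
    obtain ⟨π, hπ, rfl⟩ := Multiset.mem_map.1 h2
    exact ⟨π, UniqueFactorizationMonoid.irreducible_of_factor π hπ, h3⟩
  have hprime : Prime (C π : k[X][X]) := Polynomial.prime_C_iff.2 hπ.prime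
  have : (Ideal.span {(C π : k[X][X])}).IsPrime :=
    (Ideal.span_singleton_prime hprime.ne_zero).2 hprime
  have hlt : Ideal.span {(C π : k[X][X])} < p.under k[X][X] := by
    refine lt_of_le_of_ne ((Ideal.span_singleton_le_iff_mem _).2 hπp) fun heq => ?_
    have h4 : aeval (X : k[X][X]) h ∈ p.under k[X][X] := hhp
    rw [← heq, Ideal.mem_span_singleton, Polynomial.C_dvd_iff_dvd_coeff] at h4
    have h5 := h4 h.natDegree
    have h6 : aeval (X : k[X][X]) h = h.map C := by
      have h1 : aeval (X : k[X][X]) =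
          Polynomial.mapAlgHom (Polynomial.CAlgHom (R := k) (A := k)) := by
        ext1
        simp
      rw [h1]
      rfl
    rw [h6, coeff_map] at h5
    refine hπ.not_isUnit (isUnit_of_dvd_unit h5 ((IsUnit.mk0 _ ?_).map C))
    exact leadingCoeff_ne_zero.2 hh
  obtain ⟨p₁, hp₁, hp₁', hlies⟩ := Ideal.exists_ideal_lt_liesOver_of_lt p hlt
  have h7 : p.height ≤ 1 :=
    Ideal.height_le_one_of_isPrincipal_of_mem_minimalPrimes (Ideal.span {G}) p hp
  have h8 : (⊥ : Ideal A) < p₁ := by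
    refine bot_lt_iff_ne_bot.2 fun h0 => hprime.ne_zero ?_
    have h9 : C π ∈ p₁.under k[X][X] := hlies.over ▸ Ideal.mem_span_singleton_self _
    rw [h0] at h9
    exact FaithfulSMul.algebraMap_injective k[X][X] A (by rw [map_zero]; exact h9)
  have h9 := Ideal.height_add_one_le_of_lt_of_isPrime h8
  have h10 := Ideal.height_add_one_le_of_lt_of_isPrime hp₁
  have h11 : (1 : ℕ∞) + 1 ≤ 1 :=
    (add_le_add_left (le_add_self.trans h9) 1).trans (h10.trans h7)
  norm_num at h11

/-- A cubic form is the sum of a multiple of the cube of the last variable and of terms of lower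
degree in this variable. -/
theorem exists_eq_C_mul_X_pow_add {k : Type*} [Field k] {F : MvPolynomial (Fin 4) k}
    (hF : F.IsHomogeneous 3) (hF₀ : ∀ a : Fin 4 → k, MvPolynomial.aeval a F = 0 → a = 0) :
    ∃ (κ : k) (F' : MvPolynomial (Fin 4) k), κ ≠ 0 ∧
      F = MvPolynomial.C κ * MvPolynomial.X 3 ^ 3 + F' ∧
      ∀ d ∈ F'.support, d 0 + d 1 + d 2 + d 3 = 3 ∧ d 3 ≤ 2 := by
  classical
  have hd : ∀ d ∈ (F - MvPolynomial.C (F.coeff (Finsupp.single 3 3)) *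
      MvPolynomial.X 3 ^ 3).support, d 0 + d 1 + d 2 + d 3 = 3 ∧ d 3 ≤ 2 := by
    intro d hd
    have h0 := (MvPolynomial.isHomogeneous_C (Fin 4) (F.coeff (Finsupp.single 3 3))).mul
      ((MvPolynomial.isHomogeneous_X k (3 : Fin 4)).pow 3)
    have h1 := hF.sub h0
    have h2 := sum_eq_of_isHomogeneous h1 hd
    refine ⟨h2, ?_⟩
    by_contra h3
    have h4 : d = Finsupp.single 3 3 := by
      ext i
      fin_cases i <;> simp <;> omega
    rw [MvPolynomial.mem_support_iff, h4] at hd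
    apply hd
    rw [MvPolynomial.coeff_sub, MvPolynomial.C_mul_X_pow_eq_monomial, MvPolynomial.coeff_monomial,
      if_pos rfl, sub_self]
  refine ⟨F.coeff (Finsupp.single 3 3),
    F - MvPolynomial.C (F.coeff (Finsupp.single 3 3)) * MvPolynomial.X 3 ^ 3,
    fun h0 => ?_, by ring, hd⟩
  have h1 : MvPolynomial.aeval ![0, 0, 0, (1 : k)] F = 0 := by
    rw [h0, map_zero, zero_mul, sub_zero] at hd
    rw [MvPolynomial.aeval_def, MvPolynomial.eval₂_eq']
    refine Finset.sum_eq_zero fun d hdF => ?_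
    obtain ⟨h2, h3⟩ := hd d hdF
    have h4 : d 0 ≠ 0 ∨ d 1 ≠ 0 ∨ d 2 ≠ 0 := by omega
    rw [Fin.prod_univ_four]
    rcases h4 with h | h | h <;> simp [zero_pow h]
  have h2 := congrFun (hF₀ _ h1) 3
  simp at h2

end

section

open Polynomial

/-- No extension of degree at least seven and different from ten is minimal among the extensions
of degree prime to three in which a cubic form has a zero. -/
theorem not_zeroDegreesDivisible_finrank {k : Type u} [Field k] [Infinite k]
    {F : MvPolynomial (Fin 4) k} (hF : F.IsHomogeneous 3)
    (hF₀ : ∀ a : Fin 4 → k, MvPolynomial.aeval a F = 0 → a = 0) {K : Type u} [Field K]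
    [Algebra k K] [FiniteDimensional k K] {x : Fin 4 → K} (hx0 : x 0 = 1)
    (hx : MvPolynomial.aeval x F = 0) (h3 : ¬ 3 ∣ Module.finrank k K)
    (h7 : 7 ≤ Module.finrank k K) (h10 : Module.finrank k K ≠ 10) :
    ¬ ZeroDegreesDivisible F (Module.finrank k K) := by
  intro hn
  obtain ⟨κ, F', hκ, hFF', hF'⟩ := exists_eq_C_mul_X_pow_add hF hF₀
  let P : Fin 4 → k[X][X][X] := ![1, C (C X), C X, X]
  let f : k[X][X][X] := X ^ 3 + κ⁻¹ • MvPolynomial.aeval P F'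
  have hfκ : κ • f = MvPolynomial.aeval P F := by
    rw [hFF']
    simp only [f, smul_add, smul_inv_smul₀ hκ, map_add, map_mul, map_pow, MvPolynomial.aeval_X,
      MvPolynomial.aeval_C]
    rw [Algebra.smul_def]
    rfl
  have hmap : ∀ {Q : Type u} [CommRing Q] [Algebra k Q] (ψ : k[X][X][X] →ₐ[k] Q),
      MvPolynomial.aeval ![1, ψ (C (C X)), ψ (C X), ψ X] F = κ • ψ f := by
    intro Q _ _ ψ
    rw [← map_smul, hfκ]
    refine Eq.trans ?_ (MvPolynomial.comp_aeval_apply (f := P) ψ F).symm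
    congr 2
    funext i
    fin_cases i <;> simp [P]
  have hdeg : (κ⁻¹ • MvPolynomial.aeval P F').degree < (3 : ℕ) := by
    refine (degree_smul_le _ _).trans_lt ?_
    rw [MvPolynomial.aeval_def, MvPolynomial.eval₂_eq']
    refine (degree_sum_le _ _).trans_lt
      ((Finset.sup_lt_iff (by exact WithBot.bot_lt_coe _)).2 fun d hd => ?_)
    rw [Fin.prod_univ_four]
    have h1 : (algebraMap k k[X][X][X] (F'.coeff d)) *
        (P 0 ^ d 0 * P 1 ^ d 1 * P 2 ^ d 2 * P 3 ^ d 3)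
        = C (C (C (F'.coeff d)) * C X ^ d 1 * X ^ d 2) * X ^ d 3 := by
      simp only [P, map_mul, map_pow]
      simp
      change C (C (C (F'.coeff d))) * _ = _
      ring
    rw [h1]
    refine (degree_C_mul_X_pow_le _ _).trans_lt ?_
    have := (hF' d hd).2
    exact_mod_cast (by omega : d 3 < 3)
  have hmon : f.Monic := monic_X_pow_add hdeg
  have hnat : f.natDegree = 3 := by
    rw [natDegree_add_eq_left_of_degree_lt (by rwa [degree_X_pow]), natDegree_X_pow]
  have hirr : Irreducible f := by
    rw [hmon.irreducible_iff_roots_eq_zero_of_degree_le_three (by omega) (by omega)]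
    refine Multiset.eq_zero_of_forall_notMem fun r hr => ?_
    have hr' : aeval r f = 0 := (mem_roots'.1 hr).2
    let ψ : k[X][X][X] →ₐ[k] k := (aeval (0 : k)).comp
      (((aeval (0 : k[X])).restrictScalars k).comp ((aeval r).restrictScalars k))
    have h1 := hmap ψ
    have h2 : ψ f = 0 := by
      change aeval (0 : k) (aeval (0 : k[X]) (aeval r f)) = 0
      rw [hr', map_zero, map_zero]
    rw [h2, smul_zero] at h1
    have := congrFun (hF₀ _ h1) 0
    simp at this
  have hprime : Prime f := hirr.prime
  have : IsDomain (AdjoinRoot f) := AdjoinRoot.isDomain_of_prime hprime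
  have hfree : Module.Free k[X][X] (AdjoinRoot f) := hmon.free_adjoinRoot
  let y : AdjoinRoot f := AdjoinRoot.of f (C X)
  let w : AdjoinRoot f := AdjoinRoot.of f X
  let z : AdjoinRoot f := AdjoinRoot.root f
  let B : Module.Basis (ℕ × ℕ × Fin 3) k (AdjoinRoot f) :=
    (Polynomial.basisMonomials k).smulTower ((Polynomial.basisMonomials k[X]).smulTower
      ((AdjoinRoot.powerBasis' hmon).basis.reindex
        (finCongr ((AdjoinRoot.powerBasis'_dim hmon).trans hnat))))
  have hB : ∀ t, B t = y ^ t.1 * w ^ t.2.1 * z ^ (t.2.2 : ℕ) := by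
    rintro ⟨a, b, l⟩
    simp only [B, Module.Basis.smulTower_apply, Polynomial.coe_basisMonomials,
      Module.Basis.reindex_apply, PowerBasis.coe_basis, AdjoinRoot.powerBasis'_gen]
    rw [Algebra.smul_def, Algebra.smul_def, ← mul_assoc, ← Polynomial.X_pow_eq_monomial,
      ← Polynomial.X_pow_eq_monomial, map_pow, map_pow]
    rfl
  have hxF : MvPolynomial.aeval ![1, y, w, z] F = 0 := by
    have h1 := hmap ((AdjoinRoot.mkₐ f).restrictScalars k)
    have h2 : (AdjoinRoot.mkₐ f).restrictScalars k f = 0 := AdjoinRoot.mk_self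
    rw [h2, smul_zero] at h1
    exact h1
  have hz : z ^ 3 ∈ Submodule.span k (B '' degreeLESet 3) := by
    have h1 : z ^ 3 = - κ⁻¹ • MvPolynomial.aeval ![1, y, w, z] F' := by
      rw [hFF'] at hxF
      simp only [map_add, map_mul, map_pow, MvPolynomial.aeval_X, MvPolynomial.aeval_C,
        Matrix.cons_val] at hxF
      rw [← Algebra.smul_def] at hxF
      rw [neg_smul, ← smul_neg, eq_inv_smul_iff₀ hκ]
      exact eq_neg_of_add_eq_zero_left hxF
    rw [h1]
    refine Submodule.smul_mem _ _ ?_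
    rw [MvPolynomial.aeval_def, MvPolynomial.eval₂_eq']
    refine Submodule.sum_mem _ fun d hd => ?_
    rw [← Algebra.smul_def, Fin.prod_univ_four]
    refine Submodule.smul_mem _ _ (Submodule.subset_span ⟨(d 1, d 2, ⟨d 3, ?_⟩), ?_, ?_⟩)
    · have := (hF' d hd).2
      omega
    · have := (hF' d hd).1
      change d 1 + d 2 + d 3 ≤ 3
      omega
    · rw [hB]
      simp
  obtain ⟨φ⟩ : Nonempty (AdjoinRoot f →ₐ[k] K) := by
    let g : k[X][X] →ₐ[k] K := Polynomial.eval₂AlgHom (aeval (x 1)) (x 2) fun _ => Commute.all _ _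
    let ψ : k[X][X][X] →ₐ[k] K := Polynomial.eval₂AlgHom g (x 3) fun _ => Commute.all _ _
    have h1 := hmap ψ
    have h2 : ![1, ψ (C (C X)), ψ (C X), ψ X] = x := by
      funext i
      fin_cases i <;> simp [ψ, g, hx0]
    rw [h2, hx] at h1
    exact ⟨AdjoinRoot.liftAlgHom f g (x 3)
      (show ψ f = 0 from (smul_eq_zero.1 h1.symm).resolve_left hκ)⟩
  let e := Ideal.quotientKerAlgEquivOfSurjective (AlgHom.rangeRestrict_surjective φ)
  let E : IntermediateField k K := φ.range.toIntermediateField fun a ha =>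
    φ.range.inv_mem_of_algebraic (x := ⟨a, ha⟩) (Algebra.IsAlgebraic.isAlgebraic _)
  have hE : Module.finrank k E = Module.finrank k (AdjoinRoot f ⧸ RingHom.ker φ.rangeRestrict) :=
    e.symm.toLinearEquiv.finrank_eq
  have hmul := Module.finrank_mul_finrank k E K
  rw [hE] at hmul
  have hfin : FiniteDimensional k (AdjoinRoot f ⧸ RingHom.ker φ.rangeRestrict) :=
    e.symm.toLinearEquiv.finiteDimensional
  have hker : (RingHom.ker φ.rangeRestrict).IsPrime := RingHom.ker_isPrime _
  have hmax : (RingHom.ker φ.rangeRestrict).IsMaximal := by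
    have : IsField (AdjoinRoot f ⧸ RingHom.ker φ.rangeRestrict) :=
      isField_of_isIntegral_of_isField' (Field.toIsField k)
    exact Ideal.Quotient.maximal_of_isField _ this
  have hnot : ¬ 3 ∣ Module.finrank k (AdjoinRoot f ⧸ RingHom.ker φ.rangeRestrict) := fun h =>
    h3 (hmul ▸ h.mul_right _)
  have hle : Module.finrank k (AdjoinRoot f ⧸ RingHom.ker φ.rangeRestrict) ≤ Module.finrank k K :=
    Nat.le_of_dvd (by omega) ⟨_, hmul.symm⟩
  have heq : Module.finrank k (AdjoinRoot f ⧸ RingHom.ker φ.rangeRestrict) =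
      Module.finrank k K := by
    refine hle.eq_or_lt.resolve_right fun hlt => hnot ?_
    refine hn.three_dvd_finrank ![1, y, w, z] hxF ?_ _
      (AdjoinRoot f ⧸ RingHom.ker φ.rangeRestrict) rfl hlt
    exact Ideal.eq_top_of_isUnit_mem _ (Ideal.subset_span ⟨0, rfl⟩) isUnit_one
  exact not_zeroDegreesDivisible_of_maximal B hB hz hF hF₀ hxF
    (fun G _ p hp => not_finiteDimensional_quotient_of_mem_minimalPrimes hp)
    (RingHom.ker φ.rangeRestrict) heq h3
    h7 h10 hn

end

section

open Polynomial

theorem MvPolynomial.IsHomogeneous.aeval_mul_left {k A : Type*} [Field k] [CommRing A] [Algebra k A]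
    {F : MvPolynomial (Fin 4) k} {N : ℕ} (hF : F.IsHomogeneous N) (c : A) (a : Fin 4 → A) :
    MvPolynomial.aeval (fun i => c * a i) F = c ^ N * MvPolynomial.aeval a F := by
  rw [MvPolynomial.aeval_def, MvPolynomial.eval₂_eq', MvPolynomial.aeval_def,
    MvPolynomial.eval₂_eq', Finset.mul_sum]
  refine Finset.sum_congr rfl fun d hd => ?_
  rw [← sum_eq_of_isHomogeneous hF hd, Fin.prod_univ_four, Fin.prod_univ_four]
  ring

theorem aeval_polynomial_natDegree_coeff {k : Type*} [Field k] {F : MvPolynomial (Fin 4) k} {N : ℕ}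
    (hF : F.IsHomogeneous N) {p : Fin 4 → k[X]} {D : ℕ} (hp : ∀ i, (p i).natDegree ≤ D) :
    (MvPolynomial.aeval p F).natDegree ≤ D * N ∧
      (MvPolynomial.aeval p F).coeff (D * N) = MvPolynomial.aeval (fun i => (p i).coeff D) F := by
  rw [MvPolynomial.aeval_def, MvPolynomial.eval₂_eq', MvPolynomial.aeval_def,
    MvPolynomial.eval₂_eq']
  have hpow : ∀ i e, (p i ^ e).natDegree ≤ D * e := fun i e =>
    natDegree_pow_le_of_le e (hp i) |>.trans (mul_comm _ _).le
  have hcoeff : ∀ i e, (p i ^ e).coeff (D * e) = (p i).coeff D ^ e := fun i e => by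
    rw [mul_comm]; exact coeff_pow_of_natDegree_le (hp i)
  constructor
  · refine natDegree_sum_le_of_forall_le _ _ fun d hd => ?_
    rw [← sum_eq_of_isHomogeneous hF hd, Fin.prod_univ_four, mul_add, mul_add, mul_add]
    refine (natDegree_C_mul_le _ _).trans ?_
    exact natDegree_mul_le_of_le (natDegree_mul_le_of_le (natDegree_mul_le_of_le (hpow _ _)
      (hpow _ _)) (hpow _ _)) (hpow _ _)
  · rw [finsetSum_coeff]
    refine Finset.sum_congr rfl fun d hd => ?_
    rw [← sum_eq_of_isHomogeneous hF hd, Fin.prod_univ_four, Fin.prod_univ_four, mul_add, mul_add,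
      mul_add]
    refine (coeff_C_mul _).trans ?_
    have h2 := natDegree_mul_le_of_le (hpow 0 (d 0)) (hpow 1 (d 1))
    rw [coeff_mul_add_eq_of_natDegree_le (natDegree_mul_le_of_le h2 (hpow _ _)) (hpow _ _),
      coeff_mul_add_eq_of_natDegree_le h2 (hpow _ _),
      coeff_mul_add_eq_of_natDegree_le (hpow _ _) (hpow _ _)]
    simp only [hcoeff]
    rfl

/-- A zero of degree prime to three parametrized by polynomials of low degree leads to a zero of
smaller degree prime to three. -/
theorem ZeroDegreesDivisible.false_of_polynomials {k : Type u} [Field k]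
    {F : MvPolynomial (Fin 4) k} (hF : F.IsHomogeneous 3)
    (hF₀ : ∀ a : Fin 4 → k, MvPolynomial.aeval a F = 0 → a = 0) {n : ℕ}
    (hn : ZeroDegreesDivisible F n) {K : Type*} [Field K] [Algebra k K] {θ : K}
    (hθ : IsIntegral k θ) (h3 : ¬ 3 ∣ (minpoly k θ).natDegree) (hnθ : (minpoly k θ).natDegree ≤ n)
    {d : ℕ} (hd : 3 * d < 2 * (minpoly k θ).natDegree) (p : Fin 4 → k[X])
    (hp : ∀ i, (p i).natDegree ≤ d) (i : Fin 4) (hi : aeval θ (p i) ≠ 0)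
    (hx : MvPolynomial.aeval (fun i => aeval θ (p i)) F = 0) : False := by
  classical
  induction d using Nat.strong_induction_on generalizing p i with
  | _ d ih =>
  have hcd : ∃ j, (p j).coeff d ≠ 0 := by
    by_contra! hall
    rcases Nat.eq_zero_or_pos d with rfl | hd0
    · rw [eq_C_of_natDegree_le_zero (hp i), hall i] at hi
      simp at hi
    · refine ih (d - 1) (by omega) (by omega) p (fun j =>
        Nat.le_sub_one_of_lt (lt_of_le_of_ne (hp j) fun h => ?_)) i hi hx
      have h0 := hall j
      rw [← h, coeff_natDegree, leadingCoeff_eq_zero] at h0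
      rw [h0, natDegree_zero] at h
      omega
  obtain ⟨j, hj⟩ := hcd
  obtain ⟨hP1, hP2⟩ := aeval_polynomial_natDegree_coeff hF hp
  set P := MvPolynomial.aeval p F with hP
  have hP0 : P.coeff (d * 3) ≠ 0 := by
    rw [hP2]
    exact fun h => hj (congrFun (hF₀ _ h) j)
  have hPd : P.natDegree = d * 3 := le_antisymm hP1 (le_natDegree_of_ne_zero hP0)
  have hPne : P ≠ 0 := by rintro h; rw [h] at hP0; simp at hP0
  have hPθ : aeval θ P = 0 := by
    rw [← hx, hP]
    exact MvPolynomial.comp_aeval_apply (f := p) (aeval θ) F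
  obtain ⟨g, hg⟩ := minpoly.dvd k θ hPθ
  have hg0 : g ≠ 0 := by rintro rfl; exact hPne (by rw [hg, mul_zero])
  have hgd : (minpoly k θ).natDegree + g.natDegree = d * 3 := by
    rw [← natDegree_mul (minpoly.ne_zero hθ) hg0, ← hg, hPd]
  have hspan : Ideal.span (Set.range p) = ⊤ := by
    obtain ⟨q, hq⟩ := (IsPrincipalIdealRing.principal (Ideal.span (Set.range p))).principal
    have hdvd : ∀ i, q ∣ p i := fun i => by
      rw [← Ideal.mem_span_singleton, ← Ideal.submodule_span_eq, ← hq]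
      exact Ideal.subset_span ⟨i, rfl⟩
    choose p' hp' using hdvd
    have hq0 : q ≠ 0 := by rintro rfl; exact hi (by rw [hp' i, zero_mul, map_zero])
    rw [hq, Ideal.submodule_span_eq, Ideal.span_singleton_eq_top]
    by_contra hu
    have hqd : 0 < q.natDegree := by
      rw [Nat.pos_iff_ne_zero]
      intro h0
      rw [eq_C_of_natDegree_eq_zero h0] at hu hq0
      exact hu ((IsUnit.mk0 _ (fun h => hq0 (by rw [h, C_0]))).map C)
    have hqθ : aeval θ q ≠ 0 := fun h => hi (by rw [hp' i, map_mul, h, zero_mul])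
    have hdeg : ∀ i, (p' i).natDegree + q.natDegree ≤ d ∨ p' i = 0 := fun i => by
      by_cases h0 : p' i = 0
      · exact Or.inr h0
      · left
        rw [add_comm, ← natDegree_mul hq0 h0, ← hp' i]
        exact hp i
    have hd1 : q.natDegree ≤ d := by
      rcases hdeg i with h | h
      · omega
      · exact absurd (by rw [hp' i, h, mul_zero, map_zero]) hi
    refine ih (d - 1) (by omega) (by omega) p' (fun i => ?_) i ?_ ?_
    · rcases hdeg i with h | h
      · omega
      · simp [h]
    · exact fun h => hi (by rw [hp' i, map_mul, h, mul_zero])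
    · have h1 : (fun i => aeval θ (p i)) = fun i => aeval θ q * aeval θ (p' i) := by
        funext i
        rw [hp' i, map_mul]
      rw [h1, hF.aeval_mul_left] at hx
      exact (mul_eq_zero.1 hx).resolve_left (pow_ne_zero _ hqθ)
  have hfin : FiniteDimensional k (AdjoinRoot g) := (AdjoinRoot.powerBasis hg0).finite
  have hrank : Module.finrank k (AdjoinRoot g) = g.natDegree := by
    rw [(AdjoinRoot.powerBasis hg0).finrank, AdjoinRoot.powerBasis_dim]
  have h4 := hn.three_dvd_finrank (Q := AdjoinRoot g) (fun i => AdjoinRoot.mk g (p i)) ?_ ?_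
    g.natDegree (AdjoinRoot g) hrank (by omega)
  · omega
  · refine (MvPolynomial.comp_aeval_apply (f := p) (AdjoinRoot.mkₐ g) F).symm.trans ?_
    exact AdjoinRoot.mk_eq_zero.2 ⟨_, hg.trans (mul_comm _ _)⟩
  · have h5 := congrArg (Ideal.map (AdjoinRoot.mk g)) hspan
    rwa [Ideal.map_top, Ideal.map_span, ← Set.range_comp] at h5

/-- A minimal zero degree prime to three is neither two nor five. -/
theorem ZeroDegreesDivisible.false_of_finrank_eq_two_or_five {k : Type u} [Field k]
    {F : MvPolynomial (Fin 4) k} (hF : F.IsHomogeneous 3)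
    (hF₀ : ∀ a : Fin 4 → k, MvPolynomial.aeval a F = 0 → a = 0) {n : ℕ}
    (hn : ZeroDegreesDivisible F n) {K : Type*} [Field K] [Algebra k K] [FiniteDimensional k K]
    (hK : Module.finrank k K = n) (h25 : n = 2 ∨ n = 5) {x : Fin 4 → K} (hx0 : x ≠ 0)
    (hx : MvPolynomial.aeval x F = 0) : False := by
  have hprime : n.Prime := by rcases h25 with rfl | rfl <;> norm_num
  obtain ⟨θ, hθ⟩ : ∃ θ : K, θ ∉ (algebraMap k K).range := by
    by_contra! h
    have h1 : (⊥ : Subalgebra k K) = ⊤ := by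
      rw [eq_top_iff]
      exact fun a _ => Algebra.mem_bot.2 (h a)
    have h2 := Subalgebra.bot_eq_top_iff_finrank_eq_one.1 h1
    rw [hK] at h2
    exact hprime.one_lt.ne' h2
  have hθint : IsIntegral k θ := Algebra.IsIntegral.isIntegral θ
  have hdeg : (minpoly k θ).natDegree = n := by
    rcases (Nat.dvd_prime hprime).1 (hK ▸ minpoly.degree_dvd hθint) with h | h
    · exact absurd (minpoly.natDegree_eq_one_iff.1 h) hθ
    · exact h
  have hadj : Algebra.adjoin k {θ} = ⊤ := by
    have hs := Subalgebra.isSimpleOrder_of_finrank_prime k K (hK ▸ hprime)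
    refine (hs.eq_bot_or_eq_top _).resolve_left fun h => hθ ?_
    have h1 : θ ∈ Algebra.adjoin k {θ} := Algebra.subset_adjoin rfl
    rw [h] at h1
    exact Algebra.mem_bot.1 h1
  have hrep : ∀ a : K, ∃ p : k[X], p.natDegree ≤ n - 1 ∧ aeval θ p = a := fun a => by
    have ha : a ∈ Algebra.adjoin k {θ} := hadj ▸ Algebra.mem_top
    rw [Algebra.adjoin_singleton_eq_range_aeval] at ha
    obtain ⟨q, rfl⟩ := ha
    refine ⟨q %ₘ minpoly k θ, Nat.le_sub_one_of_lt (hdeg ▸ natDegree_modByMonic_lt q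
      (minpoly.monic hθint) (minpoly.ne_one k θ)), ?_⟩
    exact aeval_modByMonic_eq_self_of_root (minpoly.aeval k θ)
  suffices h : ∃ c : K, c ≠ 0 ∧ ∃ d, 3 * d < 2 * n ∧ ∀ i, ∃ p : k[X], p.natDegree ≤ d ∧
      aeval θ p = c * x i by
    obtain ⟨c, hc, d, hd, h⟩ := h
    choose p hp hpx using h
    obtain ⟨i, hi⟩ := Function.ne_iff.1 hx0
    refine hn.false_of_polynomials hF hF₀ hθint (by rw [hdeg]; omega) hdeg.le (d := d)
      (by rwa [hdeg]) p hp i (by rw [hpx]; exact mul_ne_zero hc hi) ?_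
    rw [show (fun i => aeval θ (p i)) = fun i => c * x i from funext hpx, hF.aeval_mul_left, hx,
      mul_zero]
  rcases h25 with rfl | rfl
  · exact ⟨1, one_ne_zero, 1, by norm_num, fun i => by rw [one_mul]; exact hrep _⟩
  · let W : Submodule k K := (degreeLT k 4).map (aeval θ).toLinearMap
    have hW : Module.finrank k (K ⧸ W) ≤ 1 := by
      refine finrank_le_one (W.mkQ (θ ^ 4)) fun w => ?_
      obtain ⟨a, rfl⟩ := W.mkQ_surjective w
      obtain ⟨p, hp, rfl⟩ := hrep a
      refine ⟨p.coeff 4, ?_⟩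
      rw [← map_smul, ← sub_eq_zero, ← map_sub, Submodule.mkQ_apply, Submodule.Quotient.mk_eq_zero]
      refine ⟨C (p.coeff 4) * X ^ 4 - p, ?_, by simp [Algebra.smul_def]⟩
      rw [SetLike.mem_coe, mem_degreeLT, degree_lt_iff_coeff_zero]
      intro m hm
      rcases hm.eq_or_lt with rfl | hm
      · simp
      · rw [coeff_sub, coeff_C_mul_X_pow, if_neg (by omega),
          coeff_eq_zero_of_natDegree_lt (by omega), sub_zero]
    let f : K →ₗ[k] Fin 4 → K ⧸ W :=
      LinearMap.pi fun i => W.mkQ ∘ₗ (LinearMap.mulRight k (x i))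
    have hker : LinearMap.ker f ≠ ⊥ := by
      refine LinearMap.ker_ne_bot_of_finrank_lt ?_
      rw [Module.finrank_pi_fintype, hK]
      simp only [Finset.sum_const, Finset.card_univ, Fintype.card_fin, smul_eq_mul]
      omega
    obtain ⟨c, hc, hc0⟩ := (Submodule.ne_bot_iff _).1 hker
    refine ⟨c, hc0, 3, by norm_num, fun i => ?_⟩
    have h1 : c * x i ∈ W := (Submodule.Quotient.mk_eq_zero W).1 (congrFun hc i)
    obtain ⟨p, hp, hpx⟩ := h1
    refine ⟨p, ?_, hpx⟩
    rw [SetLike.mem_coe, mem_degreeLT, degree_lt_iff_coeff_zero] at hp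
    exact natDegree_le_iff_coeff_eq_zero.2 fun m hm => hp m hm

end

section

open MvPolynomial Module

/-- A form of degree three in four variables over a finite field has a nontrivial zero. -/
theorem exists_zero_of_isHomogeneous_three_of_finite {k : Type*} [Field k] [Finite k]
    {F : MvPolynomial (Fin 4) k} (hF : F.IsHomogeneous 3) :
    ∃ a : Fin 4 → k, a ≠ 0 ∧ aeval a F = 0 := by
  classical
  have := Fintype.ofFinite k
  obtain ⟨p, hp⟩ := CharP.exists k
  have hpp : Fact p.Prime := ⟨CharP.char_is_prime k p⟩
  have h0 : eval 0 F = 0 := by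
    have h := hF.aeval_mul_left (0 : k) 0
    simpa [← coe_aeval_eq_eval, Pi.zero_def] using h
  have hdvd : p ∣ Fintype.card { x : Fin 4 → k // eval x F = 0 } :=
    char_dvd_card_solutions p (hF.totalDegree_le.trans_lt (by simp))
  have hcard : 1 < Fintype.card { x : Fin 4 → k // eval x F = 0 } :=
    hpp.1.one_lt.trans_le (Nat.le_of_dvd (Fintype.card_pos_iff.2 ⟨⟨0, h0⟩⟩) hdvd)
  obtain ⟨⟨a, ha⟩, hne⟩ := Fintype.exists_ne_of_one_lt_card hcard ⟨0, h0⟩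
  exact ⟨a, fun h => hne (Subtype.ext h), by rwa [← coe_aeval_eq_eval] at ha⟩

/-- An anisotropic cubic form with a nontrivial zero of degree `n` prime to three, where `n` is
minimal, has `n = 1`, `n = 4` or `n = 10`. -/
theorem ZeroDegreesDivisible.finrank_eq {k : Type u} [Field k] [Infinite k]
    {F : MvPolynomial (Fin 4) k} (hF : F.IsHomogeneous 3)
    (hF₀ : ∀ a : Fin 4 → k, aeval a F = 0 → a = 0)
    {K : Type u} [Field K] [Algebra k K] [FiniteDimensional k K]
    (hn : ZeroDegreesDivisible F (finrank k K)) {x : Fin 4 → K} (hx : x ≠ 0)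
    (hFx : aeval x F = 0) (h3 : ¬ 3 ∣ finrank k K) :
    finrank k K = 1 ∨ finrank k K = 4 ∨ finrank k K = 10 := by
  by_contra! hne
  have h25 : ¬ (finrank k K = 2 ∨ finrank k K = 5) := fun h =>
    hn.false_of_finrank_eq_two_or_five hF hF₀ rfl h hx hFx
  have hpos : 0 < finrank k K := finrank_pos
  have h7 : 7 ≤ finrank k K := by omega
  obtain ⟨i, hi⟩ := Function.ne_iff.1 hx
  let e : Fin 4 ≃ Fin 4 := Equiv.swap 0 i
  have hee : ∀ j, e (e j) = j := Equiv.swap_apply_self 0 i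
  have hG : ∀ {A : Type u} [CommRing A] [Algebra k A] (y : Fin 4 → A),
      aeval y (rename e F) = aeval (y ∘ e) F := fun y => aeval_rename _ _ _
  have hcomp : ∀ {A : Type u} [Zero A] {y : Fin 4 → A}, y ∘ e = 0 → y = 0 := fun {A _ y} h => by
    funext j
    have h1 := congrFun h (e j)
    rwa [Function.comp_apply, hee] at h1
  refine not_zeroDegreesDivisible_finrank (F := rename e F) (K := K)
    (x := fun j => (x i)⁻¹ * x (e j)) hF.rename_isHomogeneous
    (fun a ha => hcomp (hF₀ _ ((hG a).symm.trans ha))) ?_ ?_ h3 h7 hne.2.2 ?_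
  · simp only [e, Equiv.swap_apply_left]
    exact inv_mul_cancel₀ hi
  · rw [hG]
    have h1 : (fun j => (x i)⁻¹ * x (e j)) ∘ e = fun j => (x i)⁻¹ * x j := by
      funext j
      simp only [Function.comp_apply, hee]
    rw [h1, hF.aeval_mul_left, hFx, mul_zero]
  · intro L _ _ _ hL ⟨y, hy, hFy⟩
    exact hn L hL ⟨y ∘ e, fun h => hy (hcomp h), (hG y).symm.trans hFy⟩

/-- A finite extension is isomorphic to one in the universe of the base field. -/
theorem exists_algEquiv_of_finiteDimensional (k : Type u) [Field k] (K : Type v) [Field K]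
    [Algebra k K] [FiniteDimensional k K] :
    ∃ (L : Type u) (_ : Field L) (_ : Algebra k L), Nonempty (K ≃ₐ[k] L) := by
  have hsmall : Small.{u} K := small_map (finBasis k K).equivFun.toEquiv
  exact ⟨Shrink.{u} K, inferInstance, inferInstance, ⟨(Shrink.algEquiv k K).symm⟩⟩

end

open MvPolynomial

/-- **Cassels–Swinnerton-Dyer conjecture for smooth cubic surfaces, reduced form.**
If a smooth cubic surface in `P³` over a field `k` has a nontrivial zero in a finite
extension of degree prime to 3, then it has a nontrivial zero in a finite extension
of degree 1, 4 or 10. -/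
theorem closed_points_cubic_surface {k : Type u} [Field k]
    (F : MvPolynomial (Fin 4) k) (hF_ne : F ≠ 0) (hF_hom : F.IsHomogeneous 3)
    (hF_smooth : ∀ a : Fin 4 → AlgebraicClosure k,
      aeval a F = 0 → (∀ i : Fin 4, aeval a (pderiv i F) = 0) → a = 0)
    (K : Type v) [Field K] [Algebra k K] [FiniteDimensional k K]
    (hdeg : ¬ (3 ∣ Module.finrank k K))
    (x : Fin 4 → K) (hx : x ≠ 0) (hFx : aeval x F = 0) :
    ∃ (L : Type u) (_ : Field L) (_ : Algebra k L) (_ : FiniteDimensional k L),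
      (Module.finrank k L = 1 ∨ Module.finrank k L = 4 ∨ Module.finrank k L = 10) ∧
      ∃ y : Fin 4 → L, y ≠ 0 ∧ aeval y F = 0 := by
  classical
  by_cases hF₀ : ∃ a : Fin 4 → k, a ≠ 0 ∧ aeval a F = 0
  · exact ⟨k, inferInstance, inferInstance, inferInstance, Or.inl (Module.finrank_self k), hF₀⟩
  have hinf : Infinite k := by
    by_contra h
    have := not_infinite_iff_finite.1 h
    exact hF₀ (exists_zero_of_isHomogeneous_three_of_finite hF_hom)
  let P : ℕ → Prop := fun n => ∃ (L : Type u) (_ : Field L) (_ : Algebra k L)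
    (_ : FiniteDimensional k L), Module.finrank k L = n ∧ ¬ 3 ∣ n ∧
      ∃ y : Fin 4 → L, y ≠ 0 ∧ aeval y F = 0
  have hP : ∃ n, P n := by
    obtain ⟨L, _, _, ⟨f⟩⟩ := exists_algEquiv_of_finiteDimensional k K
    refine ⟨_, L, _, _, f.toLinearEquiv.finiteDimensional, rfl, ?_, fun i => f (x i), ?_, ?_⟩
    · rwa [← f.toLinearEquiv.finrank_eq]
    · intro h
      exact hx (funext fun i => (map_eq_zero_iff f f.injective).1 (congrFun h i))
    · refine (comp_aeval_apply (f := x) f.toAlgHom F).symm.trans ?_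
      rw [hFx, map_zero]
  obtain ⟨L, _, _, _, hL, h3, y, hy, hFy⟩ := Nat.find_spec hP
  refine ⟨L, _, _, inferInstance, ?_, y, hy, hFy⟩
  refine ZeroDegreesDivisible.finrank_eq hF_hom
    (fun a ha => by_contra fun h => hF₀ ⟨a, h, ha⟩) ?_ hy hFy (hL ▸ h3)
  intro M _ _ _ hM hyM
  by_contra h
  exact Nat.find_min hP (hL ▸ hM) ⟨M, _, _, inferInstance, rfl, h, hyM⟩
end

section
/- Let k be a field and let F ∈ k[X₀,…,X₅] be a homogeneous polynomial of degree 3 defining a smooth cubic fourfold in P⁵ over k. If F has a nontrivial zero in some finite field extension K/k with [K:k] = 8, then there exists a finite field extension L/k with [L:k] ∈ {1,2,4,5,7} in which F has a nontrivial zero. -/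
open MvPolynomial

/-- `F` has a nontrivial zero in a field extension of degree `n`. -/
def HasZeroOfDegree.{u, w} {k : Type u} [Field k] {ι : Type w} (F : MvPolynomial ι k) (n : ℕ) :
    Prop :=
  ∃ (L : Type u) (_ : Field L) (_ : Algebra k L) (_ : FiniteDimensional k L),
    Module.finrank k L = n ∧ ∃ y : ι → L, y ≠ 0 ∧ aeval y F = 0

/-- A zero over a finite extension in any universe can be moved to the universe of `k`. -/
theorem HasZeroOfDegree.of_zero {k : Type*} [Field k] {ι : Type*} {F : MvPolynomial ι k}
    {K : Type*} [Field K] [Algebra k K] [FiniteDimensional k K] {y : ι → K} (hy : y ≠ 0)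
    (hF : aeval y F = 0) : HasZeroOfDegree F (Module.finrank k K) := by
  let f : K →ₐ[k] AlgebraicClosure k := IsAlgClosed.lift
  let e : K ≃ₐ[k] f.fieldRange := AlgEquiv.ofInjectiveField f
  refine ⟨f.fieldRange, inferInstance, inferInstance, e.toLinearEquiv.finiteDimensional,
    e.toLinearEquiv.finrank_eq.symm, fun i => e (y i), ?_, ?_⟩
  · obtain ⟨i, hi⟩ := Function.ne_iff.1 hy
    refine Function.ne_iff.2 ⟨i, ?_⟩
    simpa using hi
  · have := comp_aeval_apply y (e : K →ₐ[k] f.fieldRange) F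
    rw [hF, map_zero] at this
    exact this.symm

/-- Degrees of zeros multiply along a field extension. -/
theorem HasZeroOfDegree.of_map {k : Type*} [Field k] {ι : Type*} {F : MvPolynomial ι k}
    {E : Type*} [Field E] [Algebra k E] [FiniteDimensional k E] {n : ℕ}
    (h : HasZeroOfDegree (map (algebraMap k E) F) n) :
    HasZeroOfDegree F (Module.finrank k E * n) := by
  obtain ⟨L, _, _, _, rfl, y, hy, hF⟩ := h
  let : Algebra k L := Algebra.compHom L (algebraMap k E)
  have : IsScalarTower k E L := IsScalarTower.of_algebraMap_eq fun _ => rfl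
  have : FiniteDimensional k L := FiniteDimensional.trans k E L
  rw [Module.finrank_mul_finrank]
  rw [aeval_map_algebraMap] at hF
  exact .of_zero hy hF

theorem MvPolynomial.IsHomogeneous.sum_eq_of_mem_support {R ι : Type*} [CommSemiring R] [Fintype ι]
    {F : MvPolynomial ι R} {m : ℕ} (hF : F.IsHomogeneous m) {d : ι →₀ ℕ} (hd : d ∈ F.support) :
    ∑ i, d i = m := by
  rw [← Finsupp.degree_eq_sum, Finsupp.degree_eq_weight_one]
  exact hF (mem_support_iff.1 hd)

theorem MvPolynomial.IsHomogeneous.aeval_mul {R S ι : Type*} [CommSemiring R] [CommSemiring S]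
    [Algebra R S] [Fintype ι] {F : MvPolynomial ι R} {m : ℕ} (hF : F.IsHomogeneous m)
    (c : S) (y : ι → S) : MvPolynomial.aeval (fun i => c * y i) F = c ^ m * MvPolynomial.aeval y F := by
  simp only [aeval_def, eval₂_eq', Finset.mul_sum]
  refine Finset.sum_congr rfl fun d hd => ?_
  rw [← hF.sum_eq_of_mem_support hd, ← Finset.prod_pow_eq_pow_sum]
  simp only [mul_pow, Finset.prod_mul_distrib]
  ring

theorem Polynomial.natDegree_prod_pow_le {R ι : Type*} [CommSemiring R] (s : Finset ι)
    (Y : ι → Polynomial R) (d : ι → ℕ) {e : ℕ} (hY : ∀ i, (Y i).natDegree ≤ e) :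
    (∏ i ∈ s, Y i ^ d i).natDegree ≤ (∑ i ∈ s, d i) * e := by
  rw [Finset.sum_mul]
  exact (natDegree_prod_le _ _).trans (Finset.sum_le_sum fun i _ => natDegree_pow_le_of_le _ (hY i))

theorem Polynomial.coeff_prod_pow {R ι : Type*} [CommSemiring R] (s : Finset ι)
    (Y : ι → Polynomial R) (d : ι → ℕ) {e : ℕ} (hY : ∀ i, (Y i).natDegree ≤ e) :
    (∏ i ∈ s, Y i ^ d i).coeff ((∑ i ∈ s, d i) * e) = ∏ i ∈ s, (Y i).coeff e ^ d i := by
  classical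
  induction s using Finset.induction_on with
  | empty => simp
  | insert i s hi ih =>
    rw [Finset.prod_insert hi, Finset.prod_insert hi, Finset.sum_insert hi, add_mul,
      coeff_mul_add_eq_of_natDegree_le (natDegree_pow_le_of_le _ (hY i))
        (natDegree_prod_pow_le s Y d hY), ih, coeff_pow_of_natDegree_le (hY i)]

theorem MvPolynomial.IsHomogeneous.natDegree_aeval_le {R ι : Type*} [CommSemiring R] [Fintype ι]
    {F : MvPolynomial ι R} {m : ℕ} (hF : F.IsHomogeneous m) (Y : ι → Polynomial R) {e : ℕ}
    (hY : ∀ i, (Y i).natDegree ≤ e) : (MvPolynomial.aeval Y F).natDegree ≤ m * e := by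
  rw [aeval_def, eval₂_eq']
  refine Polynomial.natDegree_sum_le_of_forall_le _ _ fun d hd => ?_
  rw [← hF.sum_eq_of_mem_support hd, Polynomial.algebraMap_eq]
  exact (Polynomial.natDegree_C_mul_le _ _).trans (Polynomial.natDegree_prod_pow_le _ _ _ hY)

theorem MvPolynomial.IsHomogeneous.coeff_aeval {R ι : Type*} [CommSemiring R] [Fintype ι]
    {F : MvPolynomial ι R} {m : ℕ} (hF : F.IsHomogeneous m) (Y : ι → Polynomial R) {e : ℕ}
    (hY : ∀ i, (Y i).natDegree ≤ e) :
    (MvPolynomial.aeval Y F).coeff (m * e) = MvPolynomial.aeval (fun i => (Y i).coeff e) F := by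
  rw [aeval_def, eval₂_eq', aeval_def, eval₂_eq', Polynomial.finsetSum_coeff]
  refine Finset.sum_congr rfl fun d hd => ?_
  rw [← hF.sum_eq_of_mem_support hd, Polynomial.algebraMap_eq, Polynomial.coeff_C_mul,
    Polynomial.coeff_prod_pow _ _ _ hY, Algebra.algebraMap_self, RingHom.id_apply]

/-- If `m` does not divide the degree of `h`, then `h` has an irreducible factor of degree not
divisible by `m`. -/
theorem Polynomial.exists_irreducible_dvd_not_dvd_natDegree {k : Type*} [Field k] (m : ℕ)
    (h : Polynomial k) (hm : ¬ m ∣ h.natDegree) :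
    ∃ p, Irreducible p ∧ p ∣ h ∧ ¬ m ∣ p.natDegree := by
  induction h using WfDvdMonoid.induction_on_irreducible with
  | zero => simp at hm
  | unit u hu => simp [natDegree_eq_zero_of_isUnit hu] at hm
  | mul a i ha hi ih =>
    by_cases hmi : m ∣ i.natDegree
    · rw [natDegree_mul hi.ne_zero ha, Nat.dvd_add_right hmi] at hm
      obtain ⟨p, hp, hpa, hmp⟩ := ih hm
      exact ⟨p, hp, hpa.mul_left i, hmp⟩
    · exact ⟨i, hi, dvd_mul_right i a, hmi⟩

/-- A nonzero vector of polynomials is a multiple of a unimodular one. -/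
theorem Polynomial.exists_eq_mul_sum_eq_one {k ι : Type*} [Field k] [Fintype ι]
    (X : ι → Polynomial k) (hX : X ≠ 0) :
    ∃ (g : Polynomial k) (Y c : ι → Polynomial k), g ≠ 0 ∧ (∀ i, X i = g * Y i) ∧
      ∑ i, c i * Y i = 1 := by
  obtain ⟨g, hg⟩ := IsPrincipalIdealRing.principal (Ideal.span (Set.range X))
  rw [Ideal.submodule_span_eq] at hg
  have hdvd : ∀ i, g ∣ X i := fun i => by
    rw [← Ideal.mem_span_singleton, ← hg]
    exact Ideal.subset_span ⟨i, rfl⟩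
  choose Y hY using hdvd
  obtain ⟨i, hi⟩ := Function.ne_iff.1 hX
  have hg0 : g ≠ 0 := by
    rintro rfl
    exact hi (by simp [hY])
  obtain ⟨c, hc⟩ := Ideal.mem_span_range_iff_exists_fun.1
    (hg ▸ Ideal.mem_span_singleton_self g : g ∈ Ideal.span (Set.range X))
  refine ⟨g, Y, c, hg0, hY, mul_left_cancel₀ hg0 ?_⟩
  rw [mul_one, Finset.mul_sum]
  conv_rhs => rw [← hc]
  exact Finset.sum_congr rfl fun i _ => by rw [hY i]; ring

/-- Intersecting a form of degree `m` with a rational curve of degree at most `d` through a zero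
of degree `n` yields a zero of degree at most `m * d - n` and not divisible by `m`. -/
theorem HasZeroOfDegree.of_curve {k K ι : Type*} [Field k] [Field K] [Algebra k K]
    [Fintype ι] {F : MvPolynomial ι k} {m : ℕ} (hF : F.IsHomogeneous m) {τ : K}
    {d : ℕ} (X : ι → Polynomial k) (hXd : ∀ i, (X i).natDegree ≤ d)
    (hX : (fun i => Polynomial.aeval τ (X i)) ≠ 0)
    (hFX : MvPolynomial.aeval (fun i => Polynomial.aeval τ (X i)) F = 0)
    (hm : ¬ m ∣ (minpoly k τ).natDegree) (hd : (minpoly k τ).natDegree < m * d) :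
    ∃ r ≤ m * d - (minpoly k τ).natDegree, ¬ m ∣ r ∧ HasZeroOfDegree F r := by
  obtain ⟨i₁, hi₁⟩ := Function.ne_iff.1 hX
  obtain ⟨g, Y, c, hg, hXY, hc⟩ := Polynomial.exists_eq_mul_sum_eq_one X
    (by rintro rfl; simp at hi₁)
  have hYX : ∀ i, (Y i).natDegree ≤ d := fun i => by
    rcases eq_or_ne (Y i) 0 with h | h
    · simp [h]
    · refine le_trans ?_ (hXd i)
      rw [hXY i, Polynomial.natDegree_mul hg h]
      exact Nat.le_add_left _ _
  have hY0 : ∃ i, Y i ≠ 0 := by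
    by_contra! h
    simp [h] at hc
  obtain ⟨i₂, hi₂⟩ := hY0
  obtain ⟨i₀, -, hi₀⟩ := Finset.exists_max_image Finset.univ (fun i => (Y i).degree)
    ⟨i₂, Finset.mem_univ i₂⟩
  have hYi₀ : Y i₀ ≠ 0 := by
    intro h
    have := hi₀ i₂ (Finset.mem_univ _)
    simp [h, hi₂] at this
  set e := (Y i₀).natDegree with he
  have hYe : ∀ i, (Y i).natDegree ≤ e := fun i =>
    Polynomial.natDegree_le_natDegree (hi₀ i (Finset.mem_univ _))
  have hgτ : Polynomial.aeval τ g ≠ 0 := by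
    intro h
    simp [hXY, h] at hi₁
  have hFY : MvPolynomial.aeval (fun i => Polynomial.aeval τ (Y i)) F = 0 := by
    simp only [hXY, map_mul] at hFX
    rw [hF.aeval_mul] at hFX
    exact (mul_eq_zero.1 hFX).resolve_left (pow_ne_zero _ hgτ)
  have hm1 : m ≠ 1 := by
    rintro rfl
    simp at hm
  by_cases hlead : MvPolynomial.aeval (fun i => (Y i).coeff e) F = 0
  · refine ⟨1, by omega, by simpa using hm1, ?_⟩
    rw [← Module.finrank_self k]
    refine .of_zero (Function.ne_iff.2 ⟨i₀, ?_⟩) hlead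
    simpa [he] using hYi₀
  set G := MvPolynomial.aeval Y F with hG
  have hGc : G.coeff (m * e) ≠ 0 := by rwa [hG, hF.coeff_aeval Y hYe]
  have hG0 : G ≠ 0 := by
    rintro h
    simp [h] at hGc
  have hGdeg : G.natDegree = m * e :=
    le_antisymm (hF.natDegree_aeval_le Y hYe) (Polynomial.le_natDegree_of_ne_zero hGc)
  have hGτ : Polynomial.aeval τ G = 0 := by
    rw [← hFY]
    exact comp_aeval_apply Y (Polynomial.aeval τ) F
  obtain ⟨h, hh⟩ := minpoly.dvd k τ hGτ
  have hμ0 : minpoly k τ ≠ 0 := fun h0 => hG0 (by rw [hh, h0, zero_mul])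
  have hh0 : h ≠ 0 := fun h0 => hG0 (by rw [hh, h0, mul_zero])
  have hdeg : (minpoly k τ).natDegree + h.natDegree = m * e := by
    rw [← Polynomial.natDegree_mul hμ0 hh0, ← hh, hGdeg]
  have hmh : ¬ m ∣ h.natDegree := fun hmh =>
    hm ((Nat.dvd_add_left hmh).1 (hdeg ▸ dvd_mul_right m e))
  obtain ⟨p, hp, hph, hmp⟩ := Polynomial.exists_irreducible_dvd_not_dvd_natDegree m h hmh
  have hed : m * e ≤ m * d := Nat.mul_le_mul_left m (hYX i₀)
  have hple := Polynomial.natDegree_le_of_dvd hph hh0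
  refine ⟨p.natDegree, by omega, hmp, ?_⟩
  have : Fact (Irreducible p) := ⟨hp⟩
  let pb := AdjoinRoot.powerBasis hp.ne_zero
  have : FiniteDimensional k (AdjoinRoot p) := pb.finite
  have hfr : Module.finrank k (AdjoinRoot p) = p.natDegree := pb.finrank
  rw [← hfr]
  refine .of_zero (y := fun i => Polynomial.aeval (AdjoinRoot.root p) (Y i)) ?_ ?_
  · intro h0
    have := congrArg (Polynomial.aeval (AdjoinRoot.root p)) hc
    simp only [map_sum, map_mul, map_one] at this
    simp [fun i => congrFun h0 i] at this
  · rw [← comp_aeval_apply Y (Polynomial.aeval (AdjoinRoot.root p)) F, ← hG,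
      AdjoinRoot.aeval_eq, AdjoinRoot.mk_eq_zero]
    exact hph.trans (hh ▸ dvd_mul_left h _)

section Generator

variable {k K : Type*} [Field k] [Field K] [Algebra k K] [FiniteDimensional k K] {τ : K}

/-- If `τ` generates `K` over `k`, then `K` is identified with the polynomials in `τ` of degree less
than `[K : k]`. -/
theorem exists_linearEquiv_degreeLT (hτ : (minpoly k τ).natDegree = Module.finrank k K) :
    ∃ e : Polynomial.degreeLT k (Module.finrank k K) ≃ₗ[k] K,
      ∀ P, e P = Polynomial.aeval τ (P : Polynomial k) := by
  let f : Polynomial.degreeLT k (Module.finrank k K) →ₗ[k] K :=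
    (Polynomial.aeval τ).toLinearMap ∘ₗ Submodule.subtype _
  have hf : Function.Injective f := by
    rw [← LinearMap.ker_eq_bot, LinearMap.ker_eq_bot']
    rintro ⟨P, hP⟩ h
    rw [Polynomial.mem_degreeLT, ← hτ,
      ← Polynomial.degree_eq_natDegree (minpoly.ne_zero (.of_finite k τ))] at hP
    exact Subtype.ext <| Polynomial.eq_zero_of_dvd_of_degree_lt (minpoly.dvd k τ h) hP
  refine ⟨LinearEquiv.ofInjectiveOfFinrankEq f hf ?_, fun P => rfl⟩
  rw [(Polynomial.degreeLTEquiv k _).finrank_eq, Module.finrank_fin_fun]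

theorem exists_aeval_eq (hτ : (minpoly k τ).natDegree = Module.finrank k K) (u : K) :
    ∃ P : Polynomial k, P.natDegree < Module.finrank k K ∧ Polynomial.aeval τ P = u := by
  obtain ⟨e, he⟩ := exists_linearEquiv_degreeLT hτ
  refine ⟨e.symm u, ?_, by rw [← he, e.apply_symm_apply]⟩
  rcases eq_or_ne (e.symm u : Polynomial k) 0 with h | h
  · rw [h, Polynomial.natDegree_zero]
    exact Module.finrank_pos
  · exact (Polynomial.natDegree_lt_iff_degree_lt h).2 (Polynomial.mem_degreeLT.1 (e.symm u).2)

/-- Every linear functional on `K` is a multiple of a given nonzero one. -/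
theorem exists_forall_eq_apply_mul {μ : K →ₗ[k] k} (hμ : μ ≠ 0) (ψ : K →ₗ[k] k) :
    ∃ c : K, ∀ u, ψ u = μ (c * u) := by
  let T : K →ₗ[k] Module.Dual k K := (LinearMap.mul k K).compr₂ μ
  have hT : Function.Injective T := by
    rw [← LinearMap.ker_eq_bot, LinearMap.ker_eq_bot']
    intro c hc
    by_contra hc0
    refine hμ (LinearMap.ext fun u => ?_)
    simpa [T, hc0] using LinearMap.congr_fun hc (c⁻¹ * u)
  obtain ⟨c, hc⟩ := (LinearMap.injective_iff_surjective_of_finrank_eq_finrank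
    (Subspace.dual_finrank_eq (K := k) (V := K)).symm).1 hT ψ
  exact ⟨c, fun u => by rw [← hc]; rfl⟩

/-- Let `τ` generate `K` over `k`. Up to a common factor `c`, the elements orthogonal to
`1, τ, …, τ ^ (m - 1)` are the polynomials in `τ` of degree less than `[K : k] - m`. -/
theorem exists_mul_eq_aeval (hτ : (minpoly k τ).natDegree = Module.finrank k K) {ψ : K →ₗ[k] k}
    (hψ : ψ ≠ 0) :
    ∃ c : K, c ≠ 0 ∧ ∀ m < Module.finrank k K, ∀ u, (∀ j < m, ψ (τ ^ j * u) = 0) →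
      ∃ P : Polynomial k, P.natDegree ≤ Module.finrank k K - 1 - m ∧
        Polynomial.aeval τ P = c * u := by
  set n := Module.finrank k K with hn
  obtain ⟨e, he⟩ : ∃ e : Polynomial.degreeLT k n ≃ₗ[k] K,
      ∀ P, e P = Polynomial.aeval τ (P : Polynomial k) := exists_linearEquiv_degreeLT hτ
  have hn0 : 0 < n := Module.finrank_pos
  let μ : K →ₗ[k] k := Polynomial.lcoeff k (n - 1) ∘ₗ Submodule.subtype _ ∘ₗ e.symm.toLinearMap
  have hμ : ∀ P : Polynomial k, P.degree < n → μ (Polynomial.aeval τ P) = P.coeff (n - 1) := by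
    intro P hP
    have : e.symm (Polynomial.aeval τ P) = ⟨P, Polynomial.mem_degreeLT.2 hP⟩ := by
      rw [LinearEquiv.symm_apply_eq, he]
    simp [μ, this]
  have hμ0 : μ ≠ 0 := by
    intro h
    have := hμ (Polynomial.X ^ (n - 1)) (by
      rw [Polynomial.degree_X_pow]
      exact_mod_cast Nat.sub_lt hn0 one_pos)
    simp [h] at this
  obtain ⟨c, hc⟩ := exists_forall_eq_apply_mul hμ0 ψ
  refine ⟨c, ?_, fun m => ?_⟩
  · rintro rfl
    exact hψ (LinearMap.ext fun u => by simp [hc])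
  · induction m with
    | zero =>
      intro _ u _
      obtain ⟨P, hP, hPu⟩ := exists_aeval_eq hτ (c * u)
      exact ⟨P, by omega, hPu⟩
    | succ m ih =>
      intro hm u hu
      obtain ⟨P, hP, hPu⟩ := ih (by omega) u fun j hj => hu j (by omega)
      refine ⟨P, ?_, hPu⟩
      have hdeg : (Polynomial.X ^ m * P).degree < (n : WithBot ℕ) := by
        refine (Polynomial.degree_le_of_natDegree_le (n := n - 1) ?_).trans_lt
          (by exact_mod_cast Nat.sub_lt hn0 one_pos)
        refine Polynomial.natDegree_mul_le.trans ?_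
        rw [Polynomial.natDegree_X_pow]
        omega
      have h0 := hu m (by omega)
      rw [hc, mul_left_comm, ← hPu, ← Polynomial.aeval_X (R := k) τ, ← map_pow,
        Polynomial.aeval_X, ← map_mul, hμ _ hdeg, Polynomial.coeff_X_pow_mul',
        if_pos (by omega)] at h0
      by_contra! hlt
      have hnat : P.natDegree = n - 1 - m := by omega
      rw [← hnat, Polynomial.coeff_natDegree, Polynomial.leadingCoeff_eq_zero] at h0
      simp [h0] at hlt

/-- Let `τ` generate `K` over `k`. If the coordinates of a zero in `K` of a form of degree `r` are
orthogonal to `1, τ, …, τ ^ (m - 1)`, the zero lies on a rational curve of degree at most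
`[K : k] - 1 - m`, and the residual intersection
contains a zero of degree not divisible by `r`. -/
theorem HasZeroOfDegree.of_orthogonal {ι : Type*} [Fintype ι] {F : MvPolynomial ι k} {r : ℕ}
    (hF : F.IsHomogeneous r) (hτ : (minpoly k τ).natDegree = Module.finrank k K)
    {ψ : K →ₗ[k] k} (hψ : ψ ≠ 0) {m : ℕ} (hm : m < Module.finrank k K) {v : ι → K} (hv : v ≠ 0)
    (hψv : ∀ i, ∀ j < m, ψ (τ ^ j * v i) = 0) (hFv : aeval v F = 0)
    (hr : ¬ r ∣ Module.finrank k K)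
    (hlt : Module.finrank k K < r * (Module.finrank k K - 1 - m)) :
    ∃ s ≤ r * (Module.finrank k K - 1 - m) - Module.finrank k K, ¬ r ∣ s ∧
      HasZeroOfDegree F s := by
  obtain ⟨c, hc, h⟩ := exists_mul_eq_aeval hτ hψ
  choose X hXd hX using fun i => h m hm (v i) (hψv i)
  rw [← hτ] at hr hlt hXd ⊢
  refine HasZeroOfDegree.of_curve hF X hXd ?_ ?_ hr hlt
  · obtain ⟨i, hi⟩ := Function.ne_iff.1 hv
    exact Function.ne_iff.2 ⟨i, by simpa [hX, hc] using hi⟩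
  · simp only [hX]
    rw [hF.aeval_mul, hFv, mul_zero]

end Generator

theorem exists_dual_ne_zero (k K : Type*) [Field k] [Field K] [Algebra k K] :
    ∃ ψ : K →ₗ[k] k, ψ ≠ 0 := by
  obtain ⟨ψ, hψ, -⟩ := Submodule.exists_le_ker_of_lt_top (⊥ : Submodule k K) bot_lt_top
  exact ⟨ψ, hψ⟩

theorem exists_minpoly_natDegree_ne_one {k K : Type*} [Field k] [Field K] [Algebra k K]
    (h : Module.finrank k K ≠ 1) : ∃ τ : K, (minpoly k τ).natDegree ≠ 1 := by
  by_contra! hτ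
  refine h ?_
  rw [← Subalgebra.bot_eq_top_iff_finrank_eq_one, Algebra.eq_top_iff]
  exact fun x => Algebra.mem_bot.2 (minpoly.natDegree_eq_one_iff.1 (hτ x))

/-- A zero of a cubic form over a quadratic extension of `E` gives a zero over `E`. -/
theorem HasZeroOfDegree.of_quadratic {k E K ι : Type*} [Field k] [Field E] [Field K] [Algebra k E]
    [Algebra E K] [Algebra k K] [IsScalarTower k E K] [FiniteDimensional k E]
    [FiniteDimensional E K] [Fintype ι] {F : MvPolynomial ι k} (hF : F.IsHomogeneous 3)
    (hE : Module.finrank E K = 2) {v : ι → K} (hv : v ≠ 0) (hFv : aeval v F = 0) :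
    HasZeroOfDegree F (Module.finrank k E) := by
  obtain ⟨τ, hτ1⟩ := exists_minpoly_natDegree_ne_one (k := E) (K := K) (by omega)
  have hτ : (minpoly E τ).natDegree = Module.finrank E K := by
    have := minpoly.degree_dvd (.of_finite E τ : IsIntegral E τ)
    rw [hE] at this ⊢
    exact ((Nat.dvd_prime Nat.prime_two).1 this).resolve_left hτ1
  obtain ⟨ψ, hψ⟩ := exists_dual_ne_zero E K
  obtain ⟨s, hs, hs3, h⟩ := HasZeroOfDegree.of_orthogonal (hF.map (algebraMap k E)) hτ hψ (m := 0)
    (by omega) hv (by simp) (by rwa [aeval_map_algebraMap]) (by omega) (by omega)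
  obtain rfl : s = 1 := by
    rw [hE] at hs
    omega
  simpa using h.of_map

/-- A zero of a cubic form over a quartic extension of a quadratic extension `E / k`, with
coordinates in an `E`-hyperplane, gives a zero of degree two or four. -/
theorem HasZeroOfDegree.of_quartic {k E K ι : Type*} [Field k] [Field E] [Field K] [Algebra k E]
    [Algebra E K] [Algebra k K] [IsScalarTower k E K] [FiniteDimensional k E]
    [FiniteDimensional E K] [Fintype ι] {F : MvPolynomial ι k} (hF : F.IsHomogeneous 3)
    (hkE : Module.finrank k E = 2) (hE : Module.finrank E K = 4) {ψ : K →ₗ[E] E} (hψ : ψ ≠ 0)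
    {v : ι → K} (hv : v ≠ 0) (hψv : ∀ i, ψ (v i) = 0) (hFv : aeval v F = 0) :
    HasZeroOfDegree F 2 ∨ HasZeroOfDegree F 4 := by
  obtain ⟨τ, hτ1⟩ := exists_minpoly_natDegree_ne_one (k := E) (K := K) (by omega)
  have hint : IsIntegral E τ := .of_finite E τ
  have hdvd := minpoly.degree_dvd hint
  have hFE : aeval v (map (algebraMap k E) F) = 0 := by rwa [aeval_map_algebraMap]
  have hle := Nat.le_of_dvd (by omega) hdvd
  have hτ24 : (minpoly E τ).natDegree = 2 ∨ (minpoly E τ).natDegree = 4 := by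
    rw [hE] at hdvd hle
    interval_cases (minpoly E τ).natDegree <;> omega
  rcases hτ24 with hτ | hτ
  · have hL := IntermediateField.adjoin.finrank hint
    have hLK := Module.finrank_mul_finrank E (IntermediateField.adjoin E {τ}) K
    rw [hL, hτ, hE] at hLK
    have := (HasZeroOfDegree.of_quadratic (E := IntermediateField.adjoin E {τ})
      (hF.map (algebraMap k E)) (by omega) hv hFE).of_map
    rw [hL, hτ, hkE] at this
    exact .inr this
  · obtain ⟨s, hs, hs3, h⟩ := HasZeroOfDegree.of_orthogonal (hF.map (algebraMap k E))
      (hτ.trans hE.symm) hψ (m := 1) (by omega) hv (by simpa using hψv) hFE (by omega) (by omega)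
    have h' := h.of_map
    rw [hE] at hs
    rw [hkE] at h'
    obtain rfl | rfl : s = 1 ∨ s = 2 := by omega
    exacts [.inl h', .inr h']

/-- If `θ` generates `E` over `k`, then the elements orthogonal to all powers `θ ^ j` with
`j < [E : k]` lie in an `E`-hyperplane. -/
theorem exists_dual_of_orthogonal {k E K : Type*} [Field k] [Field E] [Field K] [Algebra k E]
    [Algebra E K] [Algebra k K] [IsScalarTower k E K] [FiniteDimensional k E] {θ : E}
    (hθ : (minpoly k θ).natDegree = Module.finrank k E) {φ : K →ₗ[k] k} (hφ : φ ≠ 0) :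
    ∃ ψ : K →ₗ[E] E, ψ ≠ 0 ∧
      ∀ u, (∀ j < Module.finrank k E, φ (θ ^ j • u) = 0) → ψ u = 0 := by
  let S : Submodule E K :=
    { carrier := {u | ∀ a : E, φ (a • u) = 0}
      add_mem' := fun hu hv a => by rw [smul_add, map_add, hu, hv, add_zero]
      zero_mem' := fun a => by simp
      smul_mem' := fun b u hu a => by rw [smul_smul]; exact hu _ }
  have hS : S < ⊤ := by
    refine lt_top_iff_ne_top.2 fun h => hφ (LinearMap.ext fun u => ?_)
    have : u ∈ S := h ▸ Submodule.mem_top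
    simpa using this 1
  obtain ⟨ψ, hψ, hle⟩ := Submodule.exists_le_ker_of_lt_top S hS
  refine ⟨ψ, hψ, fun u hu => hle fun a => ?_⟩
  obtain ⟨P, hP, rfl⟩ := exists_aeval_eq hθ a
  rw [Polynomial.aeval_eq_sum_range' hP, Finset.sum_smul, map_sum]
  refine Finset.sum_eq_zero fun j hj => ?_
  rw [smul_assoc, map_smul, hu j (Finset.mem_range.1 hj), smul_zero]

/-- If there are at most `[K : k] - 2` elements `x i`, there are non-proportional multipliers `a`
and `θ * a` moving all of them into the kernel of a given functional. -/
theorem exists_orthogonal_pair {k K ι : Type*} [Field k] [Field K] [Algebra k K]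
    [FiniteDimensional k K] [Fintype ι] (φ : K →ₗ[k] k) (x : ι → K)
    (h : Fintype.card ι + 2 ≤ Module.finrank k K) :
    ∃ a θ : K, a ≠ 0 ∧ (minpoly k θ).natDegree ≠ 1 ∧
      ∀ i, φ (a * x i) = 0 ∧ φ (θ * (a * x i)) = 0 := by
  let T : K →ₗ[k] ι → k := LinearMap.pi fun i => φ ∘ₗ LinearMap.mulRight k (x i)
  have hT : 1 < Module.finrank k T.ker := by
    have h₁ := T.finrank_range_add_finrank_ker
    have h₂ := T.range.finrank_le
    rw [Module.finrank_pi] at h₂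
    omega
  have hker : ∀ a ∈ T.ker, ∀ i, φ (a * x i) = 0 := fun a ha i => congrFun ha i
  have : Nontrivial T.ker := Module.nontrivial_of_finrank_pos (R := k) (by omega)
  obtain ⟨⟨a, ha⟩, ha0⟩ := exists_ne (0 : T.ker)
  have ha' : a ≠ 0 := fun h => ha0 (by simp [h])
  by_contra! hcon
  refine (hT.trans_le (finrank_le_one (⟨a, ha⟩ : T.ker) ?_)).false
  rintro ⟨b, hb⟩
  by_cases hθ : (minpoly k (b / a)).natDegree = 1
  · obtain ⟨c, hc⟩ := minpoly.natDegree_eq_one_iff.1 hθ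
    exact ⟨c, Subtype.ext (by simp [Algebra.smul_def, hc, ha'])⟩
  · obtain ⟨i, hi⟩ := hcon a (b / a) ha' hθ
    refine absurd ?_ (hi (hker a ha i))
    rw [← mul_assoc, div_mul_cancel₀ b ha']
    exact hker b hb i

/-- **Degree descent on smooth cubic fourfolds.**
If a smooth cubic fourfold in `P⁵` over a field `k` has a nontrivial zero in a finite
extension of degree 8, then it has a nontrivial zero in a finite extension of degree
1, 2, 4, 5 or 7. -/
theorem closed_points_cubic_fourfold {k : Type u} [Field k]
    (F : MvPolynomial (Fin 6) k) (hF_ne : F ≠ 0) (hF_hom : F.IsHomogeneous 3)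
    (hF_smooth : ∀ a : Fin 6 → AlgebraicClosure k,
      aeval a F = 0 → (∀ i : Fin 6, aeval a (pderiv i F) = 0) → a = 0)
    (K : Type v) [Field K] [Algebra k K] [FiniteDimensional k K]
    (hdeg : Module.finrank k K = 8)
    (x : Fin 6 → K) (hx : x ≠ 0) (hFx : aeval x F = 0) :
    ∃ (L : Type u) (_ : Field L) (_ : Algebra k L) (_ : FiniteDimensional k L),
      Module.finrank k L ∈ ({1, 2, 4, 5, 7} : Set ℕ) ∧
      ∃ y : Fin 6 → L, y ≠ 0 ∧ aeval y F = 0 := by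
  obtain ⟨φ, hφ⟩ := exists_dual_ne_zero k K
  obtain ⟨a, θ, ha, hθ1, horth⟩ := exists_orthogonal_pair φ x (by simp [hdeg])
  have hv : (fun i => a * x i) ≠ 0 := by
    obtain ⟨i, hi⟩ := Function.ne_iff.1 hx
    exact Function.ne_iff.2 ⟨i, mul_ne_zero ha hi⟩
  have hFv : aeval (fun i => a * x i) F = 0 := by rw [hF_hom.aeval_mul, hFx, mul_zero]
  have key : ∃ n ∈ ({1, 2, 4, 5, 7} : Set ℕ), HasZeroOfDegree F n := by
    have hint : IsIntegral k θ := .of_finite k θ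
    have hdvd := minpoly.degree_dvd hint
    have hL := IntermediateField.adjoin.finrank hint
    have hLK := Module.finrank_mul_finrank k (IntermediateField.adjoin k {θ}) K
    rw [hL, hdeg] at hLK
    have hle := Nat.le_of_dvd (by omega) hdvd
    have hθ : (minpoly k θ).natDegree = 2 ∨ (minpoly k θ).natDegree = 4 ∨
        (minpoly k θ).natDegree = 8 := by
      rw [hdeg] at hdvd hle
      clear hLK hL
      interval_cases (minpoly k θ).natDegree <;> omega
    rcases hθ with hθ | hθ | hθ
    · have hgen : (minpoly k (IntermediateField.AdjoinSimple.gen k θ)).natDegree =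
          Module.finrank k (IntermediateField.adjoin k {θ}) := by
        rw [IntermediateField.minpoly_gen, hL]
      obtain ⟨ψ, hψ, hker⟩ := exists_dual_of_orthogonal hgen hφ
      have hψv : ∀ i, ψ (a * x i) = 0 := by
        refine fun i => hker _ fun j hj => ?_
        rw [hL, hθ] at hj
        rw [Algebra.smul_def, map_pow, IntermediateField.AdjoinSimple.algebraMap_gen]
        interval_cases j
        · simpa using (horth i).1
        · simpa using (horth i).2
      rcases HasZeroOfDegree.of_quartic hF_hom (hL.trans hθ) (by rw [hθ] at hLK; omega) hψ hv
        hψv hFv with h | h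
      exacts [⟨2, by simp, h⟩, ⟨4, by simp, h⟩]
    · have h := HasZeroOfDegree.of_quadratic (E := IntermediateField.adjoin k {θ}) hF_hom
        (by rw [hθ] at hLK; omega) hv hFv
      exact ⟨4, by simp, by rwa [hL, hθ] at h⟩
    · obtain ⟨s, hs, hs3, h⟩ := HasZeroOfDegree.of_orthogonal hF_hom (hθ.trans hdeg.symm) hφ
        (m := 2) (by omega) hv (fun i j hj => by
          interval_cases j
          · simpa using (horth i).1
          · simpa using (horth i).2) hFv (by omega) (by omega)
      rw [hdeg] at hs
      refine ⟨s, ?_, h⟩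
      simp only [Set.mem_insert_iff, Set.mem_singleton_iff]
      omega
  obtain ⟨n, hn, L, _, _, _, rfl, y, hy, hFy⟩ := key
  exact ⟨L, _, _, ‹_›, hn, y, hy, hFy⟩
end
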